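/- Let (A, m) be a two-dimensional regular local ring with infinite residue field, M ≠ (0) a finitely generated torsion-free A-module, F = M** of rank r > 0. Then the following are equivalent: (1) R(M) is a Buchsbaum ring and tilde(M) = bar(M); (2) R(M) is a Buchsbaum ring and Proj R(M) is normal; (3) m·bar(M) ⊆ M and M·bar(M) = M², where products are computed in S = Sym_A(F). When these hold, H^1_𝔐(R(M)) is concentrated in degree 1 with [H^1_𝔐(R(M))]_1 ≅ bar(M)/M, and bar(M^n) = M^n for every n ≥ 2. -/

import Mathlib

set_option maxHeartbeats 1000000
set_option synthInstance.maxHeartbeats 400000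

open MvPolynomial IsLocalRing

/-- The embedding of the free module `A^r` onto the degree-one part of the
polynomial ring `Sym_A(A^r) = A[t_1, ..., t_r]`, sending `f` to `∑ i, f i • X i`. -/
noncomputable abbrev emb (A : Type) [CommRing A] (r : ℕ) :
    (Fin r → A) →ₗ[A] MvPolynomial (Fin r) A :=
  Fintype.linearCombination A MvPolynomial.X

/-- The image `F₁` of the free module `F = A^r` inside `S = Sym_A(F)`. -/
noncomputable def freeSub (A : Type) [CommRing A] (r : ℕ) :
    Submodule A (MvPolynomial (Fin r) A) :=
  Submodule.map (emb A r) ⊤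

/-- The image `M₁` of a submodule `M ⊆ F` inside `S = Sym_A(F)`. -/
noncomputable def sub1 (A : Type) [CommRing A] (r : ℕ) (M : Submodule A (Fin r → A)) :
    Submodule A (MvPolynomial (Fin r) A) :=
  M.map (emb A r)

/-- The Rees algebra `R(M)` of `M ⊆ F`, i.e. the `A`-subalgebra of `S = Sym_A(F)`
generated by the degree-one part `M₁`; its `n`-th homogeneous component is `M₁ ^ n`. -/
noncomputable abbrev reesAlg (A : Type) [CommRing A] (r : ℕ) (M : Submodule A (Fin r → A)) :
    Subalgebra A (MvPolynomial (Fin r) A) :=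
  Algebra.adjoin A (sub1 A r M : Set (MvPolynomial (Fin r) A))

/-- The Ratliff--Rush closure `⋃_{ℓ > 0} [N^{ℓ+1} :_{Fn} N^ℓ]` of `N` (inside `Fn`),
where all powers and quotients of submodules are taken inside `S = Sym_A(F)`. -/
noncomputable def ratliffRush (A : Type) [CommRing A] (r : ℕ)
    (Fn N : Submodule A (MvPolynomial (Fin r) A)) : Submodule A (MvPolynomial (Fin r) A) :=
  ⨆ ℓ : ℕ, (Fn ⊓ (N ^ (ℓ + 2) / N ^ (ℓ + 1)))

/-- The positive part `R₊ = ker(constant term)` of a graded subalgebra `R₀ ⊆ S`. -/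
noncomputable def posPart (A : Type) [CommRing A] (r : ℕ)
    (R0 : Subalgebra A (MvPolynomial (Fin r) A)) : Ideal ↥R0 :=
  RingHom.ker ((MvPolynomial.constantCoeff).comp R0.val.toRingHom)

/-- `widetilde{R₀} = ε⁻¹(H⁰_{R₀₊}(S/R₀))`, i.e., the set of `x ∈ S` annihilated into `R₀`
by a power of the irrelevant ideal `R₀₊`; a graded subring of `S` containing `R₀`. -/
noncomputable def rrAlg (A : Type) [CommRing A] (r : ℕ)
    (R0 : Subalgebra A (MvPolynomial (Fin r) A)) : Subalgebra A (MvPolynomial (Fin r) A) where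
  carrier := {x | ∃ m : ℕ, ∀ y ∈ (posPart A r R0) ^ m,
    (y : MvPolynomial (Fin r) A) * x ∈ R0}
  mul_mem' := by
    rintro x₁ x₂ ⟨m₁, h₁⟩ ⟨m₂, h₂⟩
    refine ⟨m₁ + m₂, fun y hy => ?_⟩
    rw [pow_add] at hy
    refine Submodule.mul_induction_on hy (fun p hp q hq => ?_) (fun a b ha hb => ?_)
    · have : ((p * q : ↥R0) : MvPolynomial (Fin r) A) * (x₁ * x₂)
          = ((p : MvPolynomial (Fin r) A) * x₁) * ((q : MvPolynomial (Fin r) A) * x₂) := by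
        push_cast; ring
      rw [this]
      exact mul_mem (h₁ p hp) (h₂ q hq)
    · have : ((a + b : ↥R0) : MvPolynomial (Fin r) A) * (x₁ * x₂)
          = (a : MvPolynomial (Fin r) A) * (x₁ * x₂)
            + (b : MvPolynomial (Fin r) A) * (x₁ * x₂) := by
        push_cast; ring
      rw [this]
      exact add_mem ha hb
  one_mem' := ⟨0, fun y _ => by rw [mul_one]; exact y.2⟩
  add_mem' := by
    rintro x₁ x₂ ⟨m₁, h₁⟩ ⟨m₂, h₂⟩
    refine ⟨m₁ + m₂, fun y hy => ?_⟩
    rw [mul_add]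
    exact add_mem (h₁ y (Ideal.pow_le_pow_right (Nat.le_add_right _ _) hy))
      (h₂ y (Ideal.pow_le_pow_right (Nat.le_add_left _ _) hy))
  zero_mem' := ⟨0, fun y _ => by simpa using R0.zero_mem⟩
  algebraMap_mem' := fun a =>
    ⟨0, fun y _ => mul_mem y.2 (R0.algebraMap_mem a)⟩

/-- The integral closure of the Rees algebra `R(M)` inside `S = Sym_A(F)`,
viewed as an `A`-subalgebra of `S`. -/
noncomputable def intClAlg (A : Type) [CommRing A] (r : ℕ) (M : Submodule A (Fin r → A)) :
    Subalgebra A (MvPolynomial (Fin r) A) :=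
  (integralClosure (↥(reesAlg A r M)) (MvPolynomial (Fin r) A)).restrictScalars A

/-- The integral closure `overline{M^n}`: the `n`-th homogeneous component of the
integral closure of `R(M)` in `S`. -/
noncomputable def barPow (A : Type) [CommRing A] (r : ℕ) (M : Submodule A (Fin r → A))
    (n : ℕ) : Submodule A (MvPolynomial (Fin r) A) :=
  (freeSub A r) ^ n ⊓ (Subalgebra.toSubmodule (intClAlg A r M))

/-- `M` is a faithful `A`-module. -/
def faithfulSub (A : Type) [CommRing A] (r : ℕ) (M : Submodule A (Fin r → A)) : Prop :=
  ∀ a : A, (∀ x ∈ M, a • x = (0 : Fin r → A)) → a = 0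

/-- The length of an `A`-module, as the Krull dimension of its lattice of submodules. -/
noncomputable def modLength (A : Type) [CommRing A] (N : Type) [AddCommGroup N]
    [Module A N] : WithBot ℕ∞ :=
  Order.krullDim (Submodule A N)

/-- The quotient module `P/N` of two submodules of `S`. -/
abbrev quotNP (A : Type) [CommRing A] (r : ℕ)
    (N P : Submodule A (MvPolynomial (Fin r) A)) :=
  ↥P ⧸ (N.comap P.subtype)

/-- The minimal number of generators of a submodule. -/
noncomputable def minGen (A : Type) [CommRing A] {V : Type} [AddCommGroup V] [Module A V]
    (N : Submodule A V) : ℕ :=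
  sInf {n : ℕ | ∃ f : Fin n → V, Submodule.span A (Set.range f) = N}

/-- A Noetherian local ring is Cohen--Macaulay if its depth equals its Krull dimension,
i.e. there is a regular sequence in the maximal ideal whose length is the dimension. -/
def IsCohenMacaulayLocalRing (R : Type) [CommRing R] [IsLocalRing R] : Prop :=
  ∃ rs : List R, (∀ x ∈ rs, x ∈ maximalIdeal R) ∧
    RingTheory.Sequence.IsRegular R rs ∧ (rs.length : WithBot ℕ∞) = ringKrullDim R

/-- A Noetherian local ring is Buchsbaum (in the sense of Stückrad--Vogel) if every
system of parameters `x_1, …, x_d` is a weak sequence: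
`(x_1, …, x_{i-1}) : x_i ⊆ (x_1, …, x_{i-1}) : 𝔪` for all `i`. -/
def IsBuchsbaumLocalRing (R : Type) [CommRing R] [IsLocalRing R] : Prop :=
  ∀ d : ℕ, ringKrullDim R = d →
    ∀ x : Fin d → R, (∀ i, x i ∈ maximalIdeal R) →
      maximalIdeal R ≤ (Ideal.span (Set.range x)).radical →
      ∀ i : Fin d,
        (Ideal.span (x '' {j | j < i})).colon (Ideal.span {x i}) ≤
          (Ideal.span (x '' {j | j < i})).colon (maximalIdeal R)

/-- An ideal `P` of a graded subalgebra `R₀ ⊆ S` is graded (homogeneous) if it contains,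
together with any element, all of its homogeneous components. -/
def IsGradedIdeal (A : Type) [CommRing A] (r : ℕ)
    (R0 : Subalgebra A (MvPolynomial (Fin r) A)) (P : Ideal ↥R0) : Prop :=
  ∀ x : ↥R0, x ∈ P → ∀ n : ℕ,
    ∀ h : MvPolynomial.homogeneousComponent n (x : MvPolynomial (Fin r) A) ∈ R0,
      (⟨_, h⟩ : ↥R0) ∈ P

/-- The graded maximal ideal `𝔐 = 𝔪 R(M) + R(M)₊` of the Rees algebra, i.e. the
preimage of the maximal ideal under the degree-zero projection. -/
noncomputable abbrev gradedMax (A : Type) [CommRing A] [IsLocalRing A] (r : ℕ)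
    (M : Submodule A (Fin r → A)) : Ideal ↥(reesAlg A r M) :=
  Ideal.comap ((MvPolynomial.constantCoeff).comp (reesAlg A r M).val.toRingHom)
    (maximalIdeal A)


/-- The first local cohomology module `H^1_𝔐(R(M))` of the Rees algebra, viewed as an
`A`-module by restriction of scalars along `A → R(M)`. -/
noncomputable abbrev lcModA1 (A : Type) [CommRing A] [IsLocalRing A] (r : ℕ)
    (M : Submodule A (Fin r → A)) :=
  RestrictScalars A ↥(reesAlg A r M)
    ((localCohomology (gradedMax A r M) 1).obj
      (ModuleCat.of ↥(reesAlg A r M) ↥(reesAlg A r M)))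


section
set_option linter.all false
set_option autoImplicit false
open MvPolynomial IsLocalRing

section LocalTwoGen
variable {A : Type*} [CommRing A] [IsLocalRing A] [IsNoetherianRing A]

lemma rr_decomp {x z : A} (hm : Ideal.span {x, z} = maximalIdeal A) (u : A)
    (hu : u ∉ Ideal.span {z}) : ∃ (i : ℕ) (e w : A), IsUnit e ∧ u = e * x ^ i + z * w := by
  classical
  have hx : x ∈ maximalIdeal A := hm ▸ Ideal.subset_span (by simp)
  have hz : z ∈ maximalIdeal A := hm ▸ Ideal.subset_span (by simp)
  by_contra hcon
  push Not at hcon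
  have key : ∀ i : ℕ, ∃ e w, u = e * x ^ i + z * w := by
    intro i
    induction i with
    | zero => exact ⟨u, 0, by simp⟩
    | succ i ih =>
      obtain ⟨e, w, h⟩ := ih
      have he : ¬ IsUnit e := fun he => hcon i e w he h
      have he' : e ∈ maximalIdeal A := by simpa using he
      rw [← hm, Ideal.mem_span_pair] at he'
      obtain ⟨α, β, rfl⟩ := he'
      exact ⟨α, w + β * x ^ i, by rw [h]; ring⟩
  haveI : Nontrivial (A ⧸ Ideal.span {z}) := by
    apply Ideal.Quotient.nontrivial_iff.mpr
    intro h
    have : Ideal.span {z} ≤ maximalIdeal A := by rw [Ideal.span_le]; simpa using hz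
    rw [h] at this
    exact (maximalIdeal.isMaximal A).ne_top (top_le_iff.mp this)
  haveI : IsLocalRing (A ⧸ Ideal.span {z}) :=
    IsLocalRing.of_surjective' (Ideal.Quotient.mk _) Ideal.Quotient.mk_surjective
  set q := Ideal.Quotient.mk (Ideal.span {z})
  have hI : Ideal.span {q x} ≠ ⊤ := by
    intro h
    rw [Ideal.span_singleton_eq_top] at h
    obtain ⟨y, hy⟩ := h.exists_right_inv
    obtain ⟨y, rfl⟩ := Ideal.Quotient.mk_surjective y
    have : q (x * y - 1) = 0 := by
      rw [map_sub, map_mul]; exact sub_eq_zero.mpr (by simpa using hy)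
    rw [Ideal.Quotient.eq_zero_iff_mem] at this
    obtain ⟨c, hc⟩ := Ideal.mem_span_singleton'.mp this
    have h1 : (1 : A) = x * y - c * z := by rw [hc]; ring
    have : (1 : A) ∈ maximalIdeal A := by
      rw [h1]; exact sub_mem (Ideal.mul_mem_right _ _ hx) (Ideal.mul_mem_left _ _ hz)
    exact (maximalIdeal.isMaximal A).ne_top ((Ideal.eq_top_iff_one _).mpr this)
  have h0 := Ideal.iInf_pow_eq_bot_of_isLocalRing (Ideal.span {q x}) hI
  have : q u ∈ ⨅ i, Ideal.span {q x} ^ i := by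
    rw [Submodule.mem_iInf]
    intro i
    obtain ⟨e, w, h⟩ := key i
    rw [Ideal.span_singleton_pow, Ideal.mem_span_singleton']
    refine ⟨q e, ?_⟩
    have hqz : q z = 0 := Ideal.Quotient.eq_zero_iff_mem.mpr (Ideal.mem_span_singleton_self z)
    rw [h]; simp [hqz]
  rw [h0] at this
  exact hu (Ideal.Quotient.eq_zero_iff_mem.mp this)

/-- if no power of `x` lies in `(z)` then `z` generates a prime ideal. -/
lemma rr_isPrime {x z : A} (hm : Ideal.span {x, z} = maximalIdeal A)
    (h : ∀ k, x ^ k ∉ Ideal.span {z}) : (Ideal.span {z}).IsPrime := by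
  refine ⟨?_, ?_⟩
  · intro ht; exact h 0 (by rw [ht]; trivial)
  · intro u v huv
    by_contra hcon
    push Not at hcon
    obtain ⟨i, e, w, he, hu⟩ := rr_decomp hm u hcon.1
    obtain ⟨j, e', w', he', hv⟩ := rr_decomp hm v hcon.2
    apply h (i + j)
    have h1 : e * e' * x ^ (i + j) ∈ Ideal.span {z} := by
      have : e * e' * x ^ (i + j) = u * v - z * (w * v + e * x ^ i * w') := by
        rw [hu, hv]; ring
      rw [this]
      exact sub_mem huv (Ideal.mul_mem_right _ _ (Ideal.mem_span_singleton_self z))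
    obtain ⟨f, hf⟩ := (he.mul he').exists_left_inv
    have := Ideal.mul_mem_left _ f h1
    rwa [← mul_assoc, hf, one_mul] at this

/-- A prime not containing `x`, with `(x)` prime, is principal. -/
lemma rr_principal {x y : A} (hm : Ideal.span {x, y} = maximalIdeal A)
    (hx : (Ideal.span {x}).IsPrime) (P : Ideal A) [hP : P.IsPrime] (hxP : x ∉ P) :
    ∃ p, P = Ideal.span {p} := by
  classical
  by_cases hPx : P ≤ Ideal.span {x}
  · -- P = xP so P = 0
    have : P ≤ Ideal.span {x} • P := by
      intro u hu
      obtain ⟨c, hc⟩ := Ideal.mem_span_singleton'.mp (hPx hu)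
      have : c ∈ P := by
        rw [← hc] at hu
        exact (hP.mem_or_mem hu).resolve_right hxP
      rw [← hc, mul_comm]
      exact Submodule.smul_mem_smul (Ideal.mem_span_singleton_self x) this
    have h0 : P = ⊥ := by
      apply Submodule.eq_bot_of_le_smul_of_le_jacobson_bot (Ideal.span {x}) P
        (IsNoetherian.noetherian P) this
      rw [IsLocalRing.jacobson_eq_maximalIdeal _ bot_ne_top, Ideal.span_le]
      simpa using (hm ▸ Ideal.subset_span (by simp) : x ∈ maximalIdeal A)
    exact ⟨0, by rw [h0]; simp⟩
  · -- minimal i with  e y^i + x w ∈ P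
    have hm' : Ideal.span {y, x} = maximalIdeal A := by rw [Set.pair_comm]; exact hm
    have hex : ∃ i, ∃ w, y ^ i + x * w ∈ P := by
      obtain ⟨u, huP, hux⟩ := Set.not_subset.mp hPx
      obtain ⟨i, e, w, he, hu⟩ := rr_decomp hm' u hux
      obtain ⟨f, hf⟩ := he.exists_left_inv
      refine ⟨i, f * w, ?_⟩
      have := Ideal.mul_mem_left P f huP
      rw [hu] at this
      convert this using 1
      linear_combination (-(y ^ i)) * hf
    obtain ⟨w, hw⟩ := Nat.find_spec hex
    set i := Nat.find hex
    set p := y ^ i + x * w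
    refine ⟨p, le_antisymm ?_ (by rw [Ideal.span_le]; simpa using hw)⟩
    apply Submodule.le_of_le_smul_of_le_jacobson_bot (I := Ideal.span {x})
      (IsNoetherian.noetherian P)
    · rw [IsLocalRing.jacobson_eq_maximalIdeal _ bot_ne_top, Ideal.span_le]
      simpa using (hm ▸ Ideal.subset_span (by simp) : x ∈ maximalIdeal A)
    · intro u hu
      have main : ∃ c v, u = c * p + x * v := by
        by_cases hux : u ∈ Ideal.span {x}
        · obtain ⟨c, hc⟩ := Ideal.mem_span_singleton'.mp hux
          exact ⟨0, c, by rw [← hc]; ring⟩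
        · obtain ⟨j, e, w', he, hu'⟩ := rr_decomp hm' u hux
          obtain ⟨f, hf⟩ := he.exists_left_inv
          have hij : i ≤ j := by
            apply Nat.find_min'
            refine ⟨f * w', ?_⟩
            have := Ideal.mul_mem_left P f hu
            rw [hu'] at this
            convert this using 1
            linear_combination (-(y ^ j)) * hf
          obtain ⟨k, hk⟩ := Nat.exists_eq_add_of_le hij
          refine ⟨e * y ^ k, w' - e * y ^ k * w, ?_⟩
          rw [hu', hk]; simp only [p]; ring
      obtain ⟨c, v, huv⟩ := main
      have hv : v ∈ P := by
        have : x * v ∈ P := by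
          have : x * v = u - c * p := by rw [huv]; ring
          rw [this]; exact sub_mem hu (Ideal.mul_mem_left _ _ hw)
        exact (hP.mem_or_mem this).resolve_left hxP
      rw [huv]
      exact Submodule.add_mem_sup (Ideal.mul_mem_left _ _ (Ideal.mem_span_singleton_self p))
        (Submodule.smul_mem_smul (Ideal.mem_span_singleton_self x) hv)

lemma rr_ufd [IsDomain A] {x y : A} (hm : Ideal.span {x, y} = maximalIdeal A) (hx : Prime x) :
    UniqueFactorizationMonoid A := by
  rw [UniqueFactorizationMonoid.iff_exists_prime_mem_of_isPrime]
  intro P hP hPp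
  by_cases hxP : x ∈ P
  · exact ⟨x, hxP, hx⟩
  · obtain ⟨p, rfl⟩ := rr_principal hm ((Ideal.span_singleton_prime hx.ne_zero).mpr hx) P hxP
    have hp0 : p ≠ 0 := by rintro rfl; simp at hP
    exact ⟨p, Ideal.mem_span_singleton_self p, (Ideal.span_singleton_prime hp0).mp hPp⟩

/-- Change of generators. -/
lemma rr_prime_of_gens [IsDomain A] {x y : A} (hm : Ideal.span {x, y} = maximalIdeal A)
    (hx : Prime x) (hnp : ¬ (maximalIdeal A = Ideal.span {x})) (lam : A) :
    Prime (y - lam * x) := by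
  set z := y - lam * x with hz
  have hmz : Ideal.span {x, z} = maximalIdeal A := by
    rw [← hm, hz]
    apply le_antisymm <;> rw [Ideal.span_le] <;> rintro w (rfl | rfl)
    · exact Ideal.subset_span (by simp)
    · exact sub_mem (Ideal.subset_span (by simp))
        (Ideal.mul_mem_left _ _ (Ideal.subset_span (by simp)))
    · exact Ideal.subset_span (by simp)
    · rw [SetLike.mem_coe, Ideal.mem_span_pair]
      exact ⟨lam, 1, by ring⟩
  have hyx : z ∉ Ideal.span {x} := by
    intro h
    apply hnp
    rw [← hmz]
    apply le_antisymm
    · rw [Ideal.span_le]; rintro w (rfl | rfl)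
      · exact Ideal.mem_span_singleton_self _
      · exact h
    · exact Ideal.span_mono (by simp)
  have hz0 : z ≠ 0 := by intro h; exact hyx (by rw [h]; exact zero_mem _)
  rw [← Ideal.span_singleton_prime hz0]
  apply rr_isPrime hmz
  intro k hk
  rw [Ideal.mem_span_singleton] at hk
  obtain ⟨i, hi, hass⟩ := (dvd_prime_pow hx k).mp hk
  rcases Nat.eq_zero_or_pos i with rfl | hpos
  · have : IsUnit z := by
      rw [pow_zero] at hass; exact hass.symm.isUnit isUnit_one
    have hzm : z ∈ maximalIdeal A := hmz ▸ Ideal.subset_span (by simp)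
    exact hzm this
  · apply hyx
    rw [Ideal.mem_span_singleton]
    exact (dvd_pow_self x hpos.ne').trans hass.symm.dvd

end LocalTwoGen
end

section
set_option linter.all false
set_option autoImplicit false
open MvPolynomial IsLocalRing

section VCl
variable {K : Type*} [Field K]

/-- intersection of all valuation rings containing `s`. -/
def vcl (s : Set K) : Subring K :=
  ⨅ V : {V : ValuationSubring K // s ⊆ V.toSubring}, V.1.toSubring

lemma mem_vcl {s : Set K} {z : K} :
    z ∈ vcl s ↔ ∀ V : ValuationSubring K, s ⊆ (V : Set K) → z ∈ V := by
  simp only [vcl, Subring.mem_iInf, Subtype.forall]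
  exact Iff.rfl

lemma mem_vcl_iff {s : Set K} {z : K} :
    z ∈ vcl s ↔ IsIntegral (Subring.closure s) z := by
  rw [vcl, iInf_valuationSubring_superset]
  exact Iff.rfl

lemma vcl_mono {s t : Set K} (h : s ⊆ t) : vcl s ≤ vcl t := fun z hz =>
  mem_vcl.mpr fun V hV => mem_vcl.mp hz V (h.trans hV)

lemma subset_vcl (s : Set K) : s ⊆ vcl s := fun z hz => mem_vcl.mpr fun V hV => hV hz

/-- A monic equation with coefficients in a valuation ring. -/
lemma val_of_eq (V : ValuationSubring K) {z : K} (n : ℕ) (c : ℕ → K)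
    (hc : ∀ i < n, c i ∈ V) (h : z ^ n = ∑ i ∈ Finset.range n, c i * z ^ i) : z ∈ V := by
  by_contra hz
  have hz0 : z ≠ 0 := by rintro rfl; exact hz V.zero_mem
  have hzi : z⁻¹ ∈ V := (V.mem_or_inv_mem z).resolve_left hz
  rcases Nat.eq_zero_or_pos n with rfl | hn
  · simp at h
  apply hz
  have : z = ∑ i ∈ Finset.range n, c i * (z⁻¹) ^ (n - 1 - i) := by
    have h2 : z ^ (n - 1) * z = z ^ (n - 1) *
        ∑ i ∈ Finset.range n, c i * (z⁻¹) ^ (n - 1 - i) := by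
      rw [← pow_succ, Nat.sub_add_cancel hn, h, Finset.mul_sum]
      refine Finset.sum_congr rfl fun i hi => ?_
      have hi' : i ≤ n - 1 := Nat.le_sub_one_of_lt (Finset.mem_range.mp hi)
      have : z ^ (n - 1) = z ^ (n - 1 - i) * z ^ i := by rw [← pow_add, Nat.sub_add_cancel hi']
      rw [this, inv_pow]; field_simp
    exact mul_left_cancel₀ (pow_ne_zero _ hz0) h2
  rw [this]
  exact sum_mem fun i hi => mul_mem (hc i (Finset.mem_range.mp hi)) (pow_mem hzi _)

lemma exists_eq_of_mem_vcl {s : Set K} {z : K} (h : z ∈ vcl s) :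
    ∃ (n : ℕ) (c : ℕ → K), (∀ i, c i ∈ Subring.closure s) ∧
      z ^ n = ∑ i ∈ Finset.range n, c i * z ^ i := by
  rw [mem_vcl_iff] at h
  obtain ⟨p, hp, hz⟩ := h
  refine ⟨p.natDegree, fun i => -(p.coeff i : K), fun i => neg_mem (p.coeff i).2, ?_⟩
  rw [Polynomial.eval₂_eq_sum_range, Finset.sum_range_succ, hp.coeff_natDegree] at hz
  simp only [map_one, one_mul] at hz
  rw [add_comm] at hz
  rw [eq_neg_of_add_eq_zero_left hz, ← Finset.sum_neg_distrib]
  exact Finset.sum_congr rfl fun i hi => by rw [neg_mul]; rfl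

/-- clearing denominators in an integral equation -/
lemma vcl_clear {s s' : Set K} (Sg : Submonoid K) (hSg : ∀ σ ∈ Sg, σ ∈ vcl s')
    (h : ∀ d ∈ Subring.closure s, ∃ σ ∈ Sg, σ * d ∈ vcl s') {z : K} (hz : z ∈ vcl s) :
    ∃ σ ∈ Sg, σ * z ∈ vcl s' := by
  obtain ⟨n, c, hc, heq⟩ := exists_eq_of_mem_vcl hz
  choose! σ hσ hσc using h
  refine ⟨∏ i ∈ Finset.range n, σ (c i), Submonoid.prod_mem _ fun i _ => hσ _ (hc i), ?_⟩
  set τ := ∏ i ∈ Finset.range n, σ (c i) with hτ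
  have hτm : τ ∈ vcl s' := hSg _ (Submonoid.prod_mem _ fun i _ => hσ _ (hc i))
  have hτc : ∀ i < n, τ * c i ∈ vcl s' := by
    intro i hi
    rw [hτ, ← Finset.mul_prod_erase _ _ (Finset.mem_range.mpr hi)]
    have : σ (c i) * (∏ x ∈ (Finset.range n).erase i, σ (c x)) * c i =
      (∏ x ∈ (Finset.range n).erase i, σ (c x)) * (σ (c i) * c i) := by ring
    rw [this]
    exact mul_mem (Subring.prod_mem _ fun j _ => hSg _ (hσ _ (hc j))) (hσc _ (hc i))
  rw [mem_vcl]
  intro V hV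
  refine val_of_eq V n (fun i => τ ^ (n - i) * c i) ?_ ?_
  · intro i hi
    have : τ ^ (n - i) * c i = τ ^ (n - i - 1) * (τ * c i) := by
      rw [← mul_assoc, ← pow_succ]; congr 2; omega
    rw [this]
    exact mul_mem (pow_mem (mem_vcl.mp hτm V hV) _) (mem_vcl.mp (hτc i hi) V hV)
  · rw [mul_pow, heq, Finset.mul_sum]
    refine Finset.sum_congr rfl fun i hi => ?_
    have hi' : i ≤ n := (Finset.mem_range.mp hi).le
    have : τ ^ n = τ ^ (n - i) * τ ^ i := by rw [← pow_add, Nat.sub_add_cancel hi']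
    rw [this, mul_pow]; ring

/-- the decomposition property -/
def HDec (A : Subring K) (f : K) : Prop :=
  ∀ z ∈ vcl ((A : Set K) ∪ {f, f⁻¹}), ∃ p ∈ vcl ((A : Set K) ∪ {f}),
    ∃ q ∈ vcl ((A : Set K) ∪ {f⁻¹}), z = p + q

lemma HDec.symm {A : Subring K} {f : K} (h : HDec A f) : HDec A f⁻¹ := by
  intro z hz
  rw [inv_inv, Set.pair_comm] at hz
  obtain ⟨p, hp, q, hq, rfl⟩ := h z hz
  exact ⟨q, hq, p, by rwa [inv_inv], add_comm _ _⟩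

lemma HDec.of_mem {A : Subring K} {f : K} (h : f ∈ A) : HDec A f := by
  intro z hz
  refine ⟨0, zero_mem _, z, vcl_mono ?_ hz |> fun h => h, by simp⟩ <;>
  · rintro w (hw | rfl | rfl)
    · exact Or.inl hw
    · exact Or.inl h
    · exact Or.inr rfl

lemma HDec.of_mem_or {A : Subring K} {f : K} (h : f ∈ A ∨ f⁻¹ ∈ A) : HDec A f := by
  rcases h with h | h
  · exact HDec.of_mem h
  · have := (HDec.of_mem h).symm; rwa [inv_inv] at this

/-- `A[t]` inside `K` -/
noncomputable def bl (A : Subring K) (t : K) : Subring K :=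
  (Polynomial.aeval (R := A) t : Polynomial A →+* K).range

lemma mem_bl {A : Subring K} {t z : K} :
    z ∈ bl A t ↔ ∃ p : Polynomial A, Polynomial.aeval t p = z := Iff.rfl

lemma le_bl (A : Subring K) (t : K) : A ≤ bl A t := fun a ha =>
  ⟨Polynomial.C ⟨a, ha⟩, by simp; rfl⟩

lemma self_mem_bl (A : Subring K) (t : K) : t ∈ bl A t := ⟨Polynomial.X, by simp⟩

lemma bl_le {A B : Subring K} {t : K} (h : A ≤ B) (ht : t ∈ B) : bl A t ≤ B := by
  rintro z ⟨p, rfl⟩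
  simp only [RingHom.coe_coe]
  rw [Polynomial.aeval_eq_sum_range]
  refine sum_mem fun i _ => ?_
  exact mul_mem (h (p.coeff i).2) (pow_mem ht _)

lemma closure_union_singleton (A : Subring K) (t : K) :
    Subring.closure ((A : Set K) ∪ {t}) = bl A t := by
  apply le_antisymm
  · rw [Subring.closure_le]
    rintro z (h | rfl)
    · exact le_bl A t h
    · exact self_mem_bl A _
  · exact bl_le (fun a ha => Subring.subset_closure (Or.inl ha))
      (Subring.subset_closure (Or.inr rfl))

/-- glueing step along a blow up. -/
lemma HDec.glue {A : Subring K} {f t : K}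
    (hD : ∀ z ∈ vcl ((A : Set K) ∪ {t, t⁻¹}), ∃ β ∈ bl A t, ∃ γ ∈ bl A t⁻¹, z = β + γ)
    (hB : HDec (bl A t) f) (hC : HDec (bl A t⁻¹) f) : HDec A f := by
  intro z hz
  have up : ∀ (B : Subring K) (s : Set K), A ≤ B → vcl ((A : Set K) ∪ s) ≤ vcl ((B : Set K) ∪ s) :=
    fun B s h => vcl_mono (Set.union_subset_union_left _ h)
  obtain ⟨p, hp, q, hq, h1⟩ := hB z (up _ _ (le_bl A t) hz)
  obtain ⟨p', hp', q', hq', h2⟩ := hC z (up _ _ (le_bl A _) hz)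
  have hV : ∀ (V : ValuationSubring K) (u : K) (s : Set K), ((A : Set K) ∪ s ⊆ V) → u ∈ V →
      ((bl A u : Set K) ∪ s ⊆ V) := by
    intro V u s h1 h2
    apply Set.union_subset
    · have : bl A u ≤ V.toSubring := bl_le (fun a ha => h1 (Or.inl ha)) h2
      exact this
    · exact Set.subset_union_right.trans h1
  have hd : p - p' ∈ vcl ((A : Set K) ∪ {t, t⁻¹}) := by
    rw [mem_vcl]
    intro V h
    have ht : t ∈ V := h (by simp)
    have ht' : t⁻¹ ∈ V := h (by simp)
    have hA : (A : Set K) ⊆ V := Set.subset_union_left.trans h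
    rcases V.mem_or_inv_mem f with hf | hf
    · have hs : (A : Set K) ∪ {f} ⊆ V := Set.union_subset hA (by simpa using hf)
      exact sub_mem (mem_vcl.mp hp V (hV V t _ hs ht)) (mem_vcl.mp hp' V (hV V _ _ hs ht'))
    · have hs : (A : Set K) ∪ {f⁻¹} ⊆ V := Set.union_subset hA (by simpa using hf)
      have : p - p' = q' - q := by
        have := h1.symm.trans h2; linear_combination this
      rw [this]
      exact sub_mem (mem_vcl.mp hq' V (hV V _ _ hs ht')) (mem_vcl.mp hq V (hV V _ _ hs ht))
  obtain ⟨β, hβ, γ, hγ, h3⟩ := hD _ hd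
  refine ⟨p - β, ?_, q + β, ?_, by rw [h1]; ring⟩
  · rw [mem_vcl]
    intro V hs
    rcases V.mem_or_inv_mem t with ht | ht
    · exact sub_mem (mem_vcl.mp hp V (hV V t _ hs ht)) (hV V t _ hs ht (Or.inl hβ))
    · have : p - β = p' + γ := by linear_combination h3
      rw [this]
      exact add_mem (mem_vcl.mp hp' V (hV V _ _ hs ht)) (hV V _ _ hs ht (Or.inl hγ))
  · rw [mem_vcl]
    intro V hs
    rcases V.mem_or_inv_mem t with ht | ht
    · exact add_mem (mem_vcl.mp hq V (hV V t _ hs ht)) (hV V t _ hs ht (Or.inl hβ))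
    · have : q + β = q' - γ := by
        have := h1.symm.trans h2
        linear_combination this - h3
      rw [this]
      exact sub_mem (mem_vcl.mp hq' V (hV V _ _ hs ht)) (hV V _ _ hs ht (Or.inl hγ))

/-- elements of the localization -/
lemma mem_ofPrime {B : Subring K} {Q : Ideal B} [Q.IsPrime] {z : K} :
    z ∈ (LocalSubring.ofPrime B Q).toSubring ↔ ∃ b s : B, s ∉ Q ∧ (s : K) * z = b := by
  constructor
  · intro hz
    obtain ⟨⟨b, s⟩, h⟩ := IsLocalization.surj Q.primeCompl
      (⟨z, hz⟩ : (LocalSubring.ofPrime B Q).toSubring)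
    refine ⟨b, s, s.2, ?_⟩
    have := congrArg Subtype.val h
    rw [mul_comm]
    exact this
  · rintro ⟨b, s, hs, h⟩
    have hu := IsLocalization.map_units (LocalSubring.ofPrime B Q).toSubring
      (⟨s, hs⟩ : Q.primeCompl)
    obtain ⟨v, hv⟩ := hu.exists_left_inv
    have hv' : (v : K) * s = 1 := congrArg Subtype.val hv
    have : z = v * b := by rw [← h, ← mul_assoc, hv', one_mul]
    rw [this]
    exact mul_mem v.2 (LocalSubring.le_ofPrime B Q b.2)

lemma HDec.of_loc_primes {B : Subring K} {f : K}
    (h : ∀ (Q : Ideal B) [Q.IsMaximal], HDec (LocalSubring.ofPrime B Q).toSubring f) :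
    HDec B f := by
  intro z hz
  let I : Ideal B :=
    { carrier := {s | ∃ p ∈ vcl ((B : Set K) ∪ {f}), ∃ q ∈ vcl ((B : Set K) ∪ {f⁻¹}),
        (s : K) * z = p + q}
      add_mem' := by
        rintro a b ⟨p, hp, q, hq, h⟩ ⟨p', hp', q', hq', h'⟩
        exact ⟨p + p', add_mem hp hp', q + q', add_mem hq hq', by
          push_cast; rw [add_mul, h, h']; ring⟩
      zero_mem' := ⟨0, zero_mem _, 0, zero_mem _, by simp⟩
      smul_mem' := by
        rintro c a ⟨p, hp, q, hq, h⟩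
        exact ⟨c * p, mul_mem (subset_vcl _ (Or.inl c.2)) hp, c * q,
          mul_mem (subset_vcl _ (Or.inl c.2)) hq, by
          simp only [smul_eq_mul]; push_cast; rw [mul_assoc, h]; ring⟩ }
  by_cases hI : I = ⊤
  · have : (1 : B) ∈ I := by rw [hI]; trivial
    obtain ⟨p, hp, q, hq, h⟩ := this
    exact ⟨p, hp, q, hq, by simpa using h⟩
  · exfalso
    obtain ⟨Q, hQ, hIQ⟩ := Ideal.exists_le_maximal I hI
    have hle := LocalSubring.le_ofPrime B Q
    obtain ⟨p, hp, q, hq, hpq⟩ := h Q z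
      (vcl_mono (Set.union_subset_union_left _ hle) hz)
    let Sg : Submonoid K := Submonoid.map B.subtype Q.primeCompl
    have clear : ∀ (g : K) (u : K),
        u ∈ vcl (((LocalSubring.ofPrime B Q).toSubring : Set K) ∪ {g}) →
        ∃ σ ∈ Sg, σ * u ∈ vcl ((B : Set K) ∪ {g}) := by
      intro g u hu
      refine vcl_clear Sg ?_ ?_ hu
      · rintro _ ⟨s, hs, rfl⟩
        exact subset_vcl _ (Or.inl s.2)
      · rw [closure_union_singleton]
        rintro d ⟨P, rfl⟩
        simp only [RingHom.coe_coe]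
        induction P using Polynomial.induction_on' with
        | add P1 P2 h1 h2 =>
          obtain ⟨σ1, hσ1, h1⟩ := h1
          obtain ⟨σ2, hσ2, h2⟩ := h2
          refine ⟨σ1 * σ2, mul_mem hσ1 hσ2, ?_⟩
          rw [map_add, mul_add]
          have sm : ∀ σ ∈ Sg, σ ∈ vcl ((B : Set K) ∪ {g}) := by
            rintro _ ⟨s, hs, rfl⟩
            exact subset_vcl _ (Or.inl s.2)
          refine add_mem ?_ ?_
          · rw [mul_comm σ1, mul_assoc]; exact mul_mem (sm _ hσ2) h1
          · rw [mul_assoc]; exact mul_mem (sm _ hσ1) h2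
        | monomial n a =>
          obtain ⟨b, s, hs, hb⟩ := mem_ofPrime.mp a.2
          refine ⟨s, ⟨s, hs, rfl⟩, ?_⟩
          rw [Polynomial.aeval_monomial, ← mul_assoc]
          have : (s : K) * (algebraMap _ K a) = b := hb
          rw [this]
          exact mul_mem (subset_vcl _ (Or.inl b.2))
            (pow_mem (subset_vcl _ (Set.mem_union_right _ (Set.mem_singleton g))) _)
    obtain ⟨_, ⟨s, hs, rfl⟩, h1⟩ := clear f p hp
    obtain ⟨_, ⟨s', hs', rfl⟩, h2⟩ := clear f⁻¹ q hq
    have : s * s' ∈ I := by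
      refine ⟨s' * (s * p), mul_mem (subset_vcl _ (Or.inl s'.2)) h1, s * (s' * q),
        mul_mem (subset_vcl _ (Or.inl s.2)) h2, ?_⟩
      rw [hpq]; push_cast; ring
    rcases hQ.isPrime.mem_or_mem (hIQ this) with h | h
    · exact hs h
    · exact hs' h

end VCl
end

section
set_option linter.all false
set_option autoImplicit false
open MvPolynomial IsLocalRing

section BlowUp
variable {K : Type*} [Field K]

/-- the class of rings used in the induction -/
structure RRC (A : Subring K) : Prop where
  loc : IsLocalRing A
  noeth : IsNoetherianRing A
  frac : ∀ z : K, ∃ a b : A, (b : K) ≠ 0 ∧ z = a / b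
  gens : ∃ x y : A, Ideal.span {x, y} = maximalIdeal A ∧ Prime x
  inf : Infinite (ResidueField A)

variable {A : Subring K} [IsLocalRing A] [IsNoetherianRing A]

lemma bl_quasi {x y : A} (hm : Ideal.span {x, y} = maximalIdeal A) (hx : Prime x)
    (hyx : y ∉ Ideal.span {x}) {t : K} (ht : (x : K) * t = y) (n : ℕ) :
    ∀ p : Polynomial A, p.natDegree ≤ n → Polynomial.aeval t p = 0 → p.map (residue A) = 0 := by
  have hx0 : (x : K) ≠ 0 := by
    intro h; exact hx.ne_zero (Subtype.ext h)
  have hxm : x ∈ maximalIdeal A := hm ▸ Ideal.subset_span (by simp)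
  have hym : y ∈ maximalIdeal A := hm ▸ Ideal.subset_span (by simp)
  induction n with
  | zero =>
    intro p hp h
    rw [Polynomial.eq_C_of_natDegree_le_zero hp] at h ⊢
    rw [Polynomial.aeval_C] at h
    have : p.coeff 0 = 0 := Subtype.ext h
    simp [this]
  | succ n ih =>
    intro p hp h
    -- leading coefficient divisible by x
    have h1 : ∑ i ∈ Finset.range (n + 2), p.coeff i * x ^ (n + 1 - i) * y ^ i = 0 := by
      apply Subtype.ext
      push_cast
      have : ((x : K) ^ (n + 1)) * Polynomial.aeval t p = 0 := by rw [h, mul_zero]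
      rw [Polynomial.aeval_eq_sum_range' (n := n + 2) (by omega), Finset.mul_sum] at this
      rw [← this]
      refine Finset.sum_congr rfl fun i hi => ?_
      have hi' : i ≤ n + 1 := by have := Finset.mem_range.mp hi; omega
      rw [← ht, mul_pow]
      have h3 : (x : K) ^ (n + 1) = (x : K) ^ (n + 1 - i) * (x : K) ^ i := by
        rw [← pow_add, Nat.sub_add_cancel hi']
      rw [h3]
      have : p.coeff i • t ^ i = (p.coeff i : K) * t ^ i := rfl
      rw [this]; ring
    have h2 : x ∣ p.coeff (n + 1) * y ^ (n + 1) := by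
      rw [Finset.sum_range_succ] at h1
      simp only [Nat.sub_self, pow_zero, mul_one] at h1
      rw [eq_neg_of_add_eq_zero_right h1]
      refine (dvd_neg).mpr (Finset.dvd_sum fun i hi => ?_)
      have hi' : i < n + 1 := Finset.mem_range.mp hi
      exact Dvd.dvd.mul_right (Dvd.dvd.mul_left (dvd_pow_self x (by omega)) _) _
    have h3 : x ∣ p.coeff (n + 1) := by
      rcases hx.dvd_or_dvd h2 with h | h
      · exact h
      · exact absurd (Ideal.mem_span_singleton.mpr (hx.dvd_of_dvd_pow h)) hyx
    obtain ⟨d, hd⟩ := h3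
    set l : Polynomial A := Polynomial.C d * Polynomial.X ^ n *
      (Polynomial.C x * Polynomial.X - Polynomial.C y) with hl
    have hlt : Polynomial.aeval t l = 0 := by
      rw [hl]; simp only [map_mul, map_sub, Polynomial.aeval_C, Polynomial.aeval_X]
      have : (algebraMap A K x) * t - algebraMap A K y = 0 := sub_eq_zero.mpr ht
      rw [this, mul_zero]
    have hlm : l.map (residue A) = 0 := by
      rw [hl]; simp only [Polynomial.map_mul, Polynomial.map_sub, Polynomial.map_C]
      rw [(residue_eq_zero_iff x).mpr hxm, (residue_eq_zero_iff y).mpr hym]; simp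
    have hl' : l = Polynomial.C (d * x) * Polynomial.X ^ (n + 1)
        - Polynomial.C (d * y) * Polynomial.X ^ n := by
      rw [hl]; simp only [Polynomial.C_mul]; ring
    have hdeg : (p - l).natDegree ≤ n := by
      rw [Polynomial.natDegree_le_iff_coeff_eq_zero]
      intro N hN
      rw [Polynomial.coeff_sub, hl', Polynomial.coeff_sub, Polynomial.coeff_C_mul_X_pow,
        Polynomial.coeff_C_mul_X_pow]
      by_cases hN1 : N = n + 1
      · subst hN1; simp [hd, mul_comm]
      · rw [if_neg hN1, if_neg (by omega), Polynomial.coeff_eq_zero_of_natDegree_lt (by omega)]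
        simp
    have := ih (p - l) hdeg (by rw [map_sub, h, hlt, sub_zero])
    rwa [Polynomial.map_sub, hlm, sub_zero] at this

lemma bl_dvd_iff {x y : A} (hm : Ideal.span {x, y} = maximalIdeal A) (hx : Prime x)
    (hyx : y ∉ Ideal.span {x}) {t : K} (ht : (x : K) * t = y) (p : Polynomial A) :
    (∃ b ∈ bl A t, Polynomial.aeval t p = x * b) ↔ p.map (residue A) = 0 := by
  have hxm : x ∈ maximalIdeal A := hm ▸ Ideal.subset_span (by simp)
  constructor
  · rintro ⟨_, ⟨q, rfl⟩, h⟩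
    have : Polynomial.aeval t (p - Polynomial.C x * q) = 0 := by
      rw [map_sub, h, map_mul, Polynomial.aeval_C]; exact sub_self _
    have := bl_quasi hm hx hyx ht _ _ le_rfl this
    rwa [Polynomial.map_sub, Polynomial.map_mul, Polynomial.map_C,
      (residue_eq_zero_iff x).mpr hxm, map_zero, zero_mul, sub_zero] at this
  · intro h
    have hc : ∀ i, ∃ b ∈ bl A t, (p.coeff i : K) = x * b := by
      intro i
      have h1 : residue A (p.coeff i) = 0 := by
        rw [← Polynomial.coeff_map, h, Polynomial.coeff_zero]
      have h2 := (residue_eq_zero_iff _).mp h1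
      rw [← hm, Ideal.mem_span_pair] at h2
      obtain ⟨α, β, hab⟩ := h2
      refine ⟨α + β * t, add_mem (le_bl A t α.2) (mul_mem (le_bl A t β.2) (self_mem_bl A t)), ?_⟩
      rw [← hab]; push_cast; rw [← ht]; ring
    choose b hb hbc using hc
    refine ⟨∑ i ∈ Finset.range (p.natDegree + 1), b i * t ^ i,
      sum_mem fun i _ => mul_mem (hb i) (pow_mem (self_mem_bl A t) _), ?_⟩
    rw [Polynomial.aeval_eq_sum_range, Finset.mul_sum]
    refine Finset.sum_congr rfl fun i _ => ?_
    have : p.coeff i • t ^ i = (p.coeff i : K) * t ^ i := rfl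
    rw [this, hbc]; ring

lemma mem_closure_pair {t : K} (ht0 : t ≠ 0) {d : K}
    (hd : d ∈ Subring.closure ((A : Set K) ∪ {t, t⁻¹})) :
    ∃ (p : Polynomial A) (k : ℕ), t ^ k * d = Polynomial.aeval t p := by
  induction hd using Subring.closure_induction with
  | mem z hz =>
    rcases hz with hz | rfl | rfl
    · exact ⟨Polynomial.C ⟨z, hz⟩, 0, by simp; rfl⟩
    · exact ⟨Polynomial.X, 0, by simp⟩
    · exact ⟨1, 1, by simp [ht0]⟩
  | zero => exact ⟨0, 0, by simp⟩
  | one => exact ⟨1, 0, by simp⟩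
  | add a b _ _ ha hb =>
    obtain ⟨p, k, h⟩ := ha
    obtain ⟨q, l, h'⟩ := hb
    refine ⟨Polynomial.X ^ l * p + Polynomial.X ^ k * q, k + l, ?_⟩
    simp only [map_add, map_mul, map_pow, Polynomial.aeval_X, ← h, ← h']; ring
  | mul a b _ _ ha hb =>
    obtain ⟨p, k, h⟩ := ha
    obtain ⟨q, l, h'⟩ := hb
    refine ⟨p * q, k + l, ?_⟩
    simp only [map_mul, ← h, ← h']; ring
  | neg a _ ha =>
    obtain ⟨p, k, h⟩ := ha
    exact ⟨-p, k, by rw [map_neg, ← h]; ring⟩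

lemma closure_pair_split {t : K} (ht0 : t ≠ 0) {d : K}
    (hd : d ∈ Subring.closure ((A : Set K) ∪ {t, t⁻¹})) :
    ∃ β ∈ bl A t, ∃ γ ∈ bl A t⁻¹, d = β + γ := by
  obtain ⟨p, k, h⟩ := mem_closure_pair ht0 hd
  have hd' : d = (t⁻¹) ^ k * Polynomial.aeval t p := by
    rw [← h, ← mul_assoc, ← mul_pow, inv_mul_cancel₀ ht0, one_pow, one_mul]
  clear h hd
  subst hd'
  induction p using Polynomial.induction_on' with
  | add P Q hP hQ =>
    obtain ⟨b, hb, c, hc, h⟩ := hP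
    obtain ⟨b', hb', c', hc', h'⟩ := hQ
    exact ⟨b + b', add_mem hb hb', c + c', add_mem hc hc', by rw [map_add, mul_add, h, h']; ring⟩
  | monomial n a =>
    rw [Polynomial.aeval_monomial]
    rcases le_total n k with hnk | hnk
    · refine ⟨0, zero_mem _, (a : K) * (t⁻¹) ^ (k - n), mul_mem (le_bl _ _ a.2)
        (pow_mem (self_mem_bl _ _) _), ?_⟩
      obtain ⟨j, rfl⟩ := Nat.exists_eq_add_of_le hnk
      have : algebraMap A K a = (a : K) := rfl
      simp only [inv_pow]
      rw [this, Nat.add_sub_cancel_left, pow_add]; field_simp; try ring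
    · refine ⟨(a : K) * t ^ (n - k), mul_mem (le_bl _ _ a.2)
        (pow_mem (self_mem_bl _ _) _), 0, zero_mem _, ?_⟩
      obtain ⟨j, rfl⟩ := Nat.exists_eq_add_of_le hnk
      have : algebraMap A K a = (a : K) := rfl
      simp only [inv_pow]
      rw [this, Nat.add_sub_cancel_left, pow_add]; field_simp; try ring

lemma vcl_of_normal {x y : A} (hm : Ideal.span {x, y} = maximalIdeal A) (hx : Prime x)
    (hfrac : ∀ z : K, ∃ a b : A, (b : K) ≠ 0 ∧ z = a / b) : vcl (A : Set K) = A := by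
  have := rr_ufd hm hx
  haveI : IsFractionRing A K := by
    refine ⟨?_, ?_, ?_⟩
    · rintro ⟨b, hb⟩
      have : b ≠ 0 := nonZeroDivisors.ne_zero hb
      exact (Ne.isUnit (by intro h; exact this (Subtype.ext h)))
    · intro z
      obtain ⟨a, b, hb, rfl⟩ := hfrac z
      refine ⟨⟨a, ⟨b, mem_nonZeroDivisors_of_ne_zero (by rintro rfl; exact hb rfl)⟩⟩, ?_⟩
      exact div_mul_cancel₀ _ hb
    · intro a b h; exact ⟨1, by rw [Subtype.ext h]⟩
  apply le_antisymm
  · intro z hz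
    rw [mem_vcl_iff, Subring.closure_eq] at hz
    obtain ⟨a, ha⟩ := (IsIntegrallyClosed.isIntegral_iff (R := A) (K := K)).mp hz
    rw [← ha]; exact a.2
  · exact subset_vcl _

lemma bl_split {x y : A} (hm : Ideal.span {x, y} = maximalIdeal A) (hx : Prime x)
    (hyx : y ∉ Ideal.span {x}) {t : K} (ht : (x : K) * t = y)
    (hfrac : ∀ z : K, ∃ a b : A, (b : K) ≠ 0 ∧ z = a / b) :
    ∀ z ∈ vcl ((A : Set K) ∪ {t, t⁻¹}), ∃ β ∈ bl A t, ∃ γ ∈ bl A t⁻¹, z = β + γ := by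
  intro z hz
  have hx0 : (x : K) ≠ 0 := by
    intro h; exact hx.ne_zero (Subtype.ext h)
  have hy0 : (y : K) ≠ 0 := by
    intro h; apply hyx; rw [show y = 0 from Subtype.ext h]; exact zero_mem _
  have ht0 : t ≠ 0 := by rintro rfl; rw [mul_zero] at ht; exact hy0 ht.symm
  apply closure_pair_split ht0
  set D := Subring.closure ((A : Set K) ∪ {t, t⁻¹}) with hD
  have hAD : ∀ a : A, (a : K) ∈ D := fun a => Subring.subset_closure (Or.inl a.2)
  have htD : t ∈ D := Subring.subset_closure (by simp)
  have htD' : t⁻¹ ∈ D := Subring.subset_closure (by simp)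
  -- step 1
  have step1 : ∃ j : ℕ, (x : K) ^ j * z ∈ D := by
    obtain ⟨σ, ⟨k, rfl⟩, h⟩ := vcl_clear (s' := (A : Set K))
      (Submonoid.powers ((x : K) * y)) (by
        rintro _ ⟨k, rfl⟩
        exact pow_mem (subset_vcl _ (mul_mem x.2 y.2)) _) (by
        intro d hd
        obtain ⟨p, k, h⟩ := mem_closure_pair ht0 hd
        -- x^N p(t) ∈ A
        have : ∃ N, (x : K) ^ N * Polynomial.aeval t p ∈ A := by
          refine ⟨p.natDegree, ?_⟩
          rw [Polynomial.aeval_eq_sum_range, Finset.mul_sum]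
          refine sum_mem fun i hi => ?_
          have hi' : i ≤ p.natDegree := by have := Finset.mem_range.mp hi; omega
          obtain ⟨j, hj⟩ := Nat.exists_eq_add_of_le hi'
          have : (x : K) ^ p.natDegree * p.coeff i • t ^ i = (p.coeff i : K) * x ^ j * y ^ i := by
            have h' : p.coeff i • t ^ i = (p.coeff i : K) * t ^ i := rfl
            rw [h', hj, ← ht]; ring
          rw [this]
          exact mul_mem (mul_mem (p.coeff i).2 (pow_mem x.2 _)) (pow_mem y.2 _)
        obtain ⟨N, hN⟩ := this
        rw [← h] at hN
        refine ⟨_, ⟨N + k, rfl⟩, subset_vcl _ ?_⟩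
        have : ((x : K) * y) ^ (N + k) * d = y ^ N * x ^ k * x ^ k * (x ^ N * (t ^ k * d)) := by
          rw [pow_add, mul_pow, mul_pow, ← ht]; ring
        change ((x : K) * y) ^ (N + k) * d ∈ A
        rw [this]
        exact mul_mem (mul_mem (mul_mem (pow_mem y.2 _) (pow_mem x.2 _)) (pow_mem x.2 _)) hN) hz
    rw [vcl_of_normal hm hx hfrac] at h
    refine ⟨2 * k, ?_⟩
    have : (x : K) ^ (2 * k) * z = (t⁻¹) ^ k * (((x : K) * y) ^ k * z) := by
      rw [← ht, inv_pow, mul_pow, mul_pow]; field_simp; ring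
    rw [this]
    exact mul_mem (pow_mem htD' _) (hAD ⟨_, h⟩)
  -- minimal j
  classical
  have hj := Nat.find_spec step1
  set j := Nat.find step1 with hjdef
  rcases Nat.eq_zero_or_pos j with h0 | hpos
  · rw [h0, pow_zero, one_mul] at hj; exact hj
  exfalso
  obtain ⟨n, c, hc, heq⟩ := exists_eq_of_mem_vcl hz
  set w := (x : K) ^ j * z with hw
  have hwn : ∃ d ∈ D, w ^ n = x * d := by
    refine ⟨∑ i ∈ Finset.range n, x ^ (j * (n - i) - 1) * c i * w ^ i, sum_mem fun i _ =>
      mul_mem (mul_mem (pow_mem (hAD x) _) (hc i)) (pow_mem hj _), ?_⟩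
    rw [hw, mul_pow, heq, Finset.mul_sum, Finset.mul_sum]
    refine Finset.sum_congr rfl fun i hi => ?_
    have hi' : i < n := Finset.mem_range.mp hi
    obtain ⟨l, rfl⟩ := Nat.exists_eq_add_of_lt hi'
    have e1 : i + l + 1 - i = l + 1 := by omega
    have e2 : j * (l + 1) = (j * (l + 1) - 1) + 1 :=
      (Nat.sub_add_cancel (Nat.mul_pos hpos (Nat.succ_pos l))).symm
    rw [e1, ← pow_mul, mul_pow, ← pow_mul]
    have e3 : j * (i + l + 1) = (j * (l + 1) - 1) + 1 + j * i := by rw [← e2]; ring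
    rw [e3]; ring
  obtain ⟨d, hd, hwn⟩ := hwn
  obtain ⟨p, k, hp⟩ := mem_closure_pair ht0 hj
  obtain ⟨q, l, hq⟩ := mem_closure_pair ht0 hd
  have hbig : Polynomial.aeval t (p ^ n * Polynomial.X ^ l) = x *
      Polynomial.aeval t (Polynomial.X ^ (k * n) * q) := by
    simp only [map_mul, map_pow, Polynomial.aeval_X]
    rw [← hp, ← hq, mul_pow, hwn, pow_mul]; ring
  have hz0 := (bl_dvd_iff hm hx hyx ht _).mp ⟨_, ⟨_, rfl⟩, hbig⟩
  rw [Polynomial.map_mul, Polynomial.map_pow, Polynomial.map_pow, Polynomial.map_X] at hz0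
  have hp0 : p.map (residue A) = 0 := by
    rcases mul_eq_zero.mp hz0 with h | h
    · exact eq_zero_of_pow_eq_zero h
    · exact absurd h (pow_ne_zero _ Polynomial.X_ne_zero)
  obtain ⟨b, hb, hpb⟩ := (bl_dvd_iff hm hx hyx ht _).mpr hp0
  have hmin : (x : K) ^ (j - 1) * z ∈ D := by
    have : (x : K) ^ (j - 1) * z = (t⁻¹) ^ k * b := by
      have h1 : (x : K) * ((x : K) ^ (j - 1) * z) = x * ((t⁻¹) ^ k * b) := by
        rw [← mul_assoc, ← pow_succ', Nat.sub_add_cancel hpos, ← hw]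
        have : w = (t⁻¹) ^ k * (t ^ k * w) := by
          rw [← mul_assoc, ← mul_pow, inv_mul_cancel₀ ht0, one_pow, one_mul]
        rw [this, hp, hpb]; ring
      exact mul_left_cancel₀ hx0 h1
    rw [this]
    exact mul_mem (pow_mem htD' _) (bl_le (fun a ha => hAD ⟨a, ha⟩) htD hb)
  have := Nat.find_min' step1 hmin
  omega

end BlowUp
end

section
set_option linter.all false
set_option autoImplicit false
open MvPolynomial IsLocalRing

section Coords
variable {A : Type*} [CommRing A]

lemma form_rep (x y : A) (s : ℕ) : ∀ a ∈ (Ideal.span {x, y}) ^ s,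
    ∃ c : ℕ → A, a = ∑ i ∈ Finset.range (s + 1), c i * x ^ (s - i) * y ^ i := by
  induction s with
  | zero => intro a _; exact ⟨fun _ => a, by simp⟩
  | succ s ih =>
    intro a ha
    rw [pow_succ'] at ha
    refine Submodule.mul_induction_on ha ?_ ?_
    · intro u hu v hv
      obtain ⟨α, β, rfl⟩ := Ideal.mem_span_pair.mp hu
      obtain ⟨c, rfl⟩ := ih v hv
      refine ⟨fun i => (if i ≤ s then α * c i else 0) + (if 1 ≤ i then β * c (i - 1) else 0), ?_⟩
      have e1 : ∑ i ∈ Finset.range (s + 1 + 1), (if i ≤ s then α * c i else 0) *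
          x ^ (s + 1 - i) * y ^ i = α * x *
          ∑ i ∈ Finset.range (s + 1), c i * x ^ (s - i) * y ^ i := by
        rw [Finset.sum_range_succ, if_neg (by omega), zero_mul, zero_mul, add_zero, Finset.mul_sum]
        refine Finset.sum_congr rfl fun i hi => ?_
        have : i ≤ s := by have := Finset.mem_range.mp hi; omega
        rw [if_pos this, Nat.succ_sub this, Nat.succ_eq_add_one, pow_succ]; ring
      have e2 : ∑ i ∈ Finset.range (s + 1 + 1), (if 1 ≤ i then β * c (i - 1) else 0) *
          x ^ (s + 1 - i) * y ^ i = β * y *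
          ∑ i ∈ Finset.range (s + 1), c i * x ^ (s - i) * y ^ i := by
        rw [Finset.sum_range_succ', if_neg (by omega), zero_mul, zero_mul, add_zero, Finset.mul_sum]
        refine Finset.sum_congr rfl fun i hi => ?_
        rw [if_pos (by omega), Nat.add_sub_cancel, Nat.add_sub_add_right]; ring
      simp only [add_mul] at e1 e2 ⊢
      rw [Finset.sum_add_distrib, e1, e2]
    · rintro _ _ ⟨c, rfl⟩ ⟨d, rfl⟩
      exact ⟨fun i => c i + d i, by simp only [add_mul, Finset.sum_add_distrib]⟩

lemma sup_pow_le' (X Z : Ideal A) (s : ℕ) : (X ⊔ Z) ^ (s + 1) ≤ X ^ (s + 1) ⊔ Z * (X ⊔ Z) ^ s := by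
  induction s with
  | zero => simp
  | succ s ih =>
    rw [pow_succ' _ (s + 1), Ideal.sup_mul]
    refine sup_le ?_ le_sup_right
    refine (Ideal.mul_mono_right ih).trans ?_
    rw [Ideal.mul_sup, ← pow_succ']
    refine sup_le_sup_left ?_ _
    rw [mul_left_comm]
    refine Ideal.mul_mono_right ?_
    rw [pow_succ' _ s]
    exact Ideal.mul_mono_left le_sup_left

lemma mono_sub (x y lam : A) (m : Ideal A) (hx : x ∈ m) (hy : y ∈ m) (i j : ℕ) :
    x ^ j * y ^ i - lam ^ i * x ^ (j + i) ∈ Ideal.span {y - lam * x} * m ^ (j + i - 1) := by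
  induction i with
  | zero => simp
  | succ i ih =>
    have : x ^ j * y ^ (i + 1) - lam ^ (i + 1) * x ^ (j + (i + 1)) =
      (y - lam * x) * (x ^ j * y ^ i) + lam * x * (x ^ j * y ^ i - lam ^ i * x ^ (j + i)) := by ring
    rw [this]
    refine add_mem (Ideal.mul_mem_mul (Ideal.mem_span_singleton_self _) ?_) ?_
    · have : j + (i + 1) - 1 = j + i := by omega
      rw [this, pow_add]
      exact Ideal.mul_mem_mul (Ideal.pow_mem_pow hx _) (Ideal.pow_mem_pow hy _)
    · rw [mul_assoc]
      refine Ideal.mul_mem_left _ _ ?_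
      rcases Nat.eq_zero_or_pos (j + i) with h | h
      · have h1 : j = 0 := by omega
        have h2 : i = 0 := by omega
        subst h1 h2; simp
      · have : j + (i + 1) - 1 = (j + i - 1) + 1 := by omega
        rw [this, pow_succ' m, mul_left_comm]
        exact Ideal.mul_mem_mul hx ih

lemma exists_coords [IsLocalRing A] {x y : A} (hm : Ideal.span {x, y} = maximalIdeal A)
    [Infinite (ResidueField A)] {s : ℕ} (hs : 0 < s) {a : A} (ha : a ∈ maximalIdeal A ^ s)
    (ha' : a ∉ maximalIdeal A ^ (s + 1)) (E : Finset (ResidueField A)) : ∃ lam : A,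
      residue A lam ∉ E ∧ maximalIdeal A ^ s ≤
        Ideal.span {a} ⊔ Ideal.span {y - lam * x} * maximalIdeal A ^ (s - 1) := by
  classical
  have hxm : x ∈ maximalIdeal A := hm ▸ Ideal.subset_span (by simp)
  have hym : y ∈ maximalIdeal A := hm ▸ Ideal.subset_span (by simp)
  obtain ⟨c, hc⟩ := form_rep x y s a (by rw [hm]; exact ha)
  set P : Polynomial (ResidueField A) :=
    ∑ i ∈ Finset.range (s + 1), Polynomial.monomial i (residue A (c i)) with hP
  have hP0 : P ≠ 0 := by
    intro h
    apply ha'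
    rw [hc]
    refine sum_mem fun i hi => ?_
    have hi' := Finset.mem_range.mp hi
    have h1 : P.coeff i = residue A (c i) := by
      rw [hP, Polynomial.finset_sum_coeff]
      simp only [Polynomial.coeff_monomial]
      rw [Finset.sum_ite_eq' , if_pos hi]
    rw [h, Polynomial.coeff_zero] at h1
    have h2 := (residue_eq_zero_iff _).mp h1.symm
    rw [pow_succ', mul_assoc]
    refine Ideal.mul_mem_mul h2 ?_
    have : s = (s - i) + i := by omega
    rw [this, pow_add, ← this]
    exact Ideal.mul_mem_mul (Ideal.pow_mem_pow hxm _) (Ideal.pow_mem_pow hym _)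
  obtain ⟨lb, hlb⟩ := Infinite.exists_notMem_finset (E ∪ P.roots.toFinset)
  obtain ⟨lam, rfl⟩ := residue_surjective lb
  rw [Finset.mem_union, not_or] at hlb
  refine ⟨lam, hlb.1, ?_⟩
  set z := y - lam * x with hz
  set pl := ∑ i ∈ Finset.range (s + 1), c i * lam ^ i with hpl
  have hu : IsUnit pl := by
    by_contra hnu
    have h1 : residue A pl = 0 := (residue_eq_zero_iff _).mpr hnu
    apply hlb.2
    rw [Multiset.mem_toFinset, Polynomial.mem_roots hP0, Polynomial.IsRoot.def, ← h1, hP,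
      Polynomial.eval_finset_sum, hpl, map_sum]
    refine Finset.sum_congr rfl fun i _ => ?_
    simp
  have hsub : a - pl * x ^ s ∈ Ideal.span {z} * maximalIdeal A ^ (s - 1) := by
    have : a - pl * x ^ s = ∑ i ∈ Finset.range (s + 1),
        c i * (x ^ (s - i) * y ^ i - lam ^ i * x ^ (s - i + i)) := by
      rw [hc, hpl, Finset.sum_mul, ← Finset.sum_sub_distrib]
      refine Finset.sum_congr rfl fun i hi => ?_
      have : s - i + i = s := by have := Finset.mem_range.mp hi; omega
      rw [this]; ring
    rw [this]
    refine sum_mem fun i hi => Ideal.mul_mem_left _ _ ?_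
    have h2 := mono_sub x y lam (maximalIdeal A) hxm hym i (s - i)
    have : s - i + i = s := by have := Finset.mem_range.mp hi; omega
    rw [this] at h2 ⊢
    exact h2
  have hxs : x ^ s ∈ Ideal.span {a} ⊔ Ideal.span {z} * maximalIdeal A ^ (s - 1) := by
    obtain ⟨v, hv⟩ := hu.exists_left_inv
    have : x ^ s = v * a - v * (a - pl * x ^ s) := by linear_combination (-(x ^ s)) * hv
    rw [this]
    exact sub_mem (Ideal.mem_sup_left (Ideal.mul_mem_left _ _ (Ideal.mem_span_singleton_self a)))
      (Ideal.mem_sup_right (Ideal.mul_mem_left _ _ hsub))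
  have hmz : maximalIdeal A = Ideal.span {x} ⊔ Ideal.span {z} := by
    rw [← Ideal.span_insert]
    rw [← hm, hz]
    apply le_antisymm <;> rw [Ideal.span_le] <;> rintro w (rfl | rfl)
    · exact Ideal.subset_span (by simp)
    · rw [SetLike.mem_coe, Ideal.mem_span_pair]
      exact ⟨lam, 1, by ring⟩
    · exact Ideal.subset_span (by simp)
    · exact sub_mem (Ideal.subset_span (by simp))
        (Ideal.mul_mem_left _ _ (Ideal.subset_span (by simp)))
  have hle := sup_pow_le' (Ideal.span {x}) (Ideal.span {z}) (s - 1)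
  rw [← hmz, Nat.sub_add_cancel hs] at hle
  refine hle.trans (sup_le ?_ le_sup_right)
  rw [Ideal.span_singleton_pow, Ideal.span_le]
  simpa using hxs

end Coords
end

section
set_option linter.all false
set_option autoImplicit false
open MvPolynomial IsLocalRing

section Charts
variable {K : Type*} [Field K]

lemma exists_val {A : Subring K} [IsNoetherianRing A] (π : A) (hπ : ¬ IsUnit π) (a b : A)
    (ha : a ≠ 0) (hb : b ≠ 0) : ∃ (a' b' : A) (n : ℕ), ¬ π ∣ a' ∧ ¬ π ∣ b' ∧
      ((a : K) / b * b' = π ^ n * a' ∨ ((a : K) / b)⁻¹ * a' = π ^ n * b') := by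
  obtain ⟨a', h1, h2⟩ :=
    (FiniteMultiplicity.of_not_isUnit hπ ha).exists_eq_pow_mul_and_not_dvd
  obtain ⟨b', h3, h4⟩ :=
    (FiniteMultiplicity.of_not_isUnit hπ hb).exists_eq_pow_mul_and_not_dvd
  have ha0 : (a : K) ≠ 0 := fun h => ha (Subtype.ext h)
  have hb0 : (b : K) ≠ 0 := fun h => hb (Subtype.ext h)
  have e1 : (a : K) = π ^ (multiplicity π a) * a' := congrArg Subtype.val h1
  have e2 : (b : K) = π ^ (multiplicity π b) * b' := congrArg Subtype.val h3
  rw [e1] at ha0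
  rw [e2] at hb0
  have hpj := left_ne_zero_of_mul hb0
  have hpi := left_ne_zero_of_mul ha0
  rcases le_total (multiplicity π b) (multiplicity π a) with h | h
  · obtain ⟨n, hn⟩ := Nat.exists_eq_add_of_le h
    refine ⟨a', b', n, h2, h4, Or.inl ?_⟩
    rw [e1, e2, hn, pow_add]
    have := right_ne_zero_of_mul hb0
    field_simp
  · obtain ⟨n, hn⟩ := Nat.exists_eq_add_of_le h
    refine ⟨a', b', n, h2, h4, Or.inr ?_⟩
    rw [e1, e2, hn, pow_add]
    have := right_ne_zero_of_mul ha0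
    field_simp

variable {A : Subring K} [IsLocalRing A] [IsNoetherianRing A]

lemma dvr_case {x : A} (hm : maximalIdeal A = Ideal.span {x})
    (hfrac : ∀ z : K, ∃ a b : A, (b : K) ≠ 0 ∧ z = a / b) (f : K) : f ∈ A ∨ f⁻¹ ∈ A := by
  obtain ⟨a, b, hb, rfl⟩ := hfrac f
  by_cases ha : a = 0
  · left; rw [ha]; simp [zero_mem]
  have hxu : ¬ IsUnit x := by
    have : x ∈ maximalIdeal A := by rw [hm]; exact Ideal.mem_span_singleton_self x
    exact this
  obtain ⟨a', b', n, h1, h2, h⟩ := exists_val x hxu a b ha (by rintro rfl; exact hb rfl)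
  have un : ∀ c : A, ¬ x ∣ c → IsUnit c := by
    intro c hc
    by_contra hcu
    have : c ∈ maximalIdeal A := hcu
    rw [hm, Ideal.mem_span_singleton] at this
    exact hc this
  rcases h with h | h
  · left
    obtain ⟨v, hv⟩ := (un b' h2).exists_right_inv
    have hv' : (b' : K) * v = 1 := congrArg Subtype.val hv
    have : (a : K) / b = x ^ n * a' * v := by rw [← h, mul_assoc, hv', mul_one]
    rw [this]; exact mul_mem (mul_mem (pow_mem x.2 _) a'.2) v.2
  · right
    obtain ⟨v, hv⟩ := (un a' h1).exists_right_inv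
    have hv' : (a' : K) * v = 1 := congrArg Subtype.val hv
    have : ((a : K) / b)⁻¹ = x ^ n * b' * v := by rw [← h, mul_assoc, hv', mul_one]
    rw [this]; exact mul_mem (mul_mem (pow_mem x.2 _) b'.2) v.2

lemma chart_notin {x y : A} (hm : Ideal.span {x, y} = maximalIdeal A) (hx : Prime x)
    (hfrac : ∀ z : K, ∃ a b : A, (b : K) ≠ 0 ∧ z = a / b) (f : K)
    (B : Subring K) (hAB : A ≤ B) (Q : Ideal B) [Q.IsPrime]
    (hxQ : Subring.inclusion hAB x ∉ Q) :
    f ∈ (LocalSubring.ofPrime B Q).toSubring ∨ f⁻¹ ∈ (LocalSubring.ofPrime B Q).toSubring := by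
  obtain ⟨a, b, hb, rfl⟩ := hfrac f
  by_cases ha : a = 0
  · left; rw [ha]; simp [zero_mem]
  obtain ⟨π, hπ⟩ := rr_principal hm ((Ideal.span_singleton_prime hx.ne_zero).mpr hx)
    (Q.comap (Subring.inclusion hAB)) hxQ
  have hπQ : Subring.inclusion hAB π ∈ Q := by
    change π ∈ Q.comap (Subring.inclusion hAB); rw [hπ]; exact Ideal.mem_span_singleton_self _
  have hπu : ¬ IsUnit π := fun h =>
    Ideal.IsPrime.ne_top ‹_› (Ideal.eq_top_of_isUnit_mem Q hπQ (h.map _))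
  have hnQ : ∀ c : A, ¬ π ∣ c → Subring.inclusion hAB c ∉ Q := by
    intro c hc h
    change c ∈ Q.comap (Subring.inclusion hAB) at h
    rw [hπ, Ideal.mem_span_singleton] at h
    exact hc h
  obtain ⟨a', b', n, h1, h2, h⟩ := exists_val π hπu a b ha (by rintro rfl; exact hb rfl)
  rcases h with h | h
  · left
    rw [mem_ofPrime]
    exact ⟨Subring.inclusion hAB (π ^ n * a'), _, hnQ b' h2, by
      rw [mul_comm]; exact h⟩
  · right
    rw [mem_ofPrime]
    exact ⟨Subring.inclusion hAB (π ^ n * b'), _, hnQ a' h1, by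
      rw [mul_comm]; exact h⟩

lemma chart_in {x y : A} (hm : Ideal.span {x, y} = maximalIdeal A) (hx : Prime x)
    (hyx : y ∉ Ideal.span {x}) {t : K} (ht : (x : K) * t = y)
    (hfrac : ∀ z : K, ∃ a b : A, (b : K) ≠ 0 ∧ z = a / b) (hinf : Infinite (ResidueField A))
    (Q : Ideal (bl A t)) [hQ : Q.IsPrime]
    (hxQ : Subring.inclusion (le_bl A t) x ∈ Q) :
    RRC (LocalSubring.ofPrime (bl A t) Q).toSubring := by
  set ι := Subring.inclusion (le_bl A t) with hι
  let L := (LocalSubring.ofPrime (bl A t) Q).toSubring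
  have hBL : (bl A t) ≤ L := LocalSubring.le_ofPrime (bl A t) Q
  let φ : Polynomial A →+* (bl A t) := (Polynomial.aeval (R := A) t : Polynomial A →+* K).rangeRestrict
  have hφ : Function.Surjective φ := RingHom.rangeRestrict_surjective _
  have hφK : ∀ p, ((φ p : (bl A t)) : K) = Polynomial.aeval t p := fun p => rfl
  let π := Polynomial.mapRingHom (residue A)
  have hπ : Function.Surjective π := Polynomial.map_surjective _ residue_surjective
  have hdvd : ∀ p, ι x ∣ φ p ↔ π p = 0 := by
    intro p
    rw [show π p = p.map (residue A) from rfl, ← bl_dvd_iff hm hx hyx ht p]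
    constructor
    · rintro ⟨b, hb⟩
      exact ⟨b, b.2, congrArg Subtype.val hb⟩
    · rintro ⟨b, hb, h⟩
      exact ⟨⟨b, hb⟩, Subtype.ext h⟩
  have hx0 : (x : K) ≠ 0 := fun h => hx.ne_zero (Subtype.ext h)
  have hιx0 : ι x ≠ 0 := fun h => hx0 (congrArg Subtype.val h)
  have hBn : IsNoetherianRing (bl A t) := isNoetherianRing_of_surjective _ _ φ hφ
  have hprime : (Ideal.span {ι x}).IsPrime := by
    refine ⟨?_, ?_⟩
    · intro h
      apply hQ.ne_top
      rw [eq_top_iff, ← h, Ideal.span_le]; simpa using hxQ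
    · intro u v huv
      obtain ⟨p, rfl⟩ := hφ u
      obtain ⟨q, rfl⟩ := hφ v
      rw [← map_mul, Ideal.mem_span_singleton, hdvd, map_mul, mul_eq_zero] at huv
      simpa only [Ideal.mem_span_singleton, hdvd] using huv
  -- Q = (x, g)
  obtain ⟨g, hg⟩ : ∃ g, Q = Ideal.span {ι x, g} := by
    obtain ⟨gb, hgb⟩ := (IsPrincipalIdealRing.principal ((Q.comap φ).map π)).principal
    have : gb ∈ (Q.comap φ).map π := by rw [hgb]; exact Submodule.mem_span_singleton_self gb
    obtain ⟨g, hgQ, rfl⟩ := (Ideal.mem_map_iff_of_surjective π hπ).mp this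
    refine ⟨φ g, le_antisymm ?_ ?_⟩
    · intro u hu
      obtain ⟨p, rfl⟩ := hφ u
      have h1 : π p ∈ (Q.comap φ).map π := Ideal.mem_map_of_mem π hu
      rw [hgb] at h1
      obtain ⟨hb, hh⟩ := Submodule.mem_span_singleton.mp h1
      obtain ⟨h, rfl⟩ := hπ hb
      have h2 : π (p - h * g) = 0 := by rw [map_sub, map_mul, ← hh, smul_eq_mul, sub_self]
      rw [← hdvd] at h2
      obtain ⟨c, hc⟩ := h2
      rw [Ideal.mem_span_pair]
      refine ⟨c, φ h, ?_⟩
      rw [map_sub, map_mul] at hc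
      linear_combination -hc
    · rw [Ideal.span_le]
      rintro w (rfl | rfl)
      · exact hxQ
      · exact hgQ
  haveI hLn : IsNoetherianRing L := IsLocalization.isNoetherianRing Q.primeCompl _ hBn
  haveI hLl : IsLocalRing L := (LocalSubring.ofPrime (bl A t) Q).isLocalRing
  have hmax : Ideal.map (algebraMap (bl A t) L) Q = maximalIdeal L :=
    IsLocalization.AtPrime.map_eq_maximalIdeal Q L
  refine ⟨hLl, hLn, ?_, ⟨algebraMap (bl A t) L (ι x), algebraMap (bl A t) L g, ?_, ?_⟩, ?_⟩
  · intro z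
    obtain ⟨a, b, hb, rfl⟩ := hfrac z
    exact ⟨⟨a, hBL (le_bl A t a.2)⟩, ⟨b, hBL (le_bl A t b.2)⟩, hb, rfl⟩
  · rw [← hmax]
    refine ((congrArg (Ideal.map (algebraMap (bl A t) L)) hg).trans ?_).symm
    rw [Ideal.map_span, Set.image_pair]
  · have h0 : algebraMap (bl A t) L (ι x) ≠ 0 := fun h => hx0 (congrArg Subtype.val h)
    rw [← Ideal.span_singleton_prime h0, ← Set.image_singleton, ← Ideal.map_span]
    apply IsLocalization.isPrime_of_isPrime_disjoint Q.primeCompl _ _ hprime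
    rw [Set.disjoint_left]
    intro u hu hu'
    apply hu
    have : Ideal.span {ι x} ≤ Q := by rw [Ideal.span_le]; simpa using hxQ
    exact this hu'
  · -- residue field
    let ψ : A →+* ResidueField L := (residue L).comp ((algebraMap (bl A t) L).comp ι)
    have hψ : ∀ a ∈ maximalIdeal A, ψ a = 0 := by
      intro a ha
      apply (residue_eq_zero_iff _).mpr
      rw [← hmax]
      apply Ideal.mem_map_of_mem
      rw [← hm, Ideal.mem_span_pair] at ha
      obtain ⟨α, β, rfl⟩ := ha
      have : ι (α * x + β * y) = (ι α + ι β * ⟨t, self_mem_bl A t⟩) * ι x := by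
        apply Subtype.ext
        change ((α * x + β * y : A) : K) = ((α : K) + (β : K) * t) * x
        push_cast; rw [← ht]; ring
      rw [this]
      exact Ideal.mul_mem_left _ _ hxQ
    let ψ' : ResidueField A →+* ResidueField L := Ideal.Quotient.lift (maximalIdeal A) ψ hψ
    exact Infinite.of_injective ψ' ψ'.injective

end Charts
end

section
set_option linter.all false
set_option autoImplicit false
open MvPolynomial IsLocalRing

section Induct
variable {K : Type*} [Field K]

variable {A : Subring K} [IsLocalRing A] [IsNoetherianRing A]

lemma frac_mem_bl {x y : A} (hm : Ideal.span {x, y} = maximalIdeal A) {t : K} (hx0 : (x : K) ≠ 0)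
    (ht : (x : K) * t = y) (n : ℕ) : ∀ u ∈ maximalIdeal A ^ n, (u : K) / x ^ n ∈ bl A t := by
  intro u hu
  rw [← hm] at hu
  obtain ⟨c, rfl⟩ := form_rep x y n u hu
  push_cast
  rw [Finset.sum_div]
  refine sum_mem fun i hi => ?_
  have hi' : i ≤ n := by have := Finset.mem_range.mp hi; omega
  obtain ⟨j, rfl⟩ := Nat.exists_eq_add_of_le hi'
  have : (c i : K) * x ^ (i + j - i) * y ^ i / x ^ (i + j) = c i * t ^ i := by
    rw [Nat.add_sub_cancel_left, ← ht, pow_add]; field_simp; ring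
  rw [this]
  exact mul_mem (le_bl A t (c i).2) (pow_mem (self_mem_bl A t) _)

lemma bl_decomp {x y : A} (hm : Ideal.span {x, y} = maximalIdeal A) {t : K} (hx0 : (x : K) ≠ 0)
    (ht : (x : K) * t = y) {s : ℕ} (hs : 0 < s) {a : A}
    (hms : maximalIdeal A ^ s ≤ Ideal.span {a} ⊔ Ideal.span {x} * maximalIdeal A ^ (s - 1)) :
    ∀ β ∈ bl A t, ∃ u ∈ maximalIdeal A ^ s, ∃ β' ∈ bl A t,
      β = (u : K) / x ^ s + (a : K) / x ^ s * β' := by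
  have hxm : x ∈ maximalIdeal A := hm ▸ Ideal.subset_span (by simp)
  have hym : y ∈ maximalIdeal A := hm ▸ Ideal.subset_span (by simp)
  -- powers of t
  have hpow : ∀ n : ℕ, ∃ u ∈ maximalIdeal A ^ s, ∃ β' ∈ bl A t,
      t ^ n = (u : K) / x ^ s + (a : K) / x ^ s * β' := by
    intro n
    induction n with
    | zero =>
      exact ⟨x ^ s, Ideal.pow_mem_pow hxm _, 0, zero_mem _, by push_cast; field_simp; simp⟩
    | succ n ih =>
      obtain ⟨u, hu, β', hβ', h⟩ := ih
      have h1 : y * u ∈ maximalIdeal A * maximalIdeal A ^ s := Ideal.mul_mem_mul hym hu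
      have h2 := (Ideal.mul_mono_right hms : maximalIdeal A * _ ≤ _) h1
      have h3 : maximalIdeal A * (Ideal.span {a} ⊔ Ideal.span {x} * maximalIdeal A ^ (s - 1)) =
          Ideal.span {a} * maximalIdeal A ⊔ Ideal.span {x} * maximalIdeal A ^ s := by
        rw [Ideal.mul_sup, mul_comm, mul_left_comm, ← pow_succ', Nat.sub_add_cancel hs]
      rw [h3, Submodule.mem_sup] at h2
      obtain ⟨_, h4, _, h5, h6⟩ := h2
      obtain ⟨μ, hμ, rfl⟩ := Ideal.mem_span_singleton_mul.mp h4
      obtain ⟨v, hv, rfl⟩ := Ideal.mem_span_singleton_mul.mp h5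
      have hμx := frac_mem_bl hm hx0 ht 1 μ (by simpa using hμ)
      refine ⟨v, hv, (μ : K) / x ^ 1 + t * β', add_mem hμx (mul_mem (self_mem_bl A t) hβ'), ?_⟩
      have h7 : (a : K) * μ + x * v = x * t * u := by
        rw [ht]; have := congrArg Subtype.val h6; push_cast at this; exact this
      rw [pow_succ, h]
      field_simp
      linear_combination -h7
  rintro _ ⟨p, rfl⟩
  simp only [RingHom.coe_coe]
  induction p using Polynomial.induction_on' with
  | add p q hp hq =>
    obtain ⟨u, hu, b, hb, h⟩ := hp
    obtain ⟨u', hu', b', hb', h'⟩ := hq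
    exact ⟨u + u', add_mem hu hu', b + b', add_mem hb hb', by
      rw [map_add, h, h']; push_cast; ring⟩
  | monomial n c =>
    obtain ⟨u, hu, b, hb, h⟩ := hpow n
    refine ⟨c * u, Ideal.mul_mem_left _ _ hu, c * b, mul_mem (le_bl A t c.2) hb, ?_⟩
    rw [Polynomial.aeval_monomial, h]
    have : algebraMap A K c = (c : K) := rfl
    rw [this]; push_cast; ring

/-- bound on chains of ideals above `(a,b)` -/
def ChainBound (A : Type*) [CommRing A] (I : Ideal A) (n : ℕ) : Prop :=
  ∀ p : LTSeries (Ideal A), I ≤ p.head → p.length ≤ n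

lemma chart_bound {x y : A} (hm : Ideal.span {x, y} = maximalIdeal A) {t : K} (hx0 : (x : K) ≠ 0)
    (ht : (x : K) * t = y) {s : ℕ} (hs : 0 < s) {a b : A}
    (ha : a ∈ maximalIdeal A ^ s) (hb : b ∈ maximalIdeal A ^ s)
    (hms : maximalIdeal A ^ s ≤ Ideal.span {a} ⊔ Ideal.span {x} * maximalIdeal A ^ (s - 1))
    (Q : Ideal (bl A t)) [hQ : Q.IsPrime] {n : ℕ} (hn : ChainBound A (Ideal.span {a, b}) (n + 1))
    (a' b' : (LocalSubring.ofPrime (bl A t) Q).toSubring)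
    (ha' : (a' : K) = a / x ^ s) (hb' : (b' : K) = b / x ^ s) :
    ChainBound _ (Ideal.span {a', b'}) n := by
  let L := (LocalSubring.ofPrime (bl A t) Q).toSubring
  have hBL : bl A t ≤ L := LocalSubring.le_ofPrime (bl A t) Q
  let φ : Ideal L → Ideal A := fun 𝔞 =>
    { carrier := {u | ∃ h : u ∈ maximalIdeal A ^ s,
        (⟨(u : K) / x ^ s, hBL (frac_mem_bl hm hx0 ht s u h)⟩ : L) ∈ 𝔞}
      add_mem' := by
        rintro u v ⟨h, h1⟩ ⟨h', h2⟩
        refine ⟨add_mem h h', ?_⟩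
        convert add_mem h1 h2 using 1
        apply Subtype.ext; push_cast; ring
      zero_mem' := by
        refine ⟨zero_mem _, ?_⟩
        convert 𝔞.zero_mem using 1
        apply Subtype.ext; simp
      smul_mem' := by
        rintro c u ⟨h, h1⟩
        refine ⟨Ideal.mul_mem_left _ _ h, ?_⟩
        convert 𝔞.mul_mem_left (⟨c, hBL (le_bl A t c.2)⟩ : L) h1 using 1
        apply Subtype.ext; push_cast; simp only [smul_eq_mul, Subring.coe_mul]; ring }
  have hφmono : ∀ 𝔞 𝔟 : Ideal L, 𝔞 ≤ 𝔟 → φ 𝔞 ≤ φ 𝔟 := by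
    rintro 𝔞 𝔟 h u ⟨h1, h2⟩
    exact ⟨h1, h h2⟩
  have hφs : ∀ 𝔞 𝔟 : Ideal L, Ideal.span {a', b'} ≤ 𝔞 → 𝔞 < 𝔟 → φ 𝔞 < φ 𝔟 := by
    intro 𝔞 𝔟 h0 h
    refine lt_of_le_not_ge (hφmono _ _ h.le) ?_
    intro hle
    apply h.not_ge
    intro z hz
    obtain ⟨β, σ, hσ, hβ⟩ := mem_ofPrime.mp z.2
    have haa : a' ∈ 𝔞 := h0 (Ideal.subset_span (by simp))
    obtain ⟨u, hu, β', hβ', hdec⟩ := bl_decomp hm hx0 ht hs hms β β.2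
    have e : (⟨(u : K) / x ^ s, hBL (frac_mem_bl hm hx0 ht s u hu)⟩ : L) =
        algebraMap (bl A t) L σ * z - a' * ⟨β', hBL hβ'⟩ := by
      apply Subtype.ext
      change (u : K) / x ^ s = (σ : K) * z - a' * β'
      rw [hβ, ha', hdec]; ring
    have h1 : u ∈ φ 𝔟 := by
      refine ⟨hu, ?_⟩
      rw [e]
      exact sub_mem (Ideal.mul_mem_left _ _ hz) (Ideal.mul_mem_right _ _ (h.le haa))
    obtain ⟨_, h2⟩ := hle h1
    rw [e] at h2
    have h3 : algebraMap (bl A t) L σ * z ∈ 𝔞 := by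
      have := add_mem h2 (Ideal.mul_mem_right (⟨β', hBL hβ'⟩ : L) 𝔞 haa)
      rwa [sub_add_cancel] at this
    have hunit : IsUnit (algebraMap (bl A t) L σ) :=
      IsLocalization.map_units L (⟨σ, hσ⟩ : Q.primeCompl)
    obtain ⟨v, hv⟩ := hunit.exists_left_inv
    have h4 := 𝔞.mul_mem_left v h3
    rwa [← mul_assoc, hv, one_mul] at h4
  intro p hp
  -- transport the chain
  have hpi : ∀ i, Ideal.span {a', b'} ≤ p i := fun i => hp.trans (p.monotone (Fin.zero_le i))
  let q : LTSeries (Ideal A) :=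
    { length := p.length
      toFun := fun i => φ (p i)
      step := fun i => hφs _ _ (hpi _) (p.step i) }
  have hlast : q.last < ⊤ := by
    rw [lt_top_iff_ne_top]
    intro h
    have h1 : (1 : A) ∈ q.last := by rw [h]; trivial
    obtain ⟨h2, _⟩ := h1
    have h3 : (1 : A) ∈ maximalIdeal A := Ideal.pow_le_self hs.ne' h2
    exact (maximalIdeal.isMaximal A).ne_top ((Ideal.eq_top_iff_one _).mpr h3)
  have := hn (q.snoc ⊤ hlast) ?_
  · have h2 : (q.snoc ⊤ hlast).length = p.length + 1 := rfl
    omega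
  · have : (q.snoc ⊤ hlast).head = φ p.head := by
      rw [RelSeries.head_snoc]; rfl
    rw [this, Ideal.span_le]
    rintro w (rfl | rfl)
    · refine ⟨ha, hp ?_⟩
      have : (⟨(w : K) / x ^ s, hBL (frac_mem_bl hm hx0 ht s w ha)⟩ : L) = a' :=
        Subtype.ext ha'.symm
      rw [this]; exact Ideal.subset_span (by simp)
    · refine ⟨hb, hp ?_⟩
      have : (⟨(w : K) / x ^ s, hBL (frac_mem_bl hm hx0 ht s w hb)⟩ : L) = b' :=
        Subtype.ext hb'.symm
      rw [this]; exact Ideal.subset_span (by simp)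

end Induct

theorem HDec_main {K : Type*} [Field K] (n : ℕ) : ∀ (A : Subring K), RRC A → ∀ (a b : A),
    (a : K) ≠ 0 → (b : K) ≠ 0 → ChainBound A (Ideal.span {a, b}) n → HDec A ((b : K) / a) := by
  classical
  induction n with
  | zero =>
    intro A hA a b ha hb hn
    have := hA.loc
    by_cases hI : Ideal.span {a, b} = ⊤
    · -- one of a, b is a unit
      have : (1 : A) ∈ Ideal.span {a, b} := by rw [hI]; trivial
      obtain ⟨α, β, h⟩ := Ideal.mem_span_pair.mp this
      have h1 := IsLocalRing.isUnit_or_isUnit_of_add_one h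
      apply HDec.of_mem_or
      rcases h1 with h1 | h1
      · left
        obtain ⟨v, hv⟩ := (isUnit_of_mul_isUnit_right h1).exists_right_inv
        have hv' : (a : K) * v = 1 := congrArg Subtype.val hv
        have : (b : K) / a = b * v := by field_simp; exact hv'.symm
        rw [this]; exact mul_mem b.2 v.2
      · right
        obtain ⟨v, hv⟩ := (isUnit_of_mul_isUnit_right h1).exists_right_inv
        have hv' : (b : K) * v = 1 := congrArg Subtype.val hv
        have : ((b : K) / a)⁻¹ = a * v := by
          rw [inv_div]; field_simp; exact hv'.symm
        rw [this]; exact mul_mem a.2 v.2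
    · exfalso
      have h := hn ((RelSeries.singleton _ (Ideal.span {a, b})).snoc ⊤ (by
        simpa using lt_top_iff_ne_top.mpr hI)) (by simp)
      simp at h
  | succ n ih =>
    -- main step, assuming `a ∉ m^(s+1)`
    have step : ∀ (A : Subring K) (hA : RRC A) (a b : A) (ha : (a : K) ≠ 0) (hb : (b : K) ≠ 0)
        (hn : ChainBound A (Ideal.span {a, b}) (n + 1)) (s : ℕ),
        letI := hA.loc
        0 < s → a ∈ maximalIdeal A ^ s → b ∈ maximalIdeal A ^ s → a ∉ maximalIdeal A ^ (s + 1) →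
        HDec A ((b : K) / a) := by
      intro A hA a b ha hb hn s
      have := hA.loc
      have := hA.noeth
      have := hA.inf
      intro hs has hbs has'
      obtain ⟨x, y, hm, hx⟩ := hA.gens
      by_cases hpr : maximalIdeal A = Ideal.span {x}
      · exact HDec.of_mem_or (dvr_case hpr hA.frac _)
      obtain ⟨lam, _, hlam⟩ := exists_coords hm hs has has' ∅
      obtain ⟨mu, hmu, hmu'⟩ := exists_coords hm hs has has' {residue A lam}
      have hunit : IsUnit (mu - lam) := by
        by_contra h
        have : residue A (mu - lam) = 0 := (residue_eq_zero_iff _).mpr h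
        rw [map_sub, sub_eq_zero] at this
        exact hmu (by simp [this])
      have pz := rr_prime_of_gens hm hx hpr lam
      have pw := rr_prime_of_gens hm hx hpr mu
      set z := y - lam * x with hz
      set w := y - mu * x with hw
      obtain ⟨v, hv⟩ := hunit.exists_left_inv
      have hmzw : Ideal.span {z, w} = maximalIdeal A := by
        rw [← hm, hz, hw]
        apply le_antisymm <;> rw [Ideal.span_le] <;> rintro u (rfl | rfl)
        · rw [SetLike.mem_coe, Ideal.mem_span_pair]; exact ⟨-lam, 1, by ring⟩
        · rw [SetLike.mem_coe, Ideal.mem_span_pair]; exact ⟨-mu, 1, by ring⟩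
        · rw [SetLike.mem_coe, Ideal.mem_span_pair]; exact ⟨v, -v, by
            linear_combination u * hv⟩
        · rw [SetLike.mem_coe, Ideal.mem_span_pair]
          exact ⟨1 + lam * v, -lam * v, by linear_combination lam * x * hv⟩
      have hnp : ∀ q : A, Prime q → q ∈ maximalIdeal A → maximalIdeal A ≠ Ideal.span {q} := by
        intro q hq hqm h
        apply hpr
        have hxm : x ∈ maximalIdeal A := hm ▸ Ideal.subset_span (by simp)
        rw [h, Ideal.mem_span_singleton] at hxm
        rw [h, Ideal.span_singleton_eq_span_singleton]
        exact hq.associated_of_dvd hx hxm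
      have hzm : z ∈ maximalIdeal A := hmzw ▸ Ideal.subset_span (by simp)
      have hwm : w ∈ maximalIdeal A := hmzw ▸ Ideal.subset_span (by simp)
      have hwz : Ideal.span {w, z} = maximalIdeal A := by rw [Set.pair_comm]; exact hmzw
      have hz0 : (z : K) ≠ 0 := fun h => pz.ne_zero (Subtype.ext h)
      have hw0 : (w : K) ≠ 0 := fun h => pw.ne_zero (Subtype.ext h)
      -- the chart lemma
      have chart : ∀ (z w : A) (hzw : Ideal.span {z, w} = maximalIdeal A) (pz : Prime z)
          (t : K) (ht : (z : K) * t = w)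
          (hms : maximalIdeal A ^ s ≤ Ideal.span {a} ⊔ Ideal.span {z} * maximalIdeal A ^ (s - 1)),
          HDec (bl A t) ((b : K) / a) := by
        intro z w hzw pz t ht hms
        have hz0 : (z : K) ≠ 0 := fun h => pz.ne_zero (Subtype.ext h)
        have hzm : z ∈ maximalIdeal A := hzw ▸ Ideal.subset_span (by simp)
        have hwzn : w ∉ Ideal.span {z} := by
          intro h
          apply hnp z pz hzm
          rw [← hzw]
          apply le_antisymm
          · rw [Ideal.span_le]; rintro u (rfl | rfl)
            · exact Ideal.mem_span_singleton_self _
            · exact h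
          · exact Ideal.span_mono (by simp)
        apply HDec.of_loc_primes
        intro Q hQ
        by_cases hzQ : Subring.inclusion (le_bl A t) z ∈ Q
        · have hL := chart_in hzw pz hwzn ht hA.frac hA.inf Q hzQ
          have hBL : bl A t ≤ (LocalSubring.ofPrime (bl A t) Q).toSubring :=
            LocalSubring.le_ofPrime (bl A t) Q
          have key := ih _ hL ⟨_, hBL (frac_mem_bl hzw hz0 ht s a has)⟩
            ⟨_, hBL (frac_mem_bl hzw hz0 ht s b hbs)⟩
            (div_ne_zero ha (pow_ne_zero _ hz0)) (div_ne_zero hb (pow_ne_zero _ hz0))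
            (chart_bound hzw hz0 ht hs has hbs hms Q hn _ _ rfl rfl)
          have e : (b : K) / z ^ s / (a / z ^ s) = b / a := by field_simp
          simp only [e] at key
          exact key
        · exact HDec.of_mem_or (chart_notin hzw pz hA.frac _ _ (le_bl A t) Q hzQ)
      have ht : (z : K) * ((w : K) / z) = w := by field_simp
      have ht' : (w : K) * ((w : K) / z)⁻¹ = z := by field_simp
      have hwzn : w ∉ Ideal.span {z} := by
        intro h
        apply hnp z pz hzm
        rw [← hmzw]
        apply le_antisymm
        · rw [Ideal.span_le]; rintro u (rfl | rfl)
          · exact Ideal.mem_span_singleton_self _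
          · exact h
        · exact Ideal.span_mono (by simp)
      exact HDec.glue (bl_split hmzw pz hwzn ht hA.frac) (chart z w hmzw pz _ ht hlam)
        (chart w z hwz pw _ ht' hmu')
    intro A hA a b ha hb hn
    have := hA.loc
    have := hA.noeth
    by_cases hI : Ideal.span {a, b} = ⊤
    · have : (1 : A) ∈ Ideal.span {a, b} := by rw [hI]; trivial
      obtain ⟨α, β, h⟩ := Ideal.mem_span_pair.mp this
      have h1 := IsLocalRing.isUnit_or_isUnit_of_add_one h
      apply HDec.of_mem_or
      rcases h1 with h1 | h1
      · left
        obtain ⟨v, hv⟩ := (isUnit_of_mul_isUnit_right h1).exists_right_inv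
        have hv' : (a : K) * v = 1 := congrArg Subtype.val hv
        have : (b : K) / a = b * v := by field_simp; exact hv'.symm
        rw [this]; exact mul_mem b.2 v.2
      · right
        obtain ⟨v, hv⟩ := (isUnit_of_mul_isUnit_right h1).exists_right_inv
        have hv' : (b : K) * v = 1 := congrArg Subtype.val hv
        have : ((b : K) / a)⁻¹ = a * v := by
          rw [inv_div]; field_simp; exact hv'.symm
        rw [this]; exact mul_mem a.2 v.2
    have hle : Ideal.span {a, b} ≤ maximalIdeal A := IsLocalRing.le_maximalIdeal hI
    have hex : ∃ s, ¬ (a ∈ maximalIdeal A ^ (s + 1) ∧ b ∈ maximalIdeal A ^ (s + 1)) := by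
      by_contra hcon
      push Not at hcon
      have h0 := Ideal.iInf_pow_eq_bot_of_isLocalRing (maximalIdeal A) (maximalIdeal.isMaximal A).ne_top
      have : a ∈ ⨅ i, maximalIdeal A ^ i := by
        rw [Submodule.mem_iInf]
        intro i
        exact Ideal.pow_le_pow_right (Nat.le_succ i) (hcon i).1
      rw [h0] at this
      exact ha (congrArg Subtype.val ((Submodule.mem_bot A).mp this))
    have hsp := Nat.find_spec hex
    set s := Nat.find hex with hsdef
    have hs : 0 < s := by
      rw [Nat.pos_iff_ne_zero]
      intro h0
      rw [h0] at hsp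
      apply hsp
      simp only [zero_add, pow_one]
      exact ⟨hle (Ideal.subset_span (by simp)), hle (Ideal.subset_span (by simp))⟩
    have hmem : a ∈ maximalIdeal A ^ s ∧ b ∈ maximalIdeal A ^ s := by
      have := Nat.find_min hex (m := s - 1) (by omega)
      rw [not_not, Nat.sub_add_cancel hs] at this
      exact this
    by_cases h1 : a ∈ maximalIdeal A ^ (s + 1)
    · have h2 : b ∉ maximalIdeal A ^ (s + 1) := fun h => hsp ⟨h1, h⟩
      have := (step A hA b a hb ha (by rw [Set.pair_comm]; exact hn) s hs hmem.2 hmem.1 h2).symm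
      rwa [inv_div] at this
    · exact step A hA a b ha hb hn s hs hmem.1 hmem.2 h1
end

section
set_option linter.all false
set_option autoImplicit false
open MvPolynomial IsLocalRing

section
variable {A : Type*} [CommRing A] [IsLocalRing A] [IsNoetherianRing A]

lemma reg_pow_notMem (hdim : ringKrullDim A = 2) {x z : A}
    (hm : Ideal.span {x, z} = maximalIdeal A) (k : ℕ) : x ^ k ∉ Ideal.span {z} := by
  intro h
  have hmin : maximalIdeal A ∈ (Ideal.span {z}).minimalPrimes := by
    refine ⟨⟨inferInstance, ?_⟩, ?_⟩
    · rw [← hm]; exact Ideal.span_mono (by simp)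
    · rintro P ⟨hP, hle⟩ _
      rw [← hm, Ideal.span_le]
      rintro w (rfl | rfl)
      · exact hP.mem_of_pow_mem _ (hle h)
      · exact hle (Ideal.subset_span (by simp))
  have h1 := Ideal.height_le_one_of_isPrincipal_of_mem_minimalPrimes (Ideal.span {z}) _ hmin
  have h2 := IsLocalRing.maximalIdeal_height_eq_ringKrullDim (R := A)
  rw [hdim] at h2
  have h3 : (maximalIdeal A).height = 2 := by
    apply WithBot.coe_injective; exact h2
  rw [h3] at h1
  exact absurd h1 (by decide)

lemma reg_domain (hdim : ringKrullDim A = 2) {x y : A}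
    (hm : Ideal.span {x, y} = maximalIdeal A) : IsDomain A ∧ Prime x ∧ Prime y := by
  have hm' : Ideal.span {y, x} = maximalIdeal A := by rw [Set.pair_comm]; exact hm
  have hx : (Ideal.span {x}).IsPrime := rr_isPrime hm' (reg_pow_notMem hdim hm')
  have hy : (Ideal.span {y}).IsPrime := rr_isPrime hm (reg_pow_notMem hdim hm)
  have hx0 : x ≠ 0 := by
    intro h
    exact reg_pow_notMem hdim hm 1 (by rw [h]; simp)
  have hy0 : y ≠ 0 := by
    intro h
    exact reg_pow_notMem hdim hm' 1 (by rw [h]; simp)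
  refine ⟨?_, (Ideal.span_singleton_prime hx0).mp hx, (Ideal.span_singleton_prime hy0).mp hy⟩
  have h2 : ((2 : ℕ) : WithBot ℕ∞) ≤ ringKrullDim A := by rw [hdim]; rfl
  obtain ⟨l, hl⟩ := Order.le_krullDim_iff.mp h2
  have h01 : l ⟨0, by omega⟩ < l ⟨1, by omega⟩ := l.strictMono (by simp [Fin.lt_def])
  have h12 : l ⟨1, by omega⟩ < l ⟨2, by omega⟩ := l.strictMono (by simp [Fin.lt_def])
  set p0 := (l ⟨0, by omega⟩).asIdeal with hp0
  set p1 := (l ⟨1, by omega⟩).asIdeal with hp1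
  have hp0P : p0.IsPrime := (l ⟨0, by omega⟩).isPrime
  have hp1P : p1.IsPrime := (l ⟨1, by omega⟩).isPrime
  have h01' : p0 < p1 := h01
  have h1m : p1 < maximalIdeal A := lt_of_lt_of_le h12 (IsLocalRing.le_maximalIdeal (l ⟨2, by omega⟩).isPrime.ne_top)
  have hpr : ∃ p, p1 = Ideal.span {p} := by
    by_cases hxp : x ∈ p1
    · have hyp : y ∉ p1 := by
        intro hyp
        apply not_le_of_gt h1m
        rw [← hm, Ideal.span_le]
        rintro w (rfl | rfl) <;> assumption
      exact rr_principal hm' hy p1 hyp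
    · exact rr_principal hm hx p1 hxp
  obtain ⟨p, hp⟩ := hpr
  have hpp0 : p ∉ p0 := by
    intro h
    apply not_le_of_gt h01'
    rw [hp, Ideal.span_le]; rintro w rfl; exact h
  have hle : p0 ≤ p1 • p0 := by
    intro u hu
    have : u ∈ p1 := h01'.le hu
    rw [hp] at this
    obtain ⟨v, rfl⟩ := Ideal.mem_span_singleton'.mp this
    have hv : v ∈ p0 := by
      rcases hp0P.mem_or_mem hu with h | h
      · exact h
      · exact absurd h hpp0
    rw [mul_comm]
    exact Submodule.smul_mem_smul (by rw [hp]; exact Ideal.mem_span_singleton_self p) hv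
  have hbot : p0 = ⊥ := Submodule.eq_bot_of_le_smul_of_le_jacobson_bot p1 p0
    (IsNoetherian.noetherian _) hle (by
      rw [IsLocalRing.jacobson_eq_maximalIdeal _ bot_ne_top]; exact h1m.le)
  rw [hbot] at hp0P
  have : NoZeroDivisors A := ⟨fun {a b} h => by
    have h' : a * b ∈ (⊥ : Ideal A) := h
    exact hp0P.mem_or_mem h'⟩
  exact NoZeroDivisors.to_isDomain A

/-- the copy of A in its fraction field -/
abbrev imgA (A : Type*) [CommRing A] (K : Type*) [Field K] [Algebra A K] : Subring K :=
  (algebraMap A K).range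

noncomputable def imgEquiv (A : Type*) [CommRing A] [IsDomain A] (K : Type*) [Field K] [Algebra A K] [IsFractionRing A K] :
    A ≃+* imgA A K :=
  RingEquiv.ofBijective (algebraMap A K).rangeRestrict
    ⟨fun a b h => IsFractionRing.injective A K (congrArg Subtype.val h),
      (algebraMap A K).rangeRestrict_surjective⟩

lemma imgEquiv_coe (A : Type*) [CommRing A] [IsDomain A] (K : Type*) [Field K] [Algebra A K] [IsFractionRing A K]
    (a : A) : (imgEquiv A K a : K) = algebraMap A K a := rfl

lemma reg_RRC (hdim : ringKrullDim A = 2) {x y : A}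
    (hm : Ideal.span {x, y} = maximalIdeal A) (hinf : Infinite (ResidueField A)) [IsDomain A]
    (K : Type*) [Field K] [Algebra A K] [IsFractionRing A K] : RRC (imgA A K) := by
  obtain ⟨_, hx, hy⟩ := reg_domain hdim hm
  have hloc : IsLocalRing (imgA A K) := (imgEquiv A K).isLocalRing
  refine ⟨hloc, isNoetherianRing_of_ringEquiv A (imgEquiv A K), ?_, ?_, ?_⟩
  · intro z
    obtain ⟨a, b, hb, rfl⟩ := IsFractionRing.div_surjective (A := A) z
    refine ⟨imgEquiv A K a, imgEquiv A K b, ?_, rfl⟩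
    rw [imgEquiv_coe]
    exact IsFractionRing.to_map_ne_zero_of_mem_nonZeroDivisors hb
  · refine ⟨imgEquiv A K x, imgEquiv A K y, ?_, ?_⟩
    · have : Ideal.map (imgEquiv A K) (maximalIdeal A) = maximalIdeal (imgA A K) := 
        IsLocalRing.eq_maximalIdeal (Ideal.map_isMaximal_of_equiv (imgEquiv A K))
      rw [← this, ← hm, Ideal.map_span, Set.image_pair]
    · exact (MulEquiv.prime_iff (imgEquiv A K).toMulEquiv).mpr hx
  · have := IsLocalRing.ResidueField.mapEquiv (imgEquiv A K)
    exact Infinite.of_injective this this.injective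

lemma chainBound_exists {I : Ideal A} {N : ℕ} (h : maximalIdeal A ^ N ≤ I) :
    ∃ n, ChainBound A I n := by
  by_cases hI : I = ⊤
  · refine ⟨0, fun p hp => ?_⟩
    by_contra hc
    have h1 : p ⟨0, by omega⟩ < p ⟨1, by omega⟩ := p.strictMono (by simp [Fin.lt_def])
    have h2 : p ⟨0, by omega⟩ = ⊤ := top_le_iff.mp (by rw [← hI]; exact hp)
    rw [h2] at h1
    exact not_top_lt h1
  have : Nontrivial (A ⧸ I) := Ideal.Quotient.nontrivial_iff.mpr hI
  have : IsLocalRing (A ⧸ I) :=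
    IsLocalRing.of_surjective' (Ideal.Quotient.mk I) Ideal.Quotient.mk_surjective
  have hart : IsArtinianRing (A ⧸ I) := by
    rw [isArtinianRing_iff_isNilpotent_maximalIdeal]
    refine ⟨N, ?_⟩
    have h1 : maximalIdeal (A ⧸ I) ≤ (maximalIdeal A).map (Ideal.Quotient.mk I) := by
      intro u hu
      obtain ⟨a, rfl⟩ := Ideal.Quotient.mk_surjective u
      refine Ideal.mem_map_of_mem _ ?_
      rw [IsLocalRing.mem_maximalIdeal] at hu ⊢
      exact fun ha => hu (ha.map _)
    have h2 := Ideal.pow_right_mono h1 N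
    rw [← Ideal.map_pow] at h2
    refine le_bot_iff.mp (h2.trans ?_)
    rw [le_bot_iff, Ideal.map_eq_bot_iff_le_ker, Ideal.mk_ker]
    exact h
  have hfl : IsFiniteLength (A ⧸ I) (A ⧸ I) := isFiniteLength_iff_isNoetherian_isArtinian.mpr ⟨inferInstance, hart⟩
  have hne := Module.length_ne_top_iff.mpr hfl
  obtain ⟨n, hn⟩ := ENat.ne_top_iff_exists.mp hne
  refine ⟨n, fun p hp => ?_⟩
  have hpi : ∀ i, I ≤ p i := fun i => hp.trans (p.monotone (Fin.zero_le i))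
  let q : LTSeries (Submodule (A ⧸ I) (A ⧸ I)) :=
    { length := p.length
      toFun := fun i => (p i).map (Ideal.Quotient.mk I)
      step := fun i => by
        have hlt : p i.castSucc < p i.succ := p.step i
        refine lt_of_le_of_ne (Ideal.map_mono (le_of_lt hlt)) fun he => ne_of_lt hlt ?_
        have h3 := congrArg (Ideal.comap (Ideal.Quotient.mk I)) he
        rwa [Ideal.comap_map_mk (hpi _), Ideal.comap_map_mk (hpi _)] at h3 }
  have h4 : (p.length : WithBot ℕ∞) ≤ Order.krullDim (Submodule (A ⧸ I) (A ⧸ I)) :=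
    Order.LTSeries.length_le_krullDim q
  rw [← Module.coe_length, ← hn] at h4
  exact_mod_cast h4

lemma ChainBound.equiv {A B : Type*} [CommRing A] [CommRing B] (e : A ≃+* B) {I : Ideal A} {n : ℕ}
    (h : ChainBound A I n) : ChainBound B (I.map e) n := by
  intro p hp
  have := h (p.map (fun J => J.comap e) ?_) ?_
  · exact this
  · intro J J' hJ
    refine lt_of_le_of_ne (Ideal.comap_mono hJ.le) fun he => hJ.ne ?_
    have he' : Ideal.comap e J = Ideal.comap e J' := he
    rw [← Ideal.map_comap_of_surjective e e.surjective J, he', Ideal.map_comap_of_surjective e e.surjective]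
  · exact Ideal.map_le_iff_le_comap.mp hp
end
end

section
set_option linter.all false
set_option autoImplicit false
open MvPolynomial IsLocalRing

section
variable {A : Type*} [CommRing A] {r : ℕ}

/-- the square matrix with first column w and remaining columns n -/
def bordered (n : Fin (r + 1) → Fin r → A) (w : Fin (r + 1) → A) :
    Matrix (Fin (r + 1)) (Fin (r + 1)) A := Matrix.of fun j => Fin.cons (w j) (n j)

/-- signed maximal minors -/
def minorsOf (n : Fin (r + 1) → Fin r → A) (i : Fin (r + 1)) : A :=
  (bordered n (Pi.single i 1)).det

lemma bordered_update (n : Fin (r + 1) → Fin r → A) (w w' : Fin (r + 1) → A) :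
    (bordered n w).updateCol 0 w' = bordered n w' := by
  ext i j
  refine Fin.cases ?_ (fun j => ?_) j
  · simp [bordered]
  · simp [bordered, Matrix.updateCol_apply]

lemma det_bordered (n : Fin (r + 1) → Fin r → A) (w : Fin (r + 1) → A) :
    (bordered n w).det = ∑ i, w i * minorsOf n i := by
  have h : ∀ w, (bordered n w).det = Matrix.cramer (bordered n 0) w 0 := by
    intro w
    rw [Matrix.cramer_apply, bordered_update]
  rw [h w]
  conv_lhs => rw [pi_eq_sum_univ' w]
  rw [map_sum, Finset.sum_apply]
  refine Finset.sum_congr rfl fun i _ => ?_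
  rw [map_smul, Pi.smul_apply, smul_eq_mul, minorsOf, h]

lemma minors_rel (n : Fin (r + 1) → Fin r → A) (k : Fin r) : ∑ i, minorsOf n i * n i k = 0 := by
  have := det_bordered n (fun i => n i k)
  rw [Matrix.det_zero_of_column_eq (i := 0) (j := k.succ) (Fin.succ_ne_zero k).symm] at this
  · rw [this]; exact Finset.sum_congr rfl fun i _ => mul_comm _ _
  · intro j; simp [bordered]

/-- the Cramer map -/
noncomputable def tauOf (n : Fin (r + 1) → Fin r → A) (i : Fin (r + 1)) :
    (Fin r → A) →ₗ[A] (Fin (r + 1) → A) where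
  toFun v := fun k => ∑ l : Fin r, v l * (bordered n (Pi.single i 1)).adjugate l.succ k
  map_add' v w := by ext k; simp [add_mul, Finset.sum_add_distrib]
  map_smul' a v := by ext k; simp [Finset.mul_sum, mul_assoc]

lemma adj_zero (n : Fin (r + 1) → Fin r → A) (i k : Fin (r + 1)) :
    (bordered n (Pi.single i 1)).adjugate 0 k = minorsOf n k := by
  have h := Matrix.cramer_eq_adjugate_mulVec (bordered n (Pi.single i 1)) (Pi.single k 1)
  have h2 := congrFun h 0
  rw [Matrix.cramer_apply, bordered_update] at h2
  rw [minorsOf, h2]; simp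

lemma tau_n (n : Fin (r + 1) → Fin r → A) (i j k : Fin (r + 1)) :
    tauOf n i (n j) k = (if j = k then minorsOf n i else 0) - if i = j then minorsOf n k else 0 := by
  have h := congrFun (congrFun (Matrix.mul_adjugate (bordered n (Pi.single i 1))) j) k
  rw [Matrix.mul_apply, Fin.sum_univ_succ, adj_zero] at h
  simp only [bordered, Matrix.of_apply, Fin.cons_zero, Fin.cons_succ] at h
  rw [eq_sub_iff_add_eq, add_comm]
  have h3 : ((minorsOf n i) • (1 : Matrix (Fin (r+1)) (Fin (r+1)) A)) j k = if j = k then minorsOf n i else 0 := by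
    simp [Matrix.smul_apply, Matrix.one_apply]
  rw [← h3]
  refine Eq.trans ?_ h
  simp only [tauOf, LinearMap.coe_mk, AddHom.coe_mk, bordered]
  congr 1
  by_cases hij : i = j
  · subst hij; simp
  · simp [hij, Pi.single_apply, Ne.symm hij]

lemma sum_tau (n : Fin (r + 1) → Fin r → A) (i : Fin (r + 1)) (v : Fin r → A) (s : Fin r) :
    ∑ k, tauOf n i v k * n k s = minorsOf n i * v s := by
  have h : ∀ l : Fin r, ∑ k, (bordered n (Pi.single i 1)).adjugate l.succ k * n k s =
      if l = s then minorsOf n i else 0 := by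
    intro l
    have h := congrFun (congrFun (Matrix.adjugate_mul (bordered n (Pi.single i 1))) l.succ) s.succ
    rw [Matrix.mul_apply] at h
    simp only [Matrix.smul_apply, Matrix.one_apply, smul_eq_mul, Fin.succ_inj, mul_ite, mul_one, mul_zero] at h
    rw [minorsOf, ← h]
    simp [bordered]
  simp only [tauOf, LinearMap.coe_mk, AddHom.coe_mk, Finset.sum_mul]
  rw [Finset.sum_comm]
  simp only [mul_assoc, ← Finset.mul_sum, h]
  simp [mul_comm]

lemma minors_field {κ : Type*} [Field κ] (φ : A →+* κ) (n : Fin (r + 1) → Fin r → A)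
    (h : ∀ i, φ (minorsOf n i) = 0) : ∃ ξ : Fin r → κ, ξ ≠ 0 ∧ ∀ j, ∑ k, φ (n j k) * ξ k = 0 := by
  by_contra hcon
  push Not at hcon
  let n' : Fin (r + 1) → Fin r → κ := fun j k => φ (n j k)
  have hm : ∀ i, minorsOf n' i = 0 := by
    intro i
    rw [← h i, minorsOf, minorsOf, RingHom.map_det]
    congr 1
    ext a b
    refine Fin.cases ?_ (fun b => ?_) b
    · simp [bordered, Pi.single_apply]
    · simp [bordered, n']
  let col : Fin r → (Fin (r + 1) → κ) := fun k j => n' j k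
  have hli : LinearIndependent κ col := by
    rw [Fintype.linearIndependent_iff]
    intro ξ hξ
    by_contra hne
    have hne' : ξ ≠ 0 := by
      intro h0; apply hne; intro i; rw [h0]; rfl
    obtain ⟨j, hj⟩ := hcon ξ hne'
    apply hj
    have := congrFun hξ j
    simp only [Finset.sum_apply, Pi.smul_apply, smul_eq_mul, Pi.zero_apply] at this
    rw [← this]; exact Finset.sum_congr rfl fun k _ => mul_comm _ _
  have hspan : ∃ w, w ∉ Submodule.span κ (Set.range col) := by
    by_contra hall
    push Not at hall
    have htop : Submodule.span κ (Set.range col) = ⊤ := eq_top_iff.mpr fun w _ => hall w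
    have h1 := finrank_range_le_card (R := κ) col
    rw [Set.finrank, htop, finrank_top] at h1
    simp at h1
  obtain ⟨w, hw⟩ := hspan
  have hli2 : LinearIndependent κ (Fin.cons w col : Fin (r + 1) → Fin (r + 1) → κ) :=
    linearIndependent_finCons.mpr ⟨hli, hw⟩
  have h3 : LinearIndependent κ (bordered n' w).col := by
    convert hli2 using 1
    ext k j
    refine Fin.cases ?_ (fun k => ?_) k
    · simp [bordered]
    · simp [bordered, col]
  rw [Matrix.linearIndependent_cols_iff_isUnit] at h3
  have h4 := (Matrix.isUnit_iff_isUnit_det _).mp h3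
  rw [det_bordered] at h4
  simp [hm] at h4
end
end

section
set_option linter.all false
set_option autoImplicit false
open MvPolynomial IsLocalRing

section
variable {K : Type*} [Field K] {σ : Type*}

/-- polynomials with coefficients in W -/
noncomputable def cf (σ : Type*) (W : Subring K) : Subring (MvPolynomial σ K) :=
  (MvPolynomial.map W.subtype).range

lemma mem_cf {W : Subring K} {p : MvPolynomial σ K} : p ∈ cf σ W ↔ ∀ α, p.coeff α ∈ W := by
  constructor
  · rintro ⟨q, rfl⟩ α
    rw [coeff_map]; exact (q.coeff α).2
  · intro h
    have : p ∈ Set.range (MvPolynomial.map W.subtype) := by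
      rw [MvPolynomial.mem_range_map_iff_coeffs_subset]
      rintro c hc
      obtain ⟨α, _, rfl⟩ := by simpa [MvPolynomial.coeffs] using hc
      simpa using h α
    exact this

lemma C_mem_cf {W : Subring K} {a : K} (h : a ∈ W) : (C a : MvPolynomial σ K) ∈ cf σ W :=
  ⟨C ⟨a, h⟩, by simp⟩

lemma X_mem_cf {W : Subring K} (j : σ) : (X j : MvPolynomial σ K) ∈ cf σ W :=
  ⟨X j, by simp⟩

lemma monomial_mem_cf {W : Subring K} (α : σ →₀ ℕ) {a : K} (h : a ∈ W) :
    (monomial α a : MvPolynomial σ K) ∈ cf σ W :=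
  ⟨monomial α ⟨a, h⟩, by simp⟩

lemma cf_induction {W : Subring K} {T : Subring (MvPolynomial σ K)} (hC : ∀ a ∈ W, C a ∈ T)
    (hX : ∀ j, X j ∈ T) : cf σ W ≤ T := by
  rintro _ ⟨p, rfl⟩
  induction p using MvPolynomial.induction_on with
  | C a => simpa using hC a a.2
  | add p q hp hq => rw [map_add]; exact add_mem hp hq
  | mul_X p j hp => rw [map_mul]; refine mul_mem hp ?_; simpa using hX j

variable {r : ℕ}

/-- linear form in the T variables -/
noncomputable def linT {R : Type*} [CommRing R] {s : ℕ} (u : Fin s → R) : MvPolynomial (Fin s) R :=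
  ∑ j, C (u j) * X j

lemma coeff_linT {R : Type*} [CommRing R] {s : ℕ} (u : Fin s → R) (j : Fin s) :
    (linT u).coeff (Finsupp.single j 1) = u j := by
  classical
  rw [linT, coeff_sum]
  simp only [coeff_C_mul, coeff_X']
  rw [Finset.sum_eq_single j]
  · simp
  · intro b _ hb
    rw [if_neg, mul_zero]
    intro h
    exact hb (Finsupp.single_left_injective one_ne_zero h)
  · simp

lemma linT_mem_cf {W : Subring K} {s : ℕ} {u : Fin s → K} (h : ∀ j, u j ∈ W) : linT u ∈ cf _ W :=
  sum_mem fun j _ => mul_mem (C_mem_cf (h j)) (X_mem_cf j)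

lemma gauss_val (V : ValuationSubring K) {s : ℕ} {u : Fin s → K} (hu : ∀ j, u j ∈ V)
    {α : Fin s → K} (hα : ∀ j, α j ∈ V) (h1 : ∑ j, α j * u j = 1)
    (q : MvPolynomial (Fin s) K) (hq : linT u * q ∈ cf _ V.toSubring) : q ∈ cf _ V.toSubring := by
  by_cases hq0 : q = 0
  · rw [hq0]; exact zero_mem _
  obtain ⟨β, hβ, hmax⟩ := Finset.exists_max_image q.support (fun γ => V.valuation (q.coeff γ))
    (Finset.nonempty_iff_ne_empty.mpr (by simpa using hq0))
  have hβ0 : q.coeff β ≠ 0 := by simpa using hβ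
  have hmax' : ∀ γ, V.valuation (q.coeff γ) ≤ V.valuation (q.coeff β) := by
    intro γ
    by_cases hγ : q.coeff γ = 0
    · rw [hγ, map_zero]; exact zero_le
    · exact hmax γ (by simpa using hγ)
  by_cases hV : q.coeff β ∈ V
  · rw [mem_cf]
    intro γ
    change _ ∈ V
    rw [← V.valuation_le_one_iff] at hV ⊢
    exact (hmax' γ).trans hV
  exfalso
  have hlt : V.valuation (q.coeff β)⁻¹ < 1 := by
    rw [map_inv₀]
    refine inv_lt_one_of_one_lt₀ ?_
    rw [← V.valuation_le_one_iff] at hV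
    exact not_le.mp hV
  have hq' : C (q.coeff β)⁻¹ * q ∈ cf _ V.toSubring := by
    rw [mem_cf]
    intro γ
    change _ ∈ V
    rw [coeff_C_mul, ← V.valuation_le_one_iff, map_mul, map_inv₀]
    have : V.valuation (q.coeff β) ≠ 0 := by simpa using hβ0
    rw [inv_mul_le_iff₀ (zero_lt_iff.mpr this), mul_one]
    exact hmax' γ
  obtain ⟨q', hq'⟩ := hq'
  obtain ⟨l, hl⟩ := linT_mem_cf (W := V.toSubring) hu
  have hinj : Function.Injective (MvPolynomial.map (σ := Fin s) V.toSubring.subtype) :=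
    MvPolynomial.map_injective _ Subtype.val_injective
  have hprod : MvPolynomial.map (IsLocalRing.residue V) (l * q') = 0 := by
    ext γ
    rw [coeff_map, coeff_zero, IsLocalRing.residue_eq_zero_iff]
    have h2 : (((l * q').coeff γ : V) : K) = (q.coeff β)⁻¹ * (linT u * q).coeff γ := by
      have : MvPolynomial.map V.toSubring.subtype (l * q') = C (q.coeff β)⁻¹ * (linT u * q) := by
        rw [map_mul, hl, hq']; ring
      rw [← coeff_C_mul, ← this, coeff_map]; rfl
    refine (V.valuation_lt_one_iff _).mpr ?_
    rw [h2, map_mul]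
    have h3 : V.valuation ((linT u * q).coeff γ) ≤ 1 := (V.valuation_le_one_iff _).mpr (mem_cf.mp hq γ)
    calc _ ≤ V.valuation (q.coeff β)⁻¹ * 1 := by gcongr
      _ < 1 := by rw [mul_one]; exact hlt
  rw [map_mul, mul_eq_zero] at hprod
  rcases hprod with h | h
  · have hz : ∀ j, IsLocalRing.residue V (⟨u j, hu j⟩ : V) = 0 := by
      intro j
      have h2 := congrArg (fun p => coeff (Finsupp.single j 1) p) h
      simp only [coeff_map, coeff_zero] at h2
      rw [← h2]
      congr 1
      apply Subtype.ext
      have h4 := congrArg (fun p => coeff (Finsupp.single j 1) p) hl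
      simp only [coeff_map, coeff_linT] at h4
      exact h4.symm
    have h5 : (∑ j, (⟨α j, hα j⟩ : V) * ⟨u j, hu j⟩) = 1 := by
      apply Subtype.ext
      push_cast
      exact h1
    have h6 := congrArg (IsLocalRing.residue V) h5
    rw [map_sum, Finset.sum_eq_zero (fun j _ => by rw [map_mul, hz, mul_zero]), map_one] at h6
    exact zero_ne_one h6
  · have h2 := congrArg (fun p => coeff β p) h
    simp only [coeff_map, coeff_zero] at h2
    have h4 : ((q'.coeff β : V) : K) = 1 := by
      have h4 := congrArg (fun p => coeff β p) hq'
      simp only [coeff_map, coeff_C_mul] at h4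
      rw [inv_mul_cancel₀ hβ0] at h4
      exact h4
    have h5 : q'.coeff β = (1 : V) := Subtype.ext h4
    rw [h5, map_one] at h2
    exact one_ne_zero h2

lemma gauss_vcl (s' : Set K) {s : ℕ} {u : Fin s → K} (hu : ∀ j, u j ∈ vcl s')
    {α : Fin s → K} (hα : ∀ j, α j ∈ vcl s') (h1 : ∑ j, α j * u j = 1)
    (q : MvPolynomial (Fin s) K) (hq : linT u * q ∈ cf _ (vcl s')) : q ∈ cf _ (vcl s') := by
  rw [mem_cf]
  intro γ
  rw [mem_vcl]
  intro V hV
  refine mem_cf.mp (gauss_val V (fun j => mem_vcl.mp (hu j) V hV) (fun j => mem_vcl.mp (hα j) V hV) h1 q ?_) γ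
  rw [mem_cf] at hq ⊢
  exact fun δ => mem_vcl.mp (hq δ) V hV

/-- evaluation of T at n -/
noncomputable def evT {R : Type*} [CommRing R] (n : Fin (r + 1) → Fin r → R) :
    MvPolynomial (Fin (r + 1)) R →ₐ[R] MvPolynomial (Fin r) R :=
  aeval fun j => linT (n j)

/-- section -/
noncomputable def secT (n : Fin (r + 1) → Fin r → K) (i : Fin (r + 1)) :
    MvPolynomial (Fin r) K →ₐ[K] MvPolynomial (Fin (r + 1)) K :=
  aeval fun k => C (minorsOf n i)⁻¹ * linT (tauOf n i (Pi.single k 1))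

lemma ev_linT {R : Type*} [CommRing R] (n : Fin (r + 1) → Fin r → R) (v : Fin (r + 1) → R) :
    evT n (linT v) = linT (fun s => ∑ k, v k * n k s) := by
  rw [linT, map_sum]
  simp only [map_mul, evT, aeval_X, linT, map_sum, algHom_C, Finset.mul_sum, Finset.sum_mul]
  rw [Finset.sum_comm]
  simp [mul_assoc, algebraMap_eq]

lemma ev_secT (n : Fin (r + 1) → Fin r → K) (i : Fin (r + 1)) (hi : minorsOf n i ≠ 0) (g) :
    evT n (secT n i g) = g := by
  have : (evT n).comp (secT n i) = AlgHom.id K _ := by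
    apply MvPolynomial.algHom_ext
    intro k
    simp only [AlgHom.comp_apply, secT, aeval_X, AlgHom.id_apply]
    rw [map_mul, ev_linT]
    simp only [sum_tau, algHom_C, algebraMap_eq]
    rw [linT, Finset.mul_sum]
    simp only [← mul_assoc, ← map_mul, inv_mul_cancel₀ hi]
    rw [Finset.sum_eq_single k]
    · simp [hi]
    · intro b _ hb; simp [hb]
    · simp
  exact DFunLike.congr_fun this g

lemma linT_add {R : Type*} [CommRing R] {s : ℕ} (u v : Fin s → R) : linT (u + v) = linT u + linT v := by
  simp [linT, add_mul, Finset.sum_add_distrib]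

lemma linT_smul {R : Type*} [CommRing R] {s : ℕ} (a : R) (u : Fin s → R) : linT (a • u) = C a * linT u := by
  simp [linT, Finset.mul_sum, mul_assoc]

lemma linT_sum {R : Type*} [CommRing R] {s : ℕ} {ι : Type*} (t : Finset ι) (u : ι → Fin s → R) :
    linT (∑ i ∈ t, u i) = ∑ i ∈ t, linT (u i) := by
  simp only [linT, Finset.sum_apply, map_sum, Finset.sum_mul]
  rw [Finset.sum_comm]

lemma secT_linT (n : Fin (r + 1) → Fin r → K) (i : Fin (r + 1)) (v : Fin r → K) :
    secT n i (linT v) = C (minorsOf n i)⁻¹ * linT (tauOf n i v) := by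
  conv_rhs => rw [pi_eq_sum_univ' v, map_sum, linT_sum, Finset.mul_sum]
  rw [linT, map_sum]
  refine Finset.sum_congr rfl fun k _ => ?_
  rw [map_mul, algHom_C, secT, aeval_X, map_smul, linT_smul, algebraMap_eq]
  ring

lemma secT_n (n : Fin (r + 1) → Fin r → K) (i : Fin (r + 1)) (hi : minorsOf n i ≠ 0) (j) :
    secT n i (linT (n j)) = X j - if i = j then C (minorsOf n i)⁻¹ * linT (minorsOf n) else 0 := by
  rw [secT_linT]
  have : tauOf n i (n j) = minorsOf n i • Pi.single j 1 + (if i = j then -1 else 0 : K) • minorsOf n := by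
    ext k
    rw [tau_n]
    by_cases h : j = k
    · subst h
      rw [if_pos rfl]
      split_ifs <;> simp; ring
    · split_ifs <;> simp [h, Ne.symm h]
  rw [this, linT_add, linT_smul, linT_smul, mul_add, ← mul_assoc, ← map_mul, inv_mul_cancel₀ hi]
  have h2 : linT (Pi.single j (1 : K)) = X j := by
    rw [linT, Finset.sum_eq_single j]
    · simp
    · intro b _ hb; simp [hb]
    · simp
  rw [h2]
  split_ifs <;> simp
  ring
end
end

section
set_option linter.all false
set_option autoImplicit false
open MvPolynomial IsLocalRing

section
lemma integral_transfer {R S T U : Type*} [CommRing R] [CommRing S] [CommRing T] [CommRing U]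
    (f : R →+* S) (φ : S →+* U) (g : T →+* U) (h : ∀ a, φ (f a) ∈ g.range) {x : S}
    (hx : f.IsIntegralElem x) : g.IsIntegralElem (φ x) := by
  obtain ⟨p, hp, hpx⟩ := hx
  have hl : p.map (φ.comp f) ∈ Polynomial.lifts g := by
    rw [Polynomial.lifts_iff_coeff_lifts]
    intro i
    rw [Polynomial.coeff_map]
    exact h _
  obtain ⟨q, hq, -, hqm⟩ := Polynomial.lifts_and_natDegree_eq_and_monic hl (hp.map _)
  refine ⟨q, hqm, ?_⟩
  rw [← Polynomial.eval_map, hq, Polynomial.eval_map, ← Polynomial.hom_eval₂, hpx, map_zero]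

variable {K : Type*} [Field K] {r : ℕ}

lemma alpha_loc (s' : Set K) (n : Fin (r + 1) → Fin r → K) {e : K} (he : e ≠ 0)
    {u : Fin (r + 1) → K} (hc : ∀ i, minorsOf n i = e * u i) (hu : ∀ i, u i ∈ vcl s')
    {g : MvPolynomial (Fin r) K}
    (hg : (((cf _ (vcl s')).map (evT n).toRingHom).subtype).IsIntegralElem g) (i : Fin (r + 1)) :
    ∃ k : ℕ, ∃ p ∈ cf _ (vcl s'), evT n p = C (u i ^ k) * g := by
  by_cases hui : u i = 0
  · exact ⟨1, 0, zero_mem _, by simp [hui]⟩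
  have hci : minorsOf n i ≠ 0 := by rw [hc]; exact mul_ne_zero he hui
  have hco : ∀ γ, (secT n i g).coeff γ ∈ vcl ((vcl s' : Set K) ∪ {(u i)⁻¹}) := by
    intro γ
    rw [mem_vcl]
    intro V hV
    have hWV : ∀ z ∈ vcl s', z ∈ V := fun z hz => hV (Or.inl hz)
    have huV : (u i)⁻¹ ∈ V := hV (Or.inr rfl)
    have key : cf (Fin (r + 1)) (vcl s') ≤ (cf (Fin (r + 1)) V.toSubring).comap
        ((secT n i).toRingHom.comp (evT n).toRingHom) := by
      apply cf_induction
      · intro a ha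
        change secT n i (evT n (C a)) ∈ cf (Fin (r + 1)) V.toSubring
        rw [algHom_C, algebraMap_eq, algHom_C, algebraMap_eq]
        exact C_mem_cf (hWV a ha)
      · intro j
        change secT n i (evT n (X j)) ∈ cf (Fin (r + 1)) V.toSubring
        have : evT n (X j) = linT (n j) := by simp [evT]
        rw [this, secT_n n i hci]
        refine sub_mem (X_mem_cf j) ?_
        split_ifs
        · rw [← linT_smul]
          refine linT_mem_cf fun l => ?_
          change _ ∈ V
          rw [Pi.smul_apply, smul_eq_mul, hc, hc]
          have : (e * u i)⁻¹ * (e * u l) = (u i)⁻¹ * u l := by field_simp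
          rw [this]
          exact mul_mem huV (hWV _ (hu l))
        · exact zero_mem _
    have hIntg : (MvPolynomial.map (σ := Fin (r + 1)) V.toSubring.subtype).IsIntegralElem (secT n i g) := by
      refine integral_transfer _ (secT n i).toRingHom _ ?_ hg
      rintro ⟨_, p, hp, rfl⟩
      exact key hp
    letI := MvPolynomial.algebraMvPolynomial (σ := Fin (r + 1)) (R := V) (S := K)
    have hIntg' : IsIntegral (MvPolynomial (Fin (r + 1)) V) (secT n i g) := by
      rw [IsIntegral, MvPolynomial.algebraMap_def]; exact hIntg
    rw [MvPolynomial.isIntegral_iff_isIntegral_coeff] at hIntg'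
    obtain ⟨y, hy⟩ := IsIntegrallyClosed.isIntegral_iff.mp (hIntg' γ)
    rw [← hy]; exact y.2
  have hclear : ∀ γ, ∃ k : ℕ, u i ^ k * (secT n i g).coeff γ ∈ vcl s' := by
    intro γ
    obtain ⟨σ, hσ, h2⟩ := vcl_clear (s' := s') (Submonoid.powers (u i))
      (by rintro _ ⟨k, rfl⟩; exact pow_mem (hu i) k) (by
        intro d hd
        have hd' : d ∈ bl (vcl s') (u i)⁻¹ := by rw [← closure_union_singleton]; exact hd
        obtain ⟨p, rfl⟩ := mem_bl.mp hd'
        refine ⟨u i ^ p.natDegree, ⟨_, rfl⟩, ?_⟩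
        rw [Polynomial.aeval_eq_sum_range, Finset.mul_sum]
        refine sum_mem fun j hj => ?_
        have hj' : j ≤ p.natDegree := by have := Finset.mem_range.mp hj; omega
        obtain ⟨l, hl⟩ := Nat.exists_eq_add_of_le hj'
        have : u i ^ p.natDegree * p.coeff j • (u i)⁻¹ ^ j = (p.coeff j : K) * u i ^ l := by
          rw [hl, pow_add, Subring.smul_def, smul_eq_mul, inv_pow]
          field_simp
        rw [this]
        exact mul_mem (p.coeff j).2 (pow_mem (hu i) _)) (hco γ)
    obtain ⟨k, rfl⟩ := hσ
    exact ⟨k, h2⟩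
  choose k hk using hclear
  refine ⟨(secT n i g).support.sup k, C (u i ^ _) * secT n i g, ?_, by
    rw [map_mul, ev_secT n i hci, algHom_C, algebraMap_eq]⟩
  rw [mem_cf]
  intro γ
  rw [coeff_C_mul]
  by_cases hγ : (secT n i g).coeff γ = 0
  · rw [hγ, mul_zero]; exact zero_mem _
  · obtain ⟨l, hl⟩ := Nat.exists_eq_add_of_le
      (Finset.le_sup (f := k) (show γ ∈ (secT n i g).support by simpa using hγ))
    rw [hl, pow_add, mul_comm (u i ^ k γ), mul_assoc]
    exact mul_mem (pow_mem (hu i) l) (hk γ)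

lemma alpha_main (s' : Set K) (n : Fin (r + 1) → Fin r → K) {e : K} (he : e ≠ 0)
    {u : Fin (r + 1) → K} (hc : ∀ i, minorsOf n i = e * u i) (hu : ∀ i, u i ∈ vcl s')
    {α : Fin (r + 1) → K} (hα : ∀ j, α j ∈ vcl s') (h1 : ∑ j, α j * u j = 1)
    {g : MvPolynomial (Fin r) K}
    (hg : (((cf _ (vcl s')).map (evT n).toRingHom).subtype).IsIntegralElem g) :
    ∃ p ∈ cf _ (vcl s'), evT n p = g := by
  choose k hk using alpha_loc s' n he hc hu hg
  let I : Ideal (vcl s') :=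
    { carrier := {w | ∃ p ∈ cf _ (vcl s'), evT n p = C (w : K) * g}
      add_mem' := by
        rintro w w' ⟨p, hp, h⟩ ⟨p', hp', h'⟩
        exact ⟨p + p', add_mem hp hp', by rw [map_add, h, h']; push_cast; rw [C_add]; ring⟩
      zero_mem' := ⟨0, zero_mem _, by simp⟩
      smul_mem' := by
        rintro w w' ⟨p, hp, h⟩
        refine ⟨C (w : K) * p, mul_mem (C_mem_cf w.2) hp, ?_⟩
        rw [map_mul, h, algHom_C, algebraMap_eq, smul_eq_mul]; push_cast; rw [C_mul]; ring }
  have hsp : Ideal.span (Set.range fun i => (⟨u i, hu i⟩ : vcl s')) = ⊤ := by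
    rw [Ideal.eq_top_iff_one]
    have : (1 : vcl s') = ∑ j, (⟨α j, hα j⟩ : vcl s') * ⟨u j, hu j⟩ := by
      apply Subtype.ext; push_cast; exact h1.symm
    rw [this]
    exact sum_mem fun j _ => Ideal.mul_mem_left _ _ (Ideal.subset_span ⟨j, rfl⟩)
  have hsp2 := Ideal.span_pow_eq_top _ hsp (∑ i, k i)
  have hI : I = ⊤ := by
    rw [eq_top_iff, ← hsp2, Ideal.span_le]
    rintro _ ⟨_, ⟨i, rfl⟩, rfl⟩
    obtain ⟨l, hl⟩ := Nat.exists_eq_add_of_le (Finset.single_le_sum (f := k) (fun _ _ => Nat.zero_le _) (Finset.mem_univ i))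
    simp only
    rw [hl, pow_add]
    exact I.mul_mem_right _ (hk i)
  obtain ⟨p, hp, h⟩ := (Ideal.eq_top_iff_one _).mp hI
  exact ⟨p, hp, by rw [h]; simp⟩

lemma beta_main (s' : Set K) (n : Fin (r + 1) → Fin r → K) {e : K} (he : e ≠ 0)
    {u : Fin (r + 1) → K} (hc : ∀ i, minorsOf n i = e * u i) (hu : ∀ i, u i ∈ vcl s')
    {α : Fin (r + 1) → K} (hα : ∀ j, α j ∈ vcl s') (h1 : ∑ j, α j * u j = 1)
    {p : MvPolynomial (Fin (r + 1)) K} (hp : p ∈ cf _ (vcl s')) (h0 : evT n p = 0) :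
    ∃ q ∈ cf _ (vcl s'), p = linT u * q := by
  have hex : ∃ i, u i ≠ 0 := by
    by_contra hcon
    push Not at hcon
    simp [hcon] at h1
  obtain ⟨i, hi⟩ := hex
  have hci : minorsOf n i ≠ 0 := by rw [hc]; exact mul_ne_zero he hi
  have hmem : p ∈ Ideal.span {linT u} := by
    have : (Ideal.Quotient.mkₐ K (Ideal.span {linT u})) =
        (Ideal.Quotient.mkₐ K (Ideal.span {linT u})).comp ((secT n i).comp (evT n)) := by
      apply MvPolynomial.algHom_ext
      intro j
      have h2 : evT n (X j) = linT (n j) := by simp [evT]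
      rw [AlgHom.comp_apply, AlgHom.comp_apply, h2, secT_n n i hci, map_sub]
      have h3 : linT (minorsOf n) = C e * linT u := by
        rw [← linT_smul]; congr 1; ext l; rw [hc]; rfl
      rw [eq_comm, sub_eq_self, h3]
      split_ifs
      · rw [Ideal.Quotient.mkₐ_eq_mk, Ideal.Quotient.eq_zero_iff_mem]
        exact Ideal.mul_mem_left _ _ (Ideal.mul_mem_left _ _ (Ideal.mem_span_singleton_self _))
      · simp
    have h4 := DFunLike.congr_fun this p
    rw [AlgHom.comp_apply, AlgHom.comp_apply, h0, map_zero, map_zero, Ideal.Quotient.mkₐ_eq_mk,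
      Ideal.Quotient.eq_zero_iff_mem] at h4
    exact h4
  obtain ⟨q, hq⟩ := Ideal.mem_span_singleton'.mp hmem
  refine ⟨q, gauss_vcl s' hu hα h1 q ?_, by rw [← hq, mul_comm]⟩
  rw [mul_comm, hq]; exact hp
end
end

section
set_option linter.all false
set_option autoImplicit false
open MvPolynomial IsLocalRing

section
lemma minors_map {A B : Type*} [CommRing A] [CommRing B] {r : ℕ} (φ : A →+* B)
    (n : Fin (r + 1) → Fin r → A) (i) : minorsOf (fun j k => φ (n j k)) i = φ (minorsOf n i) := by
  rw [minorsOf, minorsOf, RingHom.map_det]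
  congr 1
  ext a b
  refine Fin.cases ?_ (fun b => ?_) b
  · simp [bordered, Pi.single_apply]
  · simp [bordered]

lemma map_linT {A B : Type*} [CommRing A] [CommRing B] {s : ℕ} (φ : A →+* B) (u : Fin s → A) :
    MvPolynomial.map φ (linT u) = linT (fun j => φ (u j)) := by
  simp [linT]

lemma map_evT {A B : Type*} [CommRing A] [CommRing B] {r : ℕ} (φ : A →+* B)
    (n : Fin (r + 1) → Fin r → A) (p) :
    MvPolynomial.map φ (evT n p) = evT (fun j k => φ (n j k)) (MvPolynomial.map φ p) := by
  induction p using MvPolynomial.induction_on with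
  | C a => simp [algHom_C, algebraMap_eq]
  | add p q hp hq => simp [hp, hq]
  | mul_X p j hp =>
    have h : ∀ {R : Type _} [CommRing R] (n : Fin (r + 1) → Fin r → R), evT n (X j) = linT (n j) := by
      intro R _ n; simp [evT]
    rw [map_mul, map_mul, hp, map_mul, map_X, map_mul, h, map_linT]
    congr 1
    simp [evT]

variable {A : Type*} [CommRing A] [IsDomain A] {K : Type*} [Field K] [Algebra A K]
  [IsFractionRing A K] {r : ℕ}

lemma vcl_inter (hA : RRC (imgA A K)) {f z : K} (h1 : z ∈ vcl ((imgA A K : Set K) ∪ {f}))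
    (h2 : z ∈ vcl ((imgA A K : Set K) ∪ {f⁻¹})) : z ∈ imgA A K := by
  haveI := hA.loc
  haveI := hA.noeth
  obtain ⟨x, y, hm, hx⟩ := hA.gens
  rw [← vcl_of_normal hm hx hA.frac, mem_vcl]
  intro V hV
  rcases V.mem_or_inv_mem f with h | h
  · exact mem_vcl.mp h1 V (Set.union_subset hV (by simpa using h))
  · exact mem_vcl.mp h2 V (Set.union_subset hV (by simpa using h))

lemma lbar (hA : RRC (imgA A K)) (n : Fin (r + 1) → Fin r → A) {f : K} {P Q : Fin (r + 1) → K}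
    (hP : ∀ i, P i ∈ vcl ((imgA A K : Set K) ∪ {f})) (hQ : ∀ i, Q i ∈ vcl ((imgA A K : Set K) ∪ {f⁻¹}))
    (hPQ : ∀ k, ∑ i, P i * algebraMap A K (n i k) = ∑ i, Q i * algebraMap A K (n i k)) :
    ∃ v : Fin r → A, (∀ k, algebraMap A K (v k) = ∑ i, P i * algebraMap A K (n i k)) ∧
      (evT n).range.val.toRingHom.IsIntegralElem (linT v) := by
  have hn : ∀ (s : Set K) i k, algebraMap A K (n i k) ∈ vcl ((imgA A K : Set K) ∪ s) :=
    fun s i k => subset_vcl _ (Or.inl ⟨_, rfl⟩)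
  have hv : ∀ k, ∃ v, algebraMap A K v = ∑ i, P i * algebraMap A K (n i k) := by
    intro k
    refine vcl_inter hA (f := f) (sum_mem fun i _ => mul_mem (hP i) (hn _ i k)) ?_
    rw [hPQ]
    exact sum_mem fun i _ => mul_mem (hQ i) (hn _ i k)
  choose v hv using hv
  refine ⟨v, hv, ?_⟩
  let 𝕃 := FractionRing (MvPolynomial (Fin r) K)
  let ψ : MvPolynomial (Fin r) K →+* 𝕃 := algebraMap _ _
  let φ : MvPolynomial (Fin r) A →+* 𝕃 := ψ.comp (MvPolynomial.map (algebraMap A K))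
  have hφ : Function.Injective φ := (IsFractionRing.injective (MvPolynomial (Fin r) K) 𝕃).comp
    (MvPolynomial.map_injective _ (IsFractionRing.injective A K))
  let ι : K →+* 𝕃 := ψ.comp C
  have hmem : φ (linT v) ∈ vcl (φ '' ((evT n).range : Set (MvPolynomial (Fin r) A))) := by
    rw [mem_vcl]
    intro V hV
    have hAV : ∀ w ∈ imgA A K, ι w ∈ V := by
      rintro _ ⟨w, rfl⟩
      refine hV ⟨C w, ⟨C w, by simp [algHom_C, algebraMap_eq]⟩, ?_⟩
      simp [φ, ι]
    have hnV : ∀ i, ψ (linT fun k => algebraMap A K (n i k)) ∈ V := by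
      intro i
      refine hV ⟨linT (n i), ⟨X i, by simp [evT]⟩, ?_⟩
      simp [φ, map_linT]
    have hgen : ∀ (P : Fin (r + 1) → K), (∀ i, ι (P i) ∈ V) →
        (∀ k, algebraMap A K (v k) = ∑ i, P i * algebraMap A K (n i k)) → φ (linT v) ∈ V := by
      intro P hP h
      have : φ (linT v) = ∑ i, ι (P i) * ψ (linT fun k => algebraMap A K (n i k)) := by
        simp only [φ, ι, RingHom.comp_apply, map_linT, ← map_mul, ← map_sum]
        congr 1
        simp only [← linT_smul, ← linT_sum]
        congr 1
        ext k
        rw [h]; simp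
      rw [this]
      exact sum_mem fun i _ => mul_mem (hP i) (hnV i)
    rcases V.mem_or_inv_mem (ι f) with hf | hf
    · refine hgen P (fun i => ?_) hv
      have := mem_vcl.mp (hP i) (V.comap ι) (Set.union_subset (fun w hw => hAV w hw) (by simpa using hf))
      exact this
    · refine hgen Q (fun i => ?_) (fun k => by rw [hv, hPQ])
      have := mem_vcl.mp (hQ i) (V.comap ι) (Set.union_subset (fun w hw => hAV w hw) (by
        rw [← map_inv₀] at hf
        simpa using hf))
      exact this
  rw [mem_vcl_iff] at hmem
  have h2 : (φ.comp (evT n).range.val.toRingHom).IsIntegralElem (φ (linT v)) := by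
    refine integral_transfer _ (RingHom.id 𝕃) _ ?_ hmem
    rintro ⟨w, hw⟩
    have hcl : Subring.closure (φ '' ((evT n).range : Set (MvPolynomial (Fin r) A))) ≤
        (φ.comp (evT n).range.val.toRingHom).range := by
      rw [Subring.closure_le]
      rintro _ ⟨z, hz, rfl⟩
      exact ⟨⟨z, hz⟩, rfl⟩
    exact hcl hw
  obtain ⟨p, hp, hpe⟩ := h2
  refine ⟨p, hp, hφ ?_⟩
  rw [Polynomial.hom_eval₂, hpe, map_zero]

theorem core_gen (hA : RRC (imgA A K)) (n : Fin (r + 1) → Fin r → A) {a b : A}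
    (ha : a ≠ 0) (hb : b ≠ 0)
    (hH : HDec (imgA A K) (algebraMap A K b / algebraMap A K a))
    (hca : ∀ i, algebraMap A K (minorsOf n i) / algebraMap A K a ∈
      vcl ((imgA A K : Set K) ∪ {algebraMap A K b / algebraMap A K a}))
    (hcb : ∀ i, algebraMap A K (minorsOf n i) / algebraMap A K b ∈
      vcl ((imgA A K : Set K) ∪ {(algebraMap A K b / algebraMap A K a)⁻¹}))
    (haJ : a ∈ Ideal.span (Set.range (minorsOf n))) (hbJ : b ∈ Ideal.span (Set.range (minorsOf n)))
    (g : MvPolynomial (Fin r) A) (hg : (evT n).range.val.toRingHom.IsIntegralElem g) :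
    ∃ (p : MvPolynomial (Fin (r + 1)) A) (lam : Fin r → MvPolynomial (Fin (r + 1)) A),
      (∀ α, (evT n).range.val.toRingHom.IsIntegralElem (linT fun k => (lam k).coeff α)) ∧
      g = evT n p + ∑ k, evT n (lam k) * X k := by
  set f : K := algebraMap A K b / algebraMap A K a with hf
  set φ := algebraMap A K
  have hinj : Function.Injective φ := IsFractionRing.injective A K
  have ha' : φ a ≠ 0 := by rwa [Ne, map_eq_zero_iff _ hinj]
  have hb' : φ b ≠ 0 := by rwa [Ne, map_eq_zero_iff _ hinj]
  set n' : Fin (r + 1) → Fin r → K := fun j k => φ (n j k) with hn'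
  have huni : ∀ (e : A), e ≠ 0 → e ∈ Ideal.span (Set.range (minorsOf n)) →
      ∃ α : Fin (r + 1) → A, ∑ j, φ (α j) * (φ (minorsOf n j) / φ e) = 1 := by
    intro e he hee
    obtain ⟨α, hα⟩ := (Ideal.mem_span_range_iff_exists_fun).mp hee
    refine ⟨α, ?_⟩
    have : φ e ≠ 0 := by rwa [Ne, map_eq_zero_iff _ hinj]
    have h2 : φ e = ∑ j, φ (α j) * φ (minorsOf n j) := by
      rw [← hα, map_sum]; simp
    simp only [mul_div, ← Finset.sum_div]
    rw [← h2, div_self this]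
  have hintK : ∀ (W : Set K), (((cf _ (vcl ((imgA A K : Set K) ∪ W))).map
      (evT n').toRingHom).subtype).IsIntegralElem (MvPolynomial.map φ g) := by
    intro W
    refine integral_transfer _ (MvPolynomial.map φ) _ ?_ hg
    rintro ⟨_, p, rfl⟩
    refine ⟨⟨_, MvPolynomial.map φ p, ?_, rfl⟩, ?_⟩
    · refine mem_cf.mpr (fun α => ?_)
      rw [coeff_map]
      exact subset_vcl _ (Or.inl ⟨_, rfl⟩)
    · exact (map_evT φ n p).symm
  have hAW : ∀ (W : Set K) (w : A), φ w ∈ vcl ((imgA A K : Set K) ∪ W) :=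
    fun W w => subset_vcl _ (Or.inl ⟨_, rfl⟩)
  have hcc : ∀ (e : A), e ≠ 0 → ∀ i, minorsOf n' i = φ e * (φ (minorsOf n i) / φ e) := by
    intro e he i
    have : φ e ≠ 0 := by rwa [Ne, map_eq_zero_iff _ hinj]
    rw [hn', minors_map]; field_simp
  obtain ⟨α, hα⟩ := huni a ha haJ
  obtain ⟨β, hβ⟩ := huni b hb hbJ
  obtain ⟨pa, hpa, hea⟩ := alpha_main _ n' ha' (hcc a ha) hca (fun j => hAW _ (α j)) hα (hintK {f})
  obtain ⟨pb, hpb, heb⟩ := alpha_main _ n' hb' (hcc b hb) hcb (fun j => hAW _ (β j)) hβ (hintK {f⁻¹})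
  have hle1 : vcl ((imgA A K : Set K) ∪ {f}) ≤ vcl ((imgA A K : Set K) ∪ {f, f⁻¹}) :=
    vcl_mono (Set.union_subset_union_right _ (by simp))
  have hle2 : vcl ((imgA A K : Set K) ∪ {f⁻¹}) ≤ vcl ((imgA A K : Set K) ∪ {f, f⁻¹}) :=
    vcl_mono (Set.union_subset_union_right _ (by simp))
  set u : Fin (r + 1) → K := fun i => φ (minorsOf n i) / φ a with hu
  obtain ⟨q, hq, hpq⟩ := beta_main ((imgA A K : Set K) ∪ {f, f⁻¹}) n' ha' (hcc a ha)
    (fun i => hle1 (hca i)) (fun j => hAW _ (α j)) hα (p := pa - pb)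
    (by
      rw [mem_cf] at hpa hpb ⊢
      intro γ
      rw [coeff_sub]
      exact sub_mem (hle1 (hpa γ)) (hle2 (hpb γ))) (by rw [map_sub, hea, heb, sub_self])
  have hdec : ∀ (γ : Fin (r + 1) →₀ ℕ) i, ∃ x ∈ vcl ((imgA A K : Set K) ∪ {f}),
      ∃ y ∈ vcl ((imgA A K : Set K) ∪ {f⁻¹}), u i * q.coeff γ = x - y := by
    intro γ i
    obtain ⟨x, hx, y, hy, h⟩ := hH (u i * q.coeff γ) (mul_mem (hle1 (hca i)) (mem_cf.mp hq γ))
    exact ⟨x, hx, -y, neg_mem hy, by rw [h]; ring⟩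
  choose P hP Q hQ hPQ using hdec
  have hrel : ∀ k, ∑ i, u i * n' i k = 0 := by
    intro k
    have h := minors_rel n k
    have h2 : ∑ i, u i * n' i k = φ (∑ i, minorsOf n i * n i k) / φ a := by
      rw [map_sum, Finset.sum_div]
      refine Finset.sum_congr rfl fun i _ => ?_
      rw [map_mul, hu, hn']; field_simp
    rw [h2, h]; simp
  have hl := fun γ => lbar hA n (hP γ) (hQ γ) (fun k => by
    rw [← sub_eq_zero, ← Finset.sum_sub_distrib]
    calc _ = ∑ i, q.coeff γ * (u i * n' i k) := Finset.sum_congr rfl fun i _ => by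
              rw [← sub_mul, ← hPQ]; ring
      _ = 0 := by rw [← Finset.mul_sum, hrel, mul_zero])
  choose v hv hvint using hl
  set p' := pa - ∑ γ ∈ q.support, monomial γ 1 * linT (P γ) with hp'
  have hp'b : p' = pb - ∑ γ ∈ q.support, monomial γ 1 * linT (Q γ) := by
    have h1 : pa = pb + linT u * q := by rw [← hpq]; ring
    have h2 : linT u * q = ∑ γ ∈ q.support, monomial γ 1 * linT (P γ)
        - ∑ γ ∈ q.support, monomial γ 1 * linT (Q γ) := by
      rw [← Finset.sum_sub_distrib]
      conv_lhs => rw [q.as_sum, Finset.mul_sum]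
      refine Finset.sum_congr rfl fun γ _ => ?_
      have h3 : P γ = q.coeff γ • u + Q γ := by
        ext i; simp only [Pi.add_apply, Pi.smul_apply, smul_eq_mul]
        have := hPQ γ i
        linear_combination -this
      rw [h3, linT_add, linT_smul]
      have h4 : (monomial γ (q.coeff γ) : MvPolynomial (Fin (r + 1)) K) = C (q.coeff γ) * monomial γ 1 := by
        rw [C_mul_monomial, mul_one]
      rw [h4]; ring
    rw [hp', h1, h2]; ring
  have hp'mem : ∀ γ, p'.coeff γ ∈ imgA A K := by
    intro γ
    refine vcl_inter hA (f := f) ?_ ?_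
    · refine mem_cf.mp (?_ : p' ∈ cf _ (vcl ((imgA A K : Set K) ∪ {f}))) γ
      exact sub_mem hpa (sum_mem fun δ _ => mul_mem (monomial_mem_cf _ (one_mem _)) (linT_mem_cf (hP δ)))
    · refine mem_cf.mp (?_ : p' ∈ cf _ (vcl ((imgA A K : Set K) ∪ {f⁻¹}))) γ
      rw [hp'b]
      exact sub_mem hpb (sum_mem fun δ _ => mul_mem (monomial_mem_cf _ (one_mem _)) (linT_mem_cf (hQ δ)))
  have hlift : ∃ p : MvPolynomial (Fin (r + 1)) A, MvPolynomial.map φ p = p' := by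
    have : p' ∈ Set.range (MvPolynomial.map φ) := by
      rw [MvPolynomial.mem_range_map_iff_coeffs_subset]
      rintro c hc
      obtain ⟨γ, _, rfl⟩ := by simpa [MvPolynomial.coeffs] using hc
      exact hp'mem γ
    exact this
  obtain ⟨p, hp⟩ := hlift
  refine ⟨p, fun k => ∑ γ ∈ q.support, monomial γ (v γ k), ?_, ?_⟩
  · intro γ
    by_cases hγ : γ ∈ q.support
    · convert hvint γ using 3
      rw [coeff_sum]; classical
      simp only [coeff_monomial]
      rw [Finset.sum_eq_single γ] <;> simp_all
    · have : (fun k => coeff γ (∑ γ ∈ q.support, monomial γ (v γ k))) = 0 := by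
        ext k
        rw [coeff_sum]; classical
        refine Finset.sum_eq_zero fun δ hδ => ?_
        rw [coeff_monomial, if_neg]
        rintro rfl; exact hγ hδ
      rw [this]
      have h0 : linT (0 : Fin r → A) = 0 := by simp [linT]
      rw [h0]
      exact ⟨Polynomial.X, Polynomial.monic_X, by simp⟩
  · apply MvPolynomial.map_injective φ hinj
    rw [← hea]
    have h1 : pa = p' + ∑ γ ∈ q.support, monomial γ 1 * linT (P γ) := by rw [hp']; ring
    rw [h1, map_add, map_add, map_evT, hp, map_sum, map_sum]
    congr 1
    have h2 : ∀ γ, evT n' (linT (P γ)) = ∑ k, C (φ (v γ k)) * X k := by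
      intro γ
      rw [ev_linT, linT]
      exact Finset.sum_congr rfl fun k _ => by rw [hv]
    simp only [map_mul, h2, map_evT, map_sum, map_X]
    simp only [Finset.mul_sum, Finset.sum_mul]
    rw [Finset.sum_comm]
    refine Finset.sum_congr rfl fun k _ => Finset.sum_congr rfl fun γ _ => ?_
    have h4 : (MvPolynomial.map φ (monomial γ (v γ k))) = C (φ (v γ k)) * monomial γ 1 := by
      rw [map_monomial, C_mul_monomial, mul_one]
    rw [h4, map_mul, algHom_C, algebraMap_eq]; ring
end
end

section
set_option linter.all false
set_option autoImplicit false
open MvPolynomial IsLocalRing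

section
variable {A : Type} [CommRing A]

lemma emb_eq_linT {r : ℕ} (v : Fin r → A) : emb A r v = linT v := by
  simp [emb, linT, Fintype.linearCombination_apply, MvPolynomial.smul_eq_C_mul]

lemma hfin_of_len [IsLocalRing A] [IsNoetherianRing A] {r : ℕ} {M : Submodule A (Fin r → A)}
    (hlen : ∃ n : ℕ, modLength A ((Fin r → A) ⧸ M) = (n : WithBot ℕ∞)) :
    ∃ s : ℕ, ∀ a ∈ maximalIdeal A ^ s, ∀ f, a • f ∈ M := by
  obtain ⟨n, hn⟩ := hlen
  have h1 : Module.length A ((Fin r → A) ⧸ M) ≠ ⊤ := by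
    intro h
    rw [modLength, ← Module.coe_length, h] at hn
    exact absurd (WithBot.coe_injective hn) (by simp)
  rw [Module.length_ne_top_iff, isFiniteLength_iff_isNoetherian_isArtinian] at h1
  obtain ⟨_, hA⟩ := h1
  let f : ℕ →o (Submodule A ((Fin r → A) ⧸ M))ᵒᵈ :=
    ⟨fun k => OrderDual.toDual ((maximalIdeal A ^ k) • (⊤ : Submodule A ((Fin r → A) ⧸ M))),
      fun i j h => Submodule.smul_mono_left (Ideal.pow_le_pow_right h)⟩
  obtain ⟨s, hs⟩ := IsArtinian.monotone_stabilizes f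
  have h2 : (maximalIdeal A ^ s) • (⊤ : Submodule A ((Fin r → A) ⧸ M)) = ⊥ := by
    refine Submodule.eq_bot_of_le_smul_of_le_jacobson_bot (maximalIdeal A) _
      (IsNoetherian.noetherian _) ?_ (IsLocalRing.jacobson_eq_maximalIdeal _ bot_ne_top).ge
    have h3 : (maximalIdeal A ^ s) • (⊤ : Submodule A ((Fin r → A) ⧸ M)) =
      (maximalIdeal A ^ (s+1)) • (⊤ : Submodule A ((Fin r → A) ⧸ M)) := hs (s + 1) (by omega)
    rw [← Submodule.mul_smul, ← pow_succ', ← h3]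
  refine ⟨s, fun a ha f => ?_⟩
  have : a • (M.mkQ f) ∈ (maximalIdeal A ^ s) • (⊤ : Submodule A ((Fin r → A) ⧸ M)) :=
    Submodule.smul_mem_smul ha trivial
  rw [h2, Submodule.mem_bot, ← map_smul] at this
  exact (Submodule.Quotient.mk_eq_zero _).mp this

/-- adjoining an algebraic (degree one) element does not raise the dimension -/
lemma dim_adjoin_one {S : Type*} [CommRing S] [IsDomain S] (B C : Subring S) [IsNoetherianRing B]
    (z : S) (hBC : ∀ x ∈ C, ∃ p : Polynomial B, Polynomial.eval₂ B.subtype z p = x)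
    (hB : B ≤ C) (hz : z ∈ C)
    (d : S) (hd : d ∈ B) (hd0 : d ≠ 0) (hdz : d * z ∈ B) : ringKrullDim C ≤ ringKrullDim B := by
  let f : Polynomial B →+* C := Polynomial.eval₂RingHom (Subring.inclusion hB) ⟨z, hz⟩
  have hf : ∀ p, ((f p : C) : S) = Polynomial.eval₂ B.subtype z p := by
    intro p
    have := Polynomial.hom_eval₂ p (Subring.inclusion hB) C.subtype ⟨z, hz⟩
    exact this
  have hsurj : Function.Surjective f := by
    rintro ⟨x, hx⟩
    obtain ⟨p, hp⟩ := hBC x hx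
    exact ⟨p, Subtype.ext (by rw [hf, hp])⟩
  let q : Polynomial B := Polynomial.C ⟨d, hd⟩ * Polynomial.X - Polynomial.C ⟨d * z, hdz⟩
  have hq : f q = 0 := by
    apply Subtype.ext
    rw [hf]
    simp [q, Polynomial.eval₂_mul]
  have hq0 : q ≠ 0 := by
    intro h
    have := congrArg (fun p => Polynomial.coeff p 1) h
    simp [q, Polynomial.coeff_C] at this
    exact hd0 this
  have h1 := ringKrullDim_quotient_succ_le_of_nonZeroDivisor (mem_nonZeroDivisors_of_ne_zero hq0)
  rw [Polynomial.ringKrullDim_of_isNoetherianRing] at h1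
  have h2 : ringKrullDim (Polynomial B ⧸ Ideal.span {q}) ≤ ringKrullDim B := by
    generalize ringKrullDim (Polynomial B ⧸ Ideal.span {q}) = u at h1
    generalize ringKrullDim B = v at h1
    induction u using WithBot.recBotCoe with
    | bot => exact bot_le
    | coe u =>
      induction v using WithBot.recBotCoe with
      | bot => exact absurd h1 (by rw [WithBot.bot_add, le_bot_iff]; exact WithBot.coe_ne_bot)
      | coe v =>
        have h3 : u + 1 ≤ v + 1 := WithBot.coe_le_coe.mp h1
        exact WithBot.coe_le_coe.mpr (by simpa using h3)
  refine le_trans ?_ h2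
  let g : (Polynomial B ⧸ Ideal.span {q}) →+* C := Ideal.Quotient.lift _ f (by
    intro a ha
    obtain ⟨c, rfl⟩ := Ideal.mem_span_singleton.mp ha
    rw [map_mul, hq, zero_mul])
  refine ringKrullDim_le_of_surjective g ?_
  exact Ideal.Quotient.lift_surjective_of_surjective _ _ hsurj

lemma sub1_fg [IsNoetherianRing A] {r : ℕ} (M : Submodule A (Fin r → A)) : (sub1 A r M).FG :=
  (IsNoetherian.noetherian M).map _

instance rees_noeth [IsNoetherianRing A] {r : ℕ} (M : Submodule A (Fin r → A)) :
    IsNoetherianRing (reesAlg A r M) := by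
  obtain ⟨s, hs⟩ := sub1_fg M
  have h : reesAlg A r M = Algebra.adjoin A (s : Set (MvPolynomial (Fin r) A)) := by
    rw [reesAlg, ← hs, Algebra.adjoin_span]
  have : (reesAlg A r M).FG := ⟨s, h.symm⟩
  haveI : Algebra.FiniteType A (reesAlg A r M) := (reesAlg A r M).fg_iff_finiteType.mp this
  exact Algebra.FiniteType.isNoetherianRing A _

lemma rees_dim_le [IsLocalRing A] [IsNoetherianRing A] [IsDomain A] (hdim : ringKrullDim A = 2) {r : ℕ}
    {M : Submodule A (Fin r → A)} {a : A} (ha : a ≠ 0) (haM : ∀ f, a • f ∈ M) :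
    ringKrullDim (reesAlg A r M) ≤ ((r + 2 : ℕ) : WithBot ℕ∞) := by
  classical
  let t : Set (MvPolynomial (Fin r) A) := Set.range fun i => a • X i
  have key : ∀ s : Finset (MvPolynomial (Fin r) A), (∀ z ∈ s, a • z ∈ Algebra.adjoin A t) →
      IsNoetherianRing (Algebra.adjoin A (t ∪ s)) ∧
      ringKrullDim (Algebra.adjoin A (t ∪ s)) ≤ ((r + 2 : ℕ) : WithBot ℕ∞) := by
    intro s
    induction s using Finset.induction_on with
    | empty =>
      intro _
      have h : Algebra.adjoin A (t ∪ (∅ : Finset (MvPolynomial (Fin r) A))) =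
          (aeval (R := A) (fun i => a • (X i : MvPolynomial (Fin r) A))).range := by
        simp [t, Algebra.adjoin_range_eq_range_aeval]
      rw [h]
      refine ⟨inferInstance, ?_⟩
      refine (ringKrullDim_le_of_surjective (aeval (R := A) (fun i => a • (X i : MvPolynomial (Fin r) A))).rangeRestrict.toRingHom
        (AlgHom.rangeRestrict_surjective _)).trans ?_
      rw [MvPolynomial.ringKrullDim_of_isNoetherianRing, hdim]
      simp
      rw [add_comm]
    | insert z s hz ih =>
      intro hs
      obtain ⟨ih1, ih2⟩ := ih fun z hz => hs z (Finset.mem_insert_of_mem hz)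
      set B := Algebra.adjoin A (t ∪ s)
      have hE : Algebra.adjoin A (t ∪ ↑(insert z s)) =
          Subalgebra.restrictScalars A (Algebra.adjoin B {z}) := by
        have : t ∪ ↑(insert z s) = insert z (t ∪ ↑s) := by
          simp
        rw [this, Set.insert_eq, Set.union_comm]
        exact Algebra.adjoin_union_eq_adjoin_adjoin _ _ _
      rw [hE]
      have hB : B ≤ Subalgebra.restrictScalars A (Algebra.adjoin B {z}) := by
        rw [← hE]; exact Algebra.adjoin_mono (by simp)
      haveI : IsNoetherianRing B.toSubring := ih1
      constructor
      · haveI : Algebra.FiniteType B (Algebra.adjoin B {z}) :=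
          (Subalgebra.fg_iff_finiteType _).mp ⟨{z}, by simp⟩
        exact Algebra.FiniteType.isNoetherianRing B (Algebra.adjoin B {z})
      · refine le_trans ?_ ih2
        refine dim_adjoin_one B.toSubring (Algebra.adjoin B {z}).toSubring z ?_ hB ?_ (C a) (B.algebraMap_mem a) (by simpa using ha) ?_
        · intro x hx
          have hx : x ∈ Algebra.adjoin B {z} := hx
          rw [Algebra.adjoin_singleton_eq_range_aeval] at hx
          obtain ⟨p, hp⟩ := hx
          exact ⟨p, hp⟩
        · exact Algebra.subset_adjoin (by simp)
        · have := hs z (by simp)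
          rw [smul_eq_C_mul] at this
          exact (Algebra.adjoin_mono (Set.subset_union_left) : Algebra.adjoin A t ≤ B) this
  obtain ⟨s, hs⟩ := sub1_fg M
  have h0 : ∀ i, a • (X i : MvPolynomial (Fin r) A) ∈ sub1 A r M := fun i =>
    ⟨a • Pi.single i 1, haM _, by simp [emb, Fintype.linearCombination_apply_single]⟩
  have h : reesAlg A r M = Algebra.adjoin A (t ∪ (s : Set (MvPolynomial (Fin r) A))) := by
    apply le_antisymm
    · rw [reesAlg, ← hs, Algebra.adjoin_span]
      exact Algebra.adjoin_mono Set.subset_union_right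
    · refine Algebra.adjoin_mono (Set.union_subset ?_ ?_)
      · rintro _ ⟨i, rfl⟩
        exact h0 i
      · rw [← hs]; exact Submodule.subset_span
  rw [h]
  refine (key s ?_).2
  intro z hz
  have : z ∈ sub1 A r M := hs ▸ Submodule.subset_span hz
  obtain ⟨v, -, rfl⟩ := this
  rw [Fintype.linearCombination_apply, Finset.smul_sum]
  refine sum_mem fun i _ => ?_
  rw [smul_comm]
  exact Subalgebra.smul_mem _ (Algebra.subset_adjoin (Set.mem_range_self i)) _
end
end

section
set_option linter.all false
set_option autoImplicit false
open MvPolynomial IsLocalRing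

section
variable {A : Type} [CommRing A]

lemma exists_avoid [IsLocalRing A] [Infinite (ResidueField A)] {E ι : Type*} [AddCommGroup E] [Module A E]
    (s : Finset ι) (p : ι → Submodule A E) (h : ∀ i ∈ s, p i ≠ ⊤) : ∃ e, ∀ i ∈ s, e ∉ p i := by
  by_contra hc
  push Not at hc
  have hcov : ⋃ i ∈ s, (p i : Set E) = Set.univ := by
    ext e; simpa using hc e
  obtain ⟨k, hk, hfi⟩ := Submodule.exists_finiteIndex_of_cover hcov
  haveI : Finite (E ⧸ p k) := AddSubgroup.finite_quotient_of_finiteIndex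
  obtain ⟨e, he⟩ : ∃ e, e ∉ p k := by
    by_contra h2; push Not at h2
    exact h k hk (eq_top_iff.mpr fun x _ => h2 x)
  let f : A →ₗ[A] (E ⧸ p k) := LinearMap.toSpanSingleton A _ ((p k).mkQ e)
  have hf : ∀ a, f a = a • (p k).mkQ e := fun a => rfl
  have : ∀ b : ResidueField A, ∃ a, residue A a = b := residue_surjective
  choose g hg using this
  have hinj : Function.Injective (fun b => f (g b)) := by
    intro b c hbc
    rw [← hg b, ← hg c, ← sub_eq_zero, ← map_sub, residue_eq_zero_iff]
    by_contra hu
    have hu : IsUnit (g b - g c) := by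
      by_contra h; exact hu h
    obtain ⟨u, hu⟩ := hu
    have h3 : (g b - g c) • (p k).mkQ e = 0 := by
      rw [sub_smul, sub_eq_zero]; exact hbc
    rw [← hu] at h3
    have h4 : (p k).mkQ e = 0 := by
      have := congrArg (fun z => (↑u⁻¹ : A) • z) h3
      simpa [smul_smul] using this
    exact he ((Submodule.Quotient.mk_eq_zero _).mp h4)
  exact (Finite.of_injective _ hinj).not_infinite inferInstance

/-- the grading homomorphism -/
noncomputable def thS (A : Type) [CommRing A] (r : ℕ) :
    MvPolynomial (Fin r) A →ₐ[A] Polynomial (MvPolynomial (Fin r) A) :=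
  aeval fun i => Polynomial.C (X i) * Polynomial.X

lemma thS_monomial {r : ℕ} (α : Fin r →₀ ℕ) (a : A) :
    thS A r (monomial α a) = Polynomial.monomial α.degree (monomial α a) := by
  rw [thS, aeval_monomial]
  simp only [mul_pow, Finsupp.prod_mul]
  rw [MvPolynomial.monomial_eq, ← Polynomial.C_mul_X_pow_eq_monomial, Finsupp.degree, map_mul]
  rw [mul_assoc]
  have h0 : algebraMap A (Polynomial (MvPolynomial (Fin r) A)) a = Polynomial.C (C a) := rfl
  rw [h0]
  refine congrArg (fun z => Polynomial.C (C a) * z) ?_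
  rw [Finsupp.prod, Finsupp.prod, Finsupp.prod, Finset.prod_pow_eq_pow_sum, map_prod]
  simp only [map_pow]
  rfl

lemma thS_coeff {r : ℕ} (x : MvPolynomial (Fin r) A) (n : ℕ) :
    (thS A r x).coeff n = homogeneousComponent n x := by
  induction x using MvPolynomial.induction_on' with
  | monomial α a =>
    rw [thS_monomial, Polynomial.coeff_monomial]
    split_ifs with h
    · subst h
      rw [homogeneousComponent_of_mem (isHomogeneous_monomial (n := α.degree) a rfl), if_pos rfl]
    · rw [homogeneousComponent_of_mem (isHomogeneous_monomial (n := α.degree) a rfl), if_neg (Ne.symm h)]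
  | add p q hp hq => simp [hp, hq]

lemma hc_mul {r : ℕ} (x y : MvPolynomial (Fin r) A) (n : ℕ) : homogeneousComponent n (x * y) =
    ∑ p ∈ Finset.HasAntidiagonal.antidiagonal n, homogeneousComponent p.1 x * homogeneousComponent p.2 y := by
  simp only [← thS_coeff, map_mul, Polynomial.coeff_mul]

variable {r : ℕ} {M : Submodule A (Fin r → A)}

lemma freeSub_eq : freeSub A r = homogeneousSubmodule (Fin r) A 1 := by
  apply le_antisymm
  · rintro _ ⟨v, -, rfl⟩
    rw [emb_eq_linT, linT]
    exact sum_mem fun i _ => by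
      rw [← smul_eq_C_mul]; exact Submodule.smul_mem _ _ (isHomogeneous_X A i)
  · intro p hp
    rw [homogeneousSubmodule_one_eq_span_X] at hp
    refine Submodule.span_le.mpr ?_ hp
    rintro _ ⟨i, rfl⟩
    exact ⟨Pi.single i 1, trivial, by simp [emb, Fintype.linearCombination_apply_single]⟩

lemma freeSub_pow_eq (n : ℕ) : freeSub A r ^ n = homogeneousSubmodule (Fin r) A n := by
  rw [freeSub_eq]
  exact homogeneousSubmodule_one_pow _ n

lemma sub1_le_free : sub1 A r M ≤ freeSub A r := Submodule.map_mono le_top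

lemma pow_hom {n : ℕ} {x} (hx : x ∈ sub1 A r M ^ n) : x.IsHomogeneous n := by
  have := pow_le_pow_left' (sub1_le_free (M := M)) n hx
  rwa [freeSub_pow_eq] at this

lemma pow_le_rees (n : ℕ) : sub1 A r M ^ n ≤ Subalgebra.toSubmodule (reesAlg A r M) := by
  intro x hx
  induction n generalizing x with
  | zero =>
    rw [pow_zero] at hx
    obtain ⟨a, rfl⟩ := Submodule.mem_one.mp hx
    exact Subalgebra.algebraMap_mem _ _
  | succ n ih =>
    rw [pow_succ] at hx
    refine Submodule.mul_induction_on hx (fun p hp q hq => ?_) (fun p q hp hq => add_mem hp hq)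
    exact mul_mem (S := Subalgebra A _) (s := reesAlg A r M) (ih hp) (Algebra.subset_adjoin hq)

lemma hc_mem {x : MvPolynomial (Fin r) A} (hx : x ∈ reesAlg A r M) (n : ℕ) :
    homogeneousComponent n x ∈ sub1 A r M ^ n := by
  induction hx using Algebra.adjoin_induction generalizing n with
  | mem x hx =>
    have h : x.IsHomogeneous 1 := pow_hom (M := M) (n := 1) (by simpa using hx)
    rw [homogeneousComponent_of_mem h]
    split_ifs with h1
    · subst h1; simpa using hx
    · exact zero_mem _
  | algebraMap a =>
    have h : (algebraMap A (MvPolynomial (Fin r) A) a).IsHomogeneous 0 := isHomogeneous_C _ _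
    rw [homogeneousComponent_of_mem h]
    split_ifs with h1
    · subst h1; rw [pow_zero]; exact Submodule.algebraMap_mem a
    · exact zero_mem _
  | add x y _ _ hx hy => rw [map_add]; exact add_mem (hx n) (hy n)
  | mul x y _ _ hx hy =>
    rw [hc_mul]
    refine sum_mem fun p hp => ?_
    rw [← Finset.HasAntidiagonal.mem_antidiagonal.mp hp, pow_add]
    exact Submodule.mul_mem_mul (hx _) (hy _)

lemma hc_rees {x : MvPolynomial (Fin r) A} (hx : x ∈ reesAlg A r M) (n : ℕ) :
    homogeneousComponent n x ∈ reesAlg A r M := pow_le_rees n (hc_mem hx n)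

lemma mem_rees_iff {x : MvPolynomial (Fin r) A} :
    x ∈ reesAlg A r M ↔ ∀ n, homogeneousComponent n x ∈ sub1 A r M ^ n := by
  refine ⟨hc_mem, fun h => ?_⟩
  rw [← sum_homogeneousComponent x]
  exact sum_mem fun n _ => pow_le_rees n (h n)

lemma rees_hom_mem {x : MvPolynomial (Fin r) A} {n : ℕ} (hx : x ∈ reesAlg A r M) (h : x.IsHomogeneous n) :
    x ∈ sub1 A r M ^ n := by
  have := hc_mem hx n
  rwa [homogeneousComponent_of_mem h, if_pos rfl] at this

/-- The largest graded ideal inside an ideal. -/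
def hCore (P : Ideal (reesAlg A r M)) : Ideal (reesAlg A r M) where
  carrier := {x | ∀ n, (⟨homogeneousComponent n x.1, hc_rees x.2 n⟩ : reesAlg A r M) ∈ P}
  zero_mem' := fun n => by
    have : (⟨homogeneousComponent n (0 : reesAlg A r M).1, hc_rees (0 : reesAlg A r M).2 n⟩ : reesAlg A r M) = 0 := by
      apply Subtype.ext; simp
    rw [this]; exact zero_mem _
  add_mem' := by
    intro x y hx hy n
    have : (⟨homogeneousComponent n (x + y).1, hc_rees (x + y).2 n⟩ : reesAlg A r M) =
      ⟨homogeneousComponent n x.1, hc_rees x.2 n⟩ + ⟨homogeneousComponent n y.1, hc_rees y.2 n⟩ := by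
      apply Subtype.ext; simp
    rw [this]; exact add_mem (hx n) (hy n)
  smul_mem' := by
    intro c x hx n
    have : (⟨homogeneousComponent n (c * x).1, hc_rees (c * x).2 n⟩ : reesAlg A r M) =
      ∑ p ∈ Finset.HasAntidiagonal.antidiagonal n, (⟨homogeneousComponent p.1 c.1, hc_rees c.2 p.1⟩ : reesAlg A r M) *
        ⟨homogeneousComponent p.2 x.1, hc_rees x.2 p.2⟩ := by
      apply Subtype.ext
      simp [hc_mul]
    change (⟨homogeneousComponent n (c * x).1, hc_rees (c * x).2 n⟩ : reesAlg A r M) ∈ P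
    rw [this]
    exact sum_mem fun p _ => Ideal.mul_mem_left _ _ (hx _)

lemma mem_hCore {P : Ideal (reesAlg A r M)} {x} : x ∈ hCore P ↔
  ∀ n, (⟨homogeneousComponent n x.1, hc_rees x.2 n⟩ : reesAlg A r M) ∈ P := Iff.rfl

lemma hCore_le (P : Ideal (reesAlg A r M)) : hCore P ≤ P := by
  intro x hx
  have : x = ∑ n ∈ Finset.range (x.1.totalDegree + 1), (⟨homogeneousComponent n x.1, hc_rees x.2 n⟩ : reesAlg A r M) := by
    apply Subtype.ext
    simp [sum_homogeneousComponent]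
  rw [this]
  exact sum_mem fun n _ => hx n

lemma hCore_graded (P : Ideal (reesAlg A r M)) : IsGradedIdeal A r (reesAlg A r M) (hCore P) := by
  intro x hx n h k
  have h2 := hx n
  simp only
  by_cases hk : k = n
  · subst hk
    convert h2 using 2
    rw [homogeneousComponent_of_mem (homogeneousComponent_isHomogeneous k x.1), if_pos rfl]
  · convert zero_mem P
    rw [homogeneousComponent_of_mem (homogeneousComponent_isHomogeneous n x.1), if_neg hk]
    rfl

lemma hom_mem_hCore {P : Ideal (reesAlg A r M)} {x : reesAlg A r M} {n : ℕ} (h : x.1.IsHomogeneous n) (hx : x ∈ P) :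
    x ∈ hCore P := by
  intro k
  by_cases hk : k = n
  · subst hk
    convert hx using 1
    apply Subtype.ext
    simp only
    rw [homogeneousComponent_of_mem h, if_pos rfl]
  · convert zero_mem P
    rw [homogeneousComponent_of_mem h, if_neg hk]
    rfl

lemma th_lift (x : reesAlg A r M) : ∃ p : Polynomial (reesAlg A r M),
    (∀ n, p.coeff n = ⟨homogeneousComponent n x.1, hc_rees x.2 n⟩) := by
  refine ⟨∑ k ∈ Finset.range (x.1.totalDegree + 1), Polynomial.monomial k
    ⟨homogeneousComponent k x.1, hc_rees x.2 k⟩, fun n => ?_⟩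
  rw [Polynomial.finset_sum_coeff]
  simp only [Polynomial.coeff_monomial]
  rw [Finset.sum_ite_eq']
  split_ifs with h
  · rfl
  · apply Subtype.ext
    simp only [Finset.mem_range, not_lt] at h
    symm
    exact homogeneousComponent_eq_zero _ _ (by omega)

instance hCore_prime (P : Ideal (reesAlg A r M)) [hP : P.IsPrime] : (hCore P).IsPrime := by
  refine ⟨fun h => hP.ne_top (top_le_iff.mp (h ▸ hCore_le P)), ?_⟩
  intro x y hxy
  obtain ⟨p, hp⟩ := th_lift x
  obtain ⟨q, hq⟩ := th_lift y
  have hQ : (Ideal.map Polynomial.C P).IsPrime := Ideal.isPrime_map_C_of_isPrime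
  have h : p * q ∈ Ideal.map Polynomial.C P := by
    rw [Ideal.mem_map_C_iff]
    intro n
    have := hxy n
    convert this
    simp [Polynomial.coeff_mul, hp, hq, hc_mul]
  rcases hQ.mem_or_mem h with h | h
  · left; intro n; rw [← hp]; exact Ideal.mem_map_C_iff.mp h n
  · right; intro n; rw [← hq]; exact Ideal.mem_map_C_iff.mp h n

lemma min_hCore {I P : Ideal (reesAlg A r M)} (hP : P ∈ I.minimalPrimes) (hI : I ≤ hCore P) : hCore P = P := by
  haveI := hP.1.1
  exact le_antisymm (hCore_le P) (hP.2 ⟨hCore_prime P, hI⟩ (hCore_le P))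
end
end

section
set_option linter.all false
set_option autoImplicit false
open MvPolynomial IsLocalRing

section
variable {A : Type} [CommRing A] {r : ℕ} {M : Submodule A (Fin r → A)}

lemma thS_hom {d : ℕ} {y : MvPolynomial (Fin r) A} (hy : y.IsHomogeneous d) :
    thS A r y = Polynomial.monomial d y := by
  ext1 n
  rw [thS_coeff, Polynomial.coeff_monomial, homogeneousComponent_of_mem hy]
  simp [eq_comm]

lemma hc_mul_hom {d : ℕ} {x y : MvPolynomial (Fin r) A} (hy : y.IsHomogeneous d) (k : ℕ) :
    homogeneousComponent (k + d) (x * y) = homogeneousComponent k x * y := by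
  rw [← thS_coeff, map_mul, thS_hom hy, Polynomial.coeff_mul_monomial, thS_coeff]

lemma hc_C_mul (a : A) (x : MvPolynomial (Fin r) A) (k : ℕ) :
    homogeneousComponent k (C a * x) = a • homogeneousComponent k x := by
  rw [← smul_eq_C_mul, map_smul]

lemma hc_mul_C (a : A) (x : MvPolynomial (Fin r) A) (k : ℕ) :
    homogeneousComponent k (x * C a) = a • homogeneousComponent k x := by
  rw [mul_comm, hc_C_mul]

lemma linT_mem_sub1 {v : Fin r → A} (hv : v ∈ M) : linT v ∈ sub1 A r M := ⟨v, hv, emb_eq_linT v⟩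

lemma linT_hom (v : Fin r → A) : (linT v).IsHomogeneous 1 := by
  have : linT v ∈ freeSub A r := ⟨v, trivial, emb_eq_linT v⟩
  rwa [freeSub_eq] at this

lemma linT_mem_rees {v : Fin r → A} (hv : v ∈ M) : linT v ∈ reesAlg A r M :=
  Algebra.subset_adjoin (linT_mem_sub1 hv)

/-- element of `R(M)` attached to an element of `M` -/
noncomputable def rel1 (v : M) : reesAlg A r M := ⟨linT v.1, linT_mem_rees v.2⟩

noncomputable def rel1L : M →ₗ[A] reesAlg A r M where
  toFun := rel1
  map_add' x y := Subtype.ext (by simp [rel1, linT_add])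
  map_smul' a x := Subtype.ext (by
    simp only [rel1, Submodule.coe_smul, RingHom.id_apply]
    rw [linT_smul, ← smul_eq_C_mul]; rfl)

/-- the ideal `m R + (n_1, …, n_j) R` -/
noncomputable def redI [IsLocalRing A] {j : ℕ} (n : Fin j → M) : Ideal (reesAlg A r M) :=
  Ideal.span ((algebraMap A (reesAlg A r M)) '' (maximalIdeal A) ∪ Set.range (fun i => rel1 (n i)))

lemma redI_hCore [IsLocalRing A] {j : ℕ} (n : Fin j → M) {P : Ideal (reesAlg A r M)} (h : redI n ≤ P) :
    redI n ≤ hCore P := by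
  rw [redI, Ideal.span_le]
  rintro x hx
  have hxP : x ∈ P := h (Ideal.subset_span hx)
  rcases hx with ⟨a, ha, rfl⟩ | ⟨i, rfl⟩
  · exact hom_mem_hCore (n := 0) (isHomogeneous_C _ a) hxP
  · exact hom_mem_hCore (n := 1) (linT_hom _) hxP

lemma lt_gradedMax [IsLocalRing A] {P : Ideal (reesAlg A r M)} [hP : P.IsPrime] (h : hCore P = P)
    (hM : ∃ v : M, rel1 v ∉ P) : P < gradedMax A r M := by
  refine lt_of_le_of_ne ?_ ?_
  · intro x hx
    rw [← h] at hx
    have h0 := hx 0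
    rw [Ideal.mem_comap]
    by_contra hu
    have hu : IsUnit (constantCoeff x.1) := by
      by_contra h; exact hu h
    obtain ⟨u, hu⟩ := hu
    apply hP.ne_top
    rw [Ideal.eq_top_iff_one]
    have : (1 : reesAlg A r M) = algebraMap A _ (↑u⁻¹ : A) * ⟨homogeneousComponent 0 x.1, hc_rees x.2 0⟩ := by
      apply Subtype.ext
      simp only [homogeneousComponent_zero, MulMemClass.coe_mul, OneMemClass.coe_one]
      have h2 : coeff 0 x.1 = u := hu.symm
      rw [h2]
      change 1 = C (↑u⁻¹ : A) * C (↑u : A)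
      rw [← C_mul]; simp
    rw [this]
    exact Ideal.mul_mem_left _ _ h0
  · rintro rfl
    obtain ⟨v, hv⟩ := hM
    apply hv
    rw [Ideal.mem_comap]
    have : constantCoeff (linT v.1) = 0 := by simp [linT]
    change constantCoeff (linT v.1) ∈ _
    rw [this]; exact zero_mem _

lemma red_step [IsLocalRing A] [IsNoetherianRing A] [IsDomain A] [Infinite (ResidueField A)]
    (hm : maximalIdeal A ≠ ⊥) (j : ℕ) : ∃ n : Fin j → M, ∀ P ∈ (redI n).minimalPrimes,
      (∃ v : M, rel1 v ∉ P) → ((j + 1 : ℕ) : ℕ∞) ≤ P.height := by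
  classical
  induction j with
  | zero =>
    refine ⟨Fin.elim0, fun P hP _ => ?_⟩
    haveI := hP.1.1
    obtain ⟨a, ha, ha0⟩ := Submodule.exists_mem_ne_zero_of_ne_bot hm
    have haP : algebraMap A (reesAlg A r M) a ∈ P := hP.1.2 (Ideal.subset_span (Or.inl ⟨a, ha, rfl⟩))
    have h0 : algebraMap A (reesAlg A r M) a ≠ 0 := by
      intro h
      have := congrArg Subtype.val h
      exact ha0 (by simpa using this)
    have h1 : P.height ≠ 0 := by
      rw [Ne, Ideal.height_eq_zero_iff_eq_bot]
      rintro rfl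
      exact h0 (by simpa using haP)
    simpa [Order.one_le_iff_pos, pos_iff_ne_zero] using h1
  | succ j ih =>
    obtain ⟨n, hn⟩ := ih
    have hfin := (redI n).finite_minimalPrimes_of_isNoetherianRing
    set s := hfin.toFinset.filter (fun P => ∃ v : M, rel1 v ∉ P)
    obtain ⟨v, hv⟩ := exists_avoid s (fun P => (P.restrictScalars A).comap rel1L) (by
      intro P hP
      obtain ⟨-, w, hw⟩ := Finset.mem_filter.mp hP
      intro h
      exact hw (show w ∈ (P.restrictScalars A).comap rel1L from h ▸ trivial))
    refine ⟨Fin.snoc n v, fun P hP hPM => ?_⟩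
    haveI := hP.1.1
    have hle : redI n ≤ P := by
      refine le_trans (Ideal.span_mono ?_) hP.1.2
      refine Set.union_subset_union_right _ ?_
      rintro _ ⟨i, rfl⟩
      exact ⟨i.castSucc, by simp⟩
    obtain ⟨Q, hQ, hQP⟩ := Ideal.exists_minimalPrimes_le hle
    haveI := hQ.1.1
    obtain ⟨w, hw⟩ := hPM
    have hQM : ∃ v : M, rel1 v ∉ Q := ⟨w, fun h => hw (hQP h)⟩
    have h1 := hn Q hQ hQM
    have h2 : rel1 v ∉ Q := hv Q (Finset.mem_filter.mpr ⟨hfin.mem_toFinset.mpr hQ, hQM⟩)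
    have h3 : rel1 v ∈ P := hP.1.2 (Ideal.subset_span (Or.inr ⟨Fin.last j, by simp⟩))
    have h4 : Q < P := lt_of_le_of_ne hQP (by rintro rfl; exact h2 h3)
    have h5 := Ideal.height_add_one_le_of_lt_of_isPrime h4
    calc ((j + 1 + 1 : ℕ) : ℕ∞) = ((j + 1 : ℕ) : ℕ∞) + 1 := by push_cast; rfl
      _ ≤ Q.height + 1 := by gcongr
      _ ≤ _ := h5

lemma red_mem [IsLocalRing A] {j : ℕ} (n : Fin j → M) {y : reesAlg A r M} (hy : y ∈ redI n) (k : ℕ) :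
    homogeneousComponent (k + 1) y.1 ∈ Submodule.span A (Set.range fun i => linT (n i).1) * sub1 A r M ^ k
      ⊔ maximalIdeal A • sub1 A r M ^ (k + 1) := by
  suffices h : ∀ c : reesAlg A r M, homogeneousComponent (k + 1) (c.1 * y.1) ∈
      Submodule.span A (Set.range fun i => linT (n i).1) * sub1 A r M ^ k
      ⊔ maximalIdeal A • sub1 A r M ^ (k + 1) by
    simpa using h 1
  rw [redI] at hy
  induction hy using Submodule.span_induction with
  | mem x hx =>
    intro c
    rcases hx with ⟨a, ha, rfl⟩ | ⟨i, rfl⟩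
    · refine Submodule.mem_sup_right ?_
      change homogeneousComponent (k + 1) (c.1 * C a) ∈ _
      rw [hc_mul_C]
      exact Submodule.smul_mem_smul ha (hc_mem c.2 _)
    · refine Submodule.mem_sup_left ?_
      change homogeneousComponent (k + 1) (c.1 * linT (n i).1) ∈ _
      rw [hc_mul_hom (linT_hom _), mul_comm (homogeneousComponent _ _)]
      exact Submodule.mul_mem_mul (Submodule.subset_span (Set.mem_range_self i)) (hc_mem c.2 _)
  | zero => intro c; simp
  | add x y _ _ hx hy =>
    intro c
    have := add_mem (hx c) (hy c)
    rw [← map_add, ← mul_add] at this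
    exact this
  | smul d x _ hx =>
    intro c
    have := hx (c * d)
    rw [MulMemClass.coe_mul, mul_assoc] at this
    exact this

theorem red_exists [IsLocalRing A] [IsNoetherianRing A] [IsDomain A] [Infinite (ResidueField A)]
    (hdim : ringKrullDim A = 2) {a : A} (ha : a ≠ 0) (haM : ∀ f, a • f ∈ M) :
    ∃ n : Fin (r + 1) → M, ∃ k, sub1 A r M ^ (k + 1) ≤
      Submodule.span A (Set.range fun i => linT (n i).1) * sub1 A r M ^ k := by
  have hm : maximalIdeal A ≠ ⊥ := by
    intro h
    haveI := IsLocalRing.isField_iff_maximalIdeal_eq.mpr h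
    rw [ringKrullDim_eq_zero_of_isField this] at hdim
    exact absurd hdim (by decide)
  obtain ⟨n, hn⟩ := red_step (M := M) hm (r + 1)
  refine ⟨n, ?_⟩
  have hrad : Ideal.span (Set.range (rel1 (M := M))) ≤ (redI n).radical := by
    rw [Ideal.span_le]
    rintro _ ⟨v, rfl⟩
    rw [Ideal.radical_eq_sInf]
    simp only [SetLike.mem_coe, Submodule.mem_sInf]
    rintro P ⟨hP, hPp⟩
    obtain ⟨Q, hQ, hQP⟩ := Ideal.exists_minimalPrimes_le hP
    apply hQP
    by_contra hv
    have h1 := hn Q hQ ⟨v, hv⟩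
    haveI := hQ.1.1
    have h2 := lt_gradedMax (min_hCore hQ (redI_hCore n hQ.1.2)) ⟨v, hv⟩
    have h3 := Ideal.height_add_one_le_of_lt_of_isPrime h2
    have h4 := (Ideal.height_le_ringKrullDim_of_isPrime (I := gradedMax A r M)).trans (rees_dim_le hdim ha haM)
    have h5 : (gradedMax A r M).height ≤ ((r + 2 : ℕ) : ℕ∞) := WithBot.coe_le_coe.mp h4
    have h6 : ((r + 1 + 1 : ℕ) : ℕ∞) + 1 ≤ ((r + 2 : ℕ) : ℕ∞) := le_trans (by gcongr) (h3.trans h5)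
    have h7 : r + 1 + 1 + 1 ≤ r + 2 := by exact_mod_cast h6
    omega
  obtain ⟨k, hk⟩ := Ideal.exists_pow_le_of_le_radical_of_fg hrad (IsNoetherian.noetherian _)
  refine ⟨k, ?_⟩
  refine Submodule.le_of_le_smul_of_le_jacobson_bot ((sub1_fg M).pow _)
    (IsLocalRing.jacobson_eq_maximalIdeal _ bot_ne_top).ge ?_
  have h8 : ∀ j, ∀ x ∈ sub1 A r M ^ j, ∃ y ∈ (Ideal.span (Set.range (rel1 (M := M)))) ^ j, y.1 = x := by
    intro j
    induction j with
    | zero =>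
      intro x hx
      rw [pow_zero] at hx
      obtain ⟨c, rfl⟩ := Submodule.mem_one.mp hx
      exact ⟨algebraMap _ _ c, by simp, rfl⟩
    | succ j ih =>
      intro x hx
      rw [pow_succ] at hx
      refine Submodule.mul_induction_on hx ?_ ?_
      · rintro p hp q ⟨v, hv, rfl⟩
        obtain ⟨y, hy, rfl⟩ := ih p hp
        refine ⟨y * rel1 ⟨v, hv⟩, ?_, ?_⟩
        · rw [pow_succ]; exact Ideal.mul_mem_mul hy (Ideal.subset_span ⟨_, rfl⟩)
        · rw [emb_eq_linT]; rfl
      · rintro p q ⟨y, hy, rfl⟩ ⟨z, hz, rfl⟩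
        exact ⟨y + z, add_mem hy hz, rfl⟩
  intro x hx
  obtain ⟨y, hy, rfl⟩ := h8 _ x hx
  have := red_mem n (hk (Ideal.pow_le_pow_right (Nat.le_succ k) hy)) k
  rwa [homogeneousComponent_of_mem (pow_hom hx), if_pos rfl] at this
end
end

section
set_option linter.all false
set_option autoImplicit false
open MvPolynomial IsLocalRing

section
variable {A : Type} [CommRing A] {r : ℕ} {M : Submodule A (Fin r → A)}

lemma int_of_stable {L : Type*} [CommRing L] [IsDomain L] [Algebra A L] (B : Subalgebra A L)
    (E : Submodule A L) (hE : E.FG) (hE0 : ∃ e ∈ E, e ≠ 0) (x : L)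
    (hx : ∀ e ∈ E, x * e ∈ Submodule.span B (E : Set L)) : IsIntegral B x := by
  refine isIntegral_of_smul_mem_submodule (Submodule.span B (E : Set L)) ?_ ?_ x ?_
  · obtain ⟨e, he, he0⟩ := hE0
    intro h
    have : e ∈ Submodule.span B (E : Set L) := Submodule.subset_span he
    rw [h] at this
    exact he0 (by simpa using this)
  · obtain ⟨s, rfl⟩ := hE
    refine ⟨s, ?_⟩
    refine le_antisymm (Submodule.span_mono Submodule.subset_span) ?_
    rw [Submodule.span_le]
    exact Submodule.span_le_restrictScalars A B (s : Set L)
  · intro n hn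
    induction hn using Submodule.span_induction with
    | mem e he => exact hx e he
    | zero => simp
    | add p q _ _ hp hq => rw [smul_add]; exact add_mem hp hq
    | smul c p _ hp => rw [smul_comm]; exact Submodule.smul_mem _ _ hp

lemma pow_ne_bot [IsDomain A] (hM : M ≠ ⊥) (k : ℕ) : ∃ e ∈ sub1 A r M ^ k, e ≠ 0 := by
  obtain ⟨v, hv, hv0⟩ := Submodule.exists_mem_ne_zero_of_ne_bot hM
  refine ⟨linT v ^ k, Submodule.pow_mem_pow _ (linT_mem_sub1 hv) k, pow_ne_zero _ ?_⟩
  intro h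
  apply hv0
  ext j
  have := congrArg (coeff (Finsupp.single j 1)) h
  simpa [coeff_linT] using this

lemma evT_X {R : Type*} [CommRing R] (n : Fin (r + 1) → Fin r → R) (j) : evT n (X j) = linT (n j) := by
  simp [evT]

lemma evT_range_le (n : Fin (r + 1) → Fin r → A) (hn : ∀ j, n j ∈ M) : (evT n).range ≤ reesAlg A r M := by
  rintro _ ⟨p, rfl⟩
  change evT n p ∈ _
  induction p using MvPolynomial.induction_on with
  | C a => rw [algHom_C]; exact Subalgebra.algebraMap_mem _ _
  | add p q hp hq => rw [map_add]; exact add_mem hp hq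
  | mul_X p j hp => rw [map_mul, evT_X]; exact mul_mem hp (linT_mem_rees (hn j))

lemma int_rees_iff [IsDomain A] [IsNoetherianRing A] (hM : M ≠ ⊥) (n : Fin (r + 1) → Fin r → A) (hn : ∀ j, n j ∈ M)
    {k : ℕ} (hk : sub1 A r M ^ (k + 1) ≤ Submodule.span A (Set.range fun i => linT (n i)) * sub1 A r M ^ k)
    (g : MvPolynomial (Fin r) A) :
    (evT n).range.val.toRingHom.IsIntegralElem g ↔ IsIntegral (reesAlg A r M) g := by
  constructor
  · intro h
    have := integral_transfer _ (RingHom.id _) (algebraMap (reesAlg A r M) _) (by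
      rintro ⟨a, ha⟩
      exact ⟨⟨a, evT_range_le n hn ha⟩, rfl⟩) h
    exact this
  · intro h
    set B := (evT n).range
    have h1 : reesAlg A r M ≤ (integralClosure B (MvPolynomial (Fin r) A)).restrictScalars A := by
      rw [reesAlg, Algebra.adjoin_le_iff]
      intro x hx
      refine int_of_stable B (sub1 A r M ^ k) ((sub1_fg M).pow k) (pow_ne_bot hM k) x ?_
      intro e he
      have h2 : x * e ∈ sub1 A r M ^ (k + 1) := by
        rw [pow_succ']; exact Submodule.mul_mem_mul hx he
      refine Submodule.mul_induction_on (hk h2) ?_ (fun p q hp hq => add_mem hp hq)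
      intro p hp q hq
      have hpB : p ∈ B := by
        have : Submodule.span A (Set.range fun i => linT (n i)) ≤ Subalgebra.toSubmodule B := by
          rw [Submodule.span_le]
          rintro _ ⟨i, rfl⟩
          exact ⟨X i, evT_X n i⟩
        exact this hp
      have : p * q = (⟨p, hpB⟩ : B) • q := rfl
      rw [this]
      exact Submodule.smul_mem _ _ (Submodule.subset_span hq)
    have h3 : IsIntegral (integralClosure B (MvPolynomial (Fin r) A)) g := by
      refine integral_transfer (algebraMap (reesAlg A r M) _) (RingHom.id _) _ ?_ h
      rintro ⟨a, ha⟩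
      exact ⟨⟨a, h1 ha⟩, rfl⟩
    exact isIntegral_trans g h3

lemma minors_primary [IsLocalRing A] [IsNoetherianRing A] (n : Fin (r + 1) → Fin r → A)
    {s : ℕ} (hs : ∀ a ∈ maximalIdeal A ^ s, ∀ f, a • f ∈ M)
    {k : ℕ} (hk : sub1 A r M ^ (k + 1) ≤ Submodule.span A (Set.range fun i => linT (n i)) * sub1 A r M ^ k) :
    ∃ N, maximalIdeal A ^ N ≤ Ideal.span (Set.range (minorsOf n)) := by
  refine Ideal.exists_pow_le_of_le_radical_of_fg ?_ (IsNoetherian.noetherian _)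
  intro s0 hs0
  rw [Ideal.radical_eq_sInf, Submodule.mem_sInf]
  rintro P ⟨hJ, hP⟩
  by_contra hs0P
  let κ := FractionRing (A ⧸ P)
  let φ : A →+* κ := (algebraMap (A ⧸ P) κ).comp (Ideal.Quotient.mk P)
  have hφ : ∀ a, φ a = 0 ↔ a ∈ P := by
    intro a
    simp only [φ, RingHom.comp_apply]
    rw [map_eq_zero_iff _ (IsFractionRing.injective (A ⧸ P) κ), Ideal.Quotient.eq_zero_iff_mem]
  obtain ⟨ξ, hξ0, hξ⟩ := minors_field φ n (fun i => (hφ _).mpr (hJ (Ideal.subset_span ⟨i, rfl⟩)))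
  let ε : MvPolynomial (Fin r) A →+* κ := eval₂Hom φ ξ
  have hε : ∀ v : Fin r → A, ε (linT v) = ∑ k, φ (v k) * ξ k := by
    intro v; simp [ε, linT]
  have h1 : ∀ x ∈ sub1 A r M ^ (k + 1), ε x = 0 := by
    intro x hx
    refine Submodule.mul_induction_on (hk hx) ?_ (fun p q hp hq => by rw [map_add, hp, hq, add_zero])
    intro p hp q hq
    suffices ε p = 0 by rw [map_mul, this, zero_mul]
    induction hp using Submodule.span_induction with
    | mem x hx => obtain ⟨i, rfl⟩ := hx; simp only; rw [hε]; exact hξ i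
    | zero => simp
    | add x y _ _ hx hy => rw [map_add, hx, hy, add_zero]
    | smul c x _ hx => rw [smul_eq_C_mul, map_mul, hx, mul_zero]
  apply hξ0
  ext j
  have h2 : s0 ^ s • Pi.single j (1 : A) ∈ M := hs _ (Ideal.pow_mem_pow hs0 s) _
  have h3 := h1 _ (Submodule.pow_mem_pow _ (linT_mem_sub1 h2) (k + 1))
  rw [map_pow, pow_eq_zero_iff (by omega), hε] at h3
  rw [Finset.sum_eq_single j (by intro b _ hb; simp [Pi.single_apply, hb]) (by simp)] at h3
  have h4 : φ s0 ≠ 0 := fun h => hs0P ((hφ _).mp h)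
  simp only [Pi.smul_apply, Pi.single_eq_same, smul_eq_mul, mul_one, map_pow] at h3
  exact (mul_eq_zero.mp h3).resolve_left (pow_ne_zero _ h4)

/-- two-generated reduction of an ideal -/
lemma red_ideal [IsLocalRing A] [IsNoetherianRing A] [IsDomain A] [Infinite (ResidueField A)]
    (hdim : ringKrullDim A = 2) (J : Ideal A) (hJ : J ≠ ⊥) :
    ∃ a b : A, a ≠ 0 ∧ b ≠ 0 ∧ a ∈ J ∧ b ∈ J ∧ ∃ k, J ^ (k + 1) ≤ Ideal.span {a, b} * J ^ k := by
  let M : Submodule A (Fin 1 → A) := Submodule.comap (LinearMap.proj (R := A) (φ := fun _ : Fin 1 => A) 0) J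
  obtain ⟨c, hc, hc0⟩ := Submodule.exists_mem_ne_zero_of_ne_bot hJ
  obtain ⟨n, k, hk⟩ := red_exists (M := M) hdim hc0 (fun f => by
    change c * f 0 ∈ J
    exact Ideal.mul_mem_right _ _ hc)
  let ε : MvPolynomial (Fin 1) A →ₐ[A] A := aeval fun _ => 1
  have hε : ∀ v : Fin 1 → A, ε (linT v) = v 0 := by
    intro v
    simp only [linT, Finset.univ_unique, Finset.sum_singleton]
    rw [map_mul, algHom_C]; simp [ε]
  have h1 : (sub1 A 1 M).map ε.toLinearMap = J := by
    ext x
    constructor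
    · rintro ⟨_, ⟨v, hv, rfl⟩, rfl⟩
      rw [emb_eq_linT]
      change ε (linT v) ∈ J
      rw [hε]; exact hv
    · intro hx
      exact ⟨linT (fun _ => x), linT_mem_sub1 hx, hε _⟩
  have h2 : ∀ k, (sub1 A 1 M ^ k).map ε.toLinearMap = J ^ k := by
    intro k
    rw [Submodule.map_pow, h1]
  have h3 : J ^ (k + 1) ≤ Ideal.span {(n 0).1 0, (n 1).1 0} * J ^ k := by
    have := Submodule.map_mono (f := ε.toLinearMap) hk
    rw [h2, Submodule.map_mul, h2, Submodule.map_span] at this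
    convert this using 3
    rw [← Set.range_comp]
    ext x; constructor
    · rintro (rfl | rfl)
      · exact ⟨0, hε _⟩
      · exact ⟨1, hε _⟩
    · rintro ⟨i, rfl⟩
      fin_cases i
      · left; exact hε _
      · right; exact hε _
  by_cases ha : (n 0).1 0 = 0
  · by_cases hb : (n 1).1 0 = 0
    · rw [ha, hb] at h3
      have : J ^ (k + 1) = ⊥ := by simpa using h3
      exact absurd (pow_eq_zero_iff (by omega) |>.mp this) hJ
    · refine ⟨_, _, hb, hb, (n 1).2, (n 1).2, k, h3.trans (Ideal.mul_mono_left ?_)⟩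
      rw [Ideal.span_le, ha]
      rintro _ (rfl | rfl)
      · exact zero_mem _
      · exact Ideal.subset_span (by simp)
  · by_cases hb : (n 1).1 0 = 0
    · refine ⟨_, _, ha, ha, (n 0).2, (n 0).2, k, h3.trans (Ideal.mul_mono_left ?_)⟩
      rw [Ideal.span_le, hb]
      rintro _ (rfl | rfl)
      · exact Ideal.subset_span (by simp)
      · exact zero_mem _
    · exact ⟨_, _, ha, hb, (n 0).2, (n 1).2, k, h3⟩

lemma red_vcl [IsDomain A] [IsNoetherianRing A] {K : Type*} [Field K] [Algebra A K] [IsFractionRing A K]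
    {J : Ideal A} {a b : A} (ha : a ≠ 0) (haJ : a ∈ J) {k : ℕ} (hk : J ^ (k + 1) ≤ Ideal.span {a, b} * J ^ k)
    {c : A} (hc : c ∈ J) :
    algebraMap A K c / algebraMap A K a ∈ vcl ((imgA A K : Set K) ∪ {algebraMap A K b / algebraMap A K a}) := by
  set φ := algebraMap A K with hφ
  have hinj : Function.Injective φ := IsFractionRing.injective A K
  have ha' : φ a ≠ 0 := by rwa [Ne, map_eq_zero_iff _ hinj]
  set f := φ b / φ a
  let B : Subalgebra A K := Algebra.adjoin A {f}
  have h1 : IsIntegral B (φ c / φ a) := by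
    refine int_of_stable B (Submodule.map (Algebra.linearMap A K) (J ^ k)) ?_ ?_ _ ?_
    · exact (IsNoetherian.noetherian _).map _
    · exact ⟨φ (a ^ k), ⟨a ^ k, Ideal.pow_mem_pow haJ k, rfl⟩, by rw [map_pow]; exact pow_ne_zero _ ha'⟩
    · rintro _ ⟨e, he, rfl⟩
      have h2 : c * e ∈ J ^ (k + 1) := by rw [pow_succ']; exact Ideal.mul_mem_mul hc he
      have h3 : ∀ z ∈ Ideal.span {a, b} * J ^ k, φ z / φ a ∈
          Submodule.span B ((Submodule.map (Algebra.linearMap A K) (J ^ k) : Submodule A K) : Set K) := by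
        intro z hz
        refine Submodule.mul_induction_on hz ?_ (fun p q hp hq => by
          rw [map_add, add_div]; exact add_mem hp hq)
        intro p hp q hq
        obtain ⟨u, v, rfl⟩ := Ideal.mem_span_pair.mp hp
        have hfB : algebraMap A K u + algebraMap A K v * f ∈ B :=
          add_mem (B.algebraMap_mem u) (mul_mem (B.algebraMap_mem v) (Algebra.subset_adjoin rfl))
        have h4 : φ ((u * a + v * b) * q) / φ a = (⟨_, hfB⟩ : B) • φ q := by
          change _ = (φ u + φ v * f) * φ q
          simp only [map_mul, map_add, f]; field_simp
        rw [h4]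
        exact Submodule.smul_mem _ _ (Submodule.subset_span ⟨q, hq, rfl⟩)
      have := h3 _ (hk h2)
      rw [map_mul, mul_comm, mul_div_assoc] at this
      rw [mul_comm]; exact this
  rw [mem_vcl_iff]
  refine integral_transfer (algebraMap B K) (RingHom.id K) _ ?_ h1
  rintro ⟨x, hx⟩
  refine ⟨⟨x, ?_⟩, rfl⟩
  induction hx using Algebra.adjoin_induction with
  | mem x hx => exact Subring.subset_closure (Or.inr hx)
  | algebraMap u => exact Subring.subset_closure (Or.inl ⟨u, rfl⟩)
  | add x y _ _ hx hy => exact add_mem hx hy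
  | mul x y _ _ hx hy => exact mul_mem hx hy

theorem core_M [IsLocalRing A] [IsNoetherianRing A] [IsDomain A] (hdim : ringKrullDim A = 2)
    (hreg : ∃ x y : A, Ideal.span {x, y} = maximalIdeal A) (hres : Infinite (ResidueField A))
    (hM0 : M ≠ ⊥) (hs : ∃ s, ∀ a ∈ maximalIdeal A ^ s, ∀ f, a • f ∈ M) :
    ∃ n : Fin (r + 1) → Fin r → A, (∀ j, n j ∈ M) ∧
      (∃ N, maximalIdeal A ^ N ≤ Ideal.span (Set.range (minorsOf n))) ∧
      ∀ g : MvPolynomial (Fin r) A, IsIntegral (reesAlg A r M) g →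
        ∃ (p : MvPolynomial (Fin (r + 1)) A) (lam : Fin r → MvPolynomial (Fin (r + 1)) A),
          (∀ α, IsIntegral (reesAlg A r M) (linT fun k => (lam k).coeff α)) ∧
          g = evT n p + ∑ k, evT n (lam k) * X k := by
  obtain ⟨s, hs⟩ := hs
  obtain ⟨x, y, hm⟩ := hreg
  obtain ⟨-, hx, -⟩ := reg_domain hdim hm
  have hxm : x ∈ maximalIdeal A := hm ▸ Ideal.subset_span (by simp)
  obtain ⟨n', k, hk⟩ := red_exists (M := M) hdim (pow_ne_zero s hx.ne_zero) (hs _ (Ideal.pow_mem_pow hxm s))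
  let n : Fin (r + 1) → Fin r → A := fun j => (n' j).1
  have hn : ∀ j, n j ∈ M := fun j => (n' j).2
  obtain ⟨N, hN⟩ := minors_primary n hs hk
  refine ⟨n, hn, ⟨N, hN⟩, fun g hg => ?_⟩
  set J := Ideal.span (Set.range (minorsOf n)) with hJ
  have hJ0 : J ≠ ⊥ := by
    intro h
    have := hN (Ideal.pow_mem_pow hxm N)
    rw [h] at this
    exact pow_ne_zero N hx.ne_zero (by simpa using this)
  obtain ⟨a, b, ha, hb, haJ, hbJ, l, hl⟩ := red_ideal hdim J hJ0
  let K := FractionRing A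
  have hRRC := reg_RRC hdim hm hres K
  have hab : ∃ N', maximalIdeal A ^ N' ≤ Ideal.span {a, b} := by
    refine ⟨N * (l + 1), ?_⟩
    rw [pow_mul]
    exact (Ideal.pow_right_mono hN _).trans (hl.trans Ideal.mul_le_left)
  obtain ⟨N', hN'⟩ := hab
  obtain ⟨cb, hcb⟩ := chainBound_exists hN'
  have hcb2 := hcb.equiv (imgEquiv A K)
  rw [Ideal.map_span, Set.image_pair] at hcb2
  have hinj : Function.Injective (algebraMap A K) := IsFractionRing.injective A K
  have hH := HDec_main cb (imgA A K) hRRC _ _ (by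
      rw [imgEquiv_coe]; rwa [Ne, map_eq_zero_iff _ hinj])  (by
      rw [imgEquiv_coe]; rwa [Ne, map_eq_zero_iff _ hinj]) hcb2
  rw [imgEquiv_coe, imgEquiv_coe] at hH
  have hmem : ∀ i, minorsOf n i ∈ J := fun i => Ideal.subset_span ⟨i, rfl⟩
  obtain ⟨p, lam, h1, h2⟩ := core_gen hRRC n ha hb hH (fun i => red_vcl ha haJ hl (hmem i))
    (fun i => by
      rw [inv_div]
      exact red_vcl hb hbJ (by rwa [Set.pair_comm]) (hmem i)) haJ hbJ g ((int_rees_iff hM0 n hn hk g).mpr hg)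
  exact ⟨p, lam, fun α => (int_rees_iff hM0 n hn hk _).mp (h1 α), h2⟩
end
end

section
set_option linter.all false
set_option autoImplicit false
open MvPolynomial IsLocalRing

section
variable {A : Type} [CommRing A] {r : ℕ}

lemma clear_den [IsDomain A] {σ : Type} (q : MvPolynomial σ (FractionRing A)) :
    ∃ d : A, d ≠ 0 ∧ ∃ q' : MvPolynomial σ A,
      MvPolynomial.map (algebraMap A (FractionRing A)) q' = C (algebraMap A (FractionRing A) d) * q := by
  induction q using MvPolynomial.induction_on' with
  | monomial α a =>
    obtain ⟨b, c, hc, rfl⟩ := IsFractionRing.div_surjective (A := A) a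
    have hc0 : algebraMap A (FractionRing A) c ≠ 0 := by
      simpa using nonZeroDivisors.ne_zero hc
    refine ⟨c, nonZeroDivisors.ne_zero hc, monomial α b, ?_⟩
    rw [map_monomial, C_mul_monomial, mul_div_cancel₀ _ hc0]
  | add p q hp hq =>
    obtain ⟨d, hd, p', hp'⟩ := hp
    obtain ⟨e, he, q', hq'⟩ := hq
    refine ⟨d * e, mul_ne_zero hd he, C e * p' + C d * q', ?_⟩
    simp only [map_add, map_mul, map_C, hp', hq']
    ring

lemma gauss_ufd [IsDomain A] [UniqueFactorizationMonoid A] {s : ℕ} (c : Fin s → A)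
    (hg : ∀ π : A, Prime π → ∃ i, ¬ π ∣ c i) (d : A) : ∀ (_ : d ≠ 0) (p q : MvPolynomial (Fin s) A),
      C d * p = linT c * q → ∃ q', p = linT c * q' := by
  induction d using UniqueFactorizationMonoid.induction_on_prime with
  | h₁ => intro h; exact absurd rfl h
  | h₂ u hu =>
    intro _ p q h
    obtain ⟨u, rfl⟩ := hu
    refine ⟨C (↑u⁻¹ : A) * q, ?_⟩
    calc p = C (↑u⁻¹ : A) * (C (u : A) * p) := by rw [← mul_assoc, ← C_mul]; simp
      _ = _ := by rw [h]; ring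
  | h₃ a π ha hπ ih =>
    intro _ p q h
    have hC : Prime (C π : MvPolynomial (Fin s) A) := (MvPolynomial.prime_C_iff _).2 hπ
    have hdvd : (C π : MvPolynomial (Fin s) A) ∣ linT c * q := ⟨C a * p, by rw [← h, C_mul]; ring⟩
    rcases hC.dvd_or_dvd hdvd with h1 | ⟨q', rfl⟩
    · obtain ⟨i, hi⟩ := hg π hπ
      refine absurd ?_ hi
      rw [MvPolynomial.C_dvd_iff_dvd_coeff] at h1
      simpa [coeff_linT] using h1 (Finsupp.single i 1)
    · refine ih ha p q' (mul_left_cancel₀ hC.ne_zero ?_)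
      rw [← mul_assoc, ← C_mul, h]; ring

lemma ker_evT [IsDomain A] [UniqueFactorizationMonoid A] (n : Fin (r + 1) → Fin r → A)
    (hg : ∀ π : A, Prime π → ∃ i, ¬ π ∣ minorsOf n i) (h0 : ∃ i, minorsOf n i ≠ 0)
    (p : MvPolynomial (Fin (r + 1)) A) (hp : evT n p = 0) : ∃ q, p = linT (minorsOf n) * q := by
  let K := FractionRing A
  let φ : A →+* K := algebraMap A K
  have hφ : Function.Injective φ := IsFractionRing.injective A K
  obtain ⟨i, hi⟩ := h0
  have hi' : φ (minorsOf n i) ≠ 0 := fun h => hi (hφ (by rw [h, map_zero]))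
  have hall : ∀ z : K, z ∈ vcl (Set.univ : Set K) := fun z => by
    rw [mem_vcl]; intro V hV; exact hV (Set.mem_univ z)
  obtain ⟨q, -, hq⟩ := beta_main (Set.univ : Set K) (fun j k => φ (n j k)) (one_ne_zero) (u := fun i => φ (minorsOf n i))
    (fun i => by rw [minors_map, one_mul]) (fun _ => hall _) (α := fun j => if j = i then (φ (minorsOf n i))⁻¹ else 0) (fun _ => hall _)
    (by simpa using inv_mul_cancel₀ hi') (p := MvPolynomial.map φ p) (by rw [mem_cf]; exact fun _ => hall _) (by rw [← map_evT, hp, map_zero])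
  obtain ⟨d, hd, q', hq'⟩ := clear_den q
  refine gauss_ufd _ hg d hd p q' ?_
  apply MvPolynomial.map_injective φ hφ
  rw [map_mul, map_mul, map_C, map_linT, hq']
  rw [hq]; ring

/-! identities -/
section
variable {P : Type} [CommRing P] (n : Fin (r + 1) → Fin r → P) (z : Fin (r + 1) → P)

noncomputable def ccz : P := ∑ i, minorsOf n i * z i
noncomputable def psi (i : Fin (r + 1)) (p : P) (l : Fin r → P) : P :=
  minorsOf n i * p + ∑ j, tauOf n i l j * z j

lemma tau_sum (i : Fin (r + 1)) (v : Fin (r + 1) → P) (j) :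
    tauOf n i (fun k => ∑ l, v l * n l k) j = v j * minorsOf n i - v i * minorsOf n j := by
  have : (fun k => ∑ l, v l * n l k) = ∑ l, v l • n l := by
    ext k; simp
  rw [this, map_sum]
  simp only [map_smul, Finset.sum_apply, Pi.smul_apply, smul_eq_mul, tau_n, mul_sub, Finset.sum_sub_distrib]
  simp

lemma psi_theta (i : Fin (r + 1)) (v : Fin (r + 1) → P) :
    psi n z i (∑ j, v j * z j) (fun k => - ∑ l, v l * n l k) = ccz n z * v i := by
  have h : (fun k => - ∑ l, v l * n l k) = - (fun k => ∑ l, v l * n l k) := rfl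
  unfold psi ccz
  rw [h, map_neg]
  simp only [Pi.neg_apply, tau_sum, neg_mul, Finset.sum_neg_distrib, sub_mul, Finset.sum_sub_distrib, Finset.mul_sum, Finset.sum_mul]
  have : ∀ a b : Fin (r+1) → P, (∀ j, a j = b j) → ∑ j, a j = ∑ j, b j := fun a b h => Finset.sum_congr rfl fun j _ => h j
  rw [this (fun j => minorsOf n i * (v j * z j)) (fun j => v j * minorsOf n i * z j) (fun j => by ring),
    this (fun j => v i * minorsOf n j * z j) (fun j => minorsOf n j * z j * v i) (fun j => by ring)]
  ring

lemma c_tau (l i j : Fin (r + 1)) (v : Fin r → P) :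
    minorsOf n l * tauOf n i v j = tauOf n l v j * minorsOf n i - tauOf n l v i * minorsOf n j := by
  rw [← tau_sum]
  have : (fun k => ∑ s, tauOf n l v s * n s k) = minorsOf n l • v := by
    ext k; simp [sum_tau]
  rw [this, map_smul]; rfl

lemma theta_psi1 [IsDomain P] (h0 : ∃ i, minorsOf n i ≠ 0) (p : P) (l : Fin r → P) :
    ∑ i, psi n z i p l * z i = ccz n z * p := by
  obtain ⟨s, hs⟩ := h0
  have key : ∑ i, (∑ j, tauOf n i l j * z j) * z i = 0 := by
    apply mul_left_cancel₀ hs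
    rw [mul_zero, Finset.mul_sum]
    have : ∀ i, minorsOf n s * ((∑ j, tauOf n i l j * z j) * z i) =
        ∑ j, tauOf n s l j * minorsOf n i * z j * z i - ∑ j, tauOf n s l i * minorsOf n j * z j * z i := by
      intro i
      rw [Finset.sum_mul, Finset.mul_sum, ← Finset.sum_sub_distrib]
      refine Finset.sum_congr rfl fun j _ => ?_
      have := c_tau n s i j l
      linear_combination (z j * z i) * this
    simp only [this, Finset.sum_sub_distrib]
    rw [Finset.sum_comm, sub_eq_zero]
    refine Finset.sum_congr rfl fun i _ => Finset.sum_congr rfl fun j _ => by ring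
  unfold psi ccz
  simp only [add_mul, Finset.sum_add_distrib, key, add_zero]
  rw [Finset.sum_mul]
  exact Finset.sum_congr rfl fun i _ => by ring

lemma theta_psi2 [IsDomain P] (h0 : ∃ i, minorsOf n i ≠ 0) (p : P) (l : Fin r → P) (k : Fin r) :
    - ∑ i, psi n z i p l * n i k = ccz n z * l k := by
  obtain ⟨s, hs⟩ := h0
  have key : ∑ i, (∑ j, tauOf n i l j * z j) * n i k = - (ccz n z * l k) := by
    apply mul_left_cancel₀ hs
    rw [Finset.mul_sum]
    have : ∀ i, minorsOf n s * ((∑ j, tauOf n i l j * z j) * n i k) =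
        (∑ j, tauOf n s l j * z j) * (minorsOf n i * n i k) - (tauOf n s l i * n i k) * ccz n z := by
      intro i
      unfold ccz
      rw [Finset.sum_mul, Finset.mul_sum, Finset.sum_mul, Finset.mul_sum, ← Finset.sum_sub_distrib]
      refine Finset.sum_congr rfl fun j _ => ?_
      have := c_tau n s i j l
      linear_combination (z j * n i k) * this
    simp only [this, Finset.sum_sub_distrib, ← Finset.mul_sum, ← Finset.sum_mul]
    rw [minors_rel, sum_tau]; ring
  unfold psi
  simp only [add_mul, Finset.sum_add_distrib, key]
  have : ∑ i, minorsOf n i * p * n i k = 0 := by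
    have := minors_rel n k
    calc _ = p * ∑ i, minorsOf n i * n i k := by
          rw [Finset.mul_sum]; exact Finset.sum_congr rfl fun i _ => by ring
      _ = 0 := by rw [this, mul_zero]
  rw [this]; ring
end
end
end

section
set_option linter.all false
set_option autoImplicit false
open MvPolynomial IsLocalRing

section
variable {A : Type} [CommRing A] {r t : ℕ}

/-- kill the variables in `T` -/
noncomputable def sgT (A : Type) [CommRing A] {t : ℕ} (T : Finset (Fin t)) : MvPolynomial (Fin t) A →ₐ[A] MvPolynomial (Fin t) A :=
  aeval fun j => if j ∈ T then 0 else X j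

lemma sgT_X (T : Finset (Fin t)) (j) : sgT A T (X j) = if j ∈ T then 0 else X j := by
  simp [sgT]

lemma sgT_C (T : Finset (Fin t)) (a : A) : sgT A T (C a) = C a := by
  simp [sgT]

lemma sgT_empty (p : MvPolynomial (Fin t) A) : sgT A ∅ p = p := by
  have : sgT A (∅ : Finset (Fin t)) = AlgHom.id A _ := by
    apply MvPolynomial.algHom_ext; intro j; simp [sgT_X]
  rw [this]; rfl

lemma sgT_insert (T : Finset (Fin t)) (i) (p : MvPolynomial (Fin t) A) :
    sgT A (insert i T) p = sgT A {i} (sgT A T p) := by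
  have : sgT A (insert i T) = (sgT A {i}).comp (sgT A T) := by
    apply MvPolynomial.algHom_ext; intro j
    simp only [AlgHom.comp_apply, sgT_X, Finset.mem_insert]
    by_cases h : j ∈ T
    · simp [h]
    · simp [h, sgT_X]
  rw [this]; rfl

lemma sgT_univ (p : MvPolynomial (Fin t) A) : sgT A Finset.univ p = C (constantCoeff p) := by
  have : sgT A (Finset.univ : Finset (Fin t)) = (Algebra.ofId A _).comp (aeval (fun _ => (0 : A))) := by
    apply MvPolynomial.algHom_ext; intro j; simp [sgT_X]
  rw [this]
  simp [Algebra.ofId_apply, MvPolynomial.aeval_zero', ← MvPolynomial.algebraMap_eq]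

lemma sgT_cc (T : Finset (Fin t)) (p : MvPolynomial (Fin t) A) : constantCoeff (sgT A T p) = constantCoeff p := by
  have : (constantCoeff : MvPolynomial (Fin t) A →+* A).comp (sgT A T).toRingHom = constantCoeff := by
    apply MvPolynomial.ringHom_ext
    · intro a; simp [sgT_C]
    · intro j; simp only [AlgHom.toRingHom_eq_coe, RingHom.comp_apply, RingHom.coe_coe, sgT_X]; split_ifs <;> simp
  exact DFunLike.congr_fun this p

lemma sg_single [IsDomain A] (i : Fin t) : ∃ D : MvPolynomial (Fin t) A →ₗ[A] MvPolynomial (Fin t) A,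
    ∀ p, p = sgT A {i} p + X i * D p := by
  have h : ∀ p : MvPolynomial (Fin t) A, ∃ q, p - sgT A {i} p = X i * q := by
    intro p
    have : (Ideal.Quotient.mkₐ A (Ideal.span {(X i : MvPolynomial (Fin t) A)})).comp (sgT A {i}) = Ideal.Quotient.mkₐ A _ := by
      apply MvPolynomial.algHom_ext; intro j
      simp only [AlgHom.comp_apply, sgT_X, Finset.mem_singleton]
      split_ifs with hj
      · subst hj; symm; rw [map_zero]
        simp [Ideal.Quotient.eq_zero_iff_mem]
      · rfl
    have h2 := DFunLike.congr_fun this p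
    have h3 := (Ideal.Quotient.eq.1 h2.symm)
    exact Ideal.mem_span_singleton'.1 h3 |>.imp fun a ha => by rw [mul_comm, ha]; rfl
  choose f hf using h
  have hX : (X i : MvPolynomial (Fin t) A) ≠ 0 := X_ne_zero i
  refine ⟨⟨⟨f, fun p q => mul_left_cancel₀ hX ?_⟩, fun a p => mul_left_cancel₀ hX ?_⟩, fun p => ?_⟩
  · rw [← hf, mul_add, ← hf, ← hf, map_add]; ring
  · simp only [RingHom.id_apply]
    rw [← hf, mul_smul_comm, ← hf, map_smul, smul_sub]
  · show p = _ + X i * f p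
    rw [← hf]; ring

lemma sg_dec [IsDomain A] (T : Finset (Fin t)) :
    ∃ D : Fin t → (MvPolynomial (Fin t) A →ₗ[A] MvPolynomial (Fin t) A),
    ∀ p, p = sgT A T p + ∑ j ∈ T, X j * D j p := by
  induction T using Finset.induction_on with
  | empty => exact ⟨fun _ => 0, fun p => by simp [sgT_empty]⟩
  | insert i T hi ih =>
    obtain ⟨D, hD⟩ := ih
    obtain ⟨d, hd⟩ := sg_single (A := A) i
    refine ⟨fun j => if j = i then d ∘ₗ (sgT A T).toLinearMap else D j, fun p => ?_⟩
    rw [Finset.sum_insert hi, sgT_insert]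
    have : ∑ j ∈ T, X j * (if j = i then d ∘ₗ (sgT A T).toLinearMap else D j) p = ∑ j ∈ T, X j * D j p :=
      Finset.sum_congr rfl fun j hj => by rw [if_neg (by rintro rfl; exact hi hj)]
    rw [this]
    simp only [if_true, LinearMap.comp_apply, AlgHom.toLinearMap_apply]
    rw [← add_assoc, ← hd, ← hD]

/-- coefficient vectors in `L` -/
def inL (L : Submodule A (Fin r → A)) (l : Fin r → MvPolynomial (Fin t) A) : Prop :=
  ∀ α, (fun k => (l k).coeff α) ∈ L

variable {L : Submodule A (Fin r → A)}

lemma inL_map {s : ℕ} {l : Fin r → MvPolynomial (Fin t) A} (h : inL L l)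
    (D : MvPolynomial (Fin t) A →ₗ[A] MvPolynomial (Fin s) A) : inL L (fun k => D (l k)) := by
  classical
  intro α
  let s := Finset.univ.biUnion fun k => (l k).support
  have h1 : ∀ k, l k = ∑ β ∈ s, (l k).coeff β • monomial β (1 : A) := by
    intro k
    conv_lhs => rw [(l k).as_sum]
    rw [Finset.sum_subset (Finset.subset_biUnion_of_mem (fun k => (l k).support) (Finset.mem_univ k))]
    · exact Finset.sum_congr rfl fun β _ => by rw [smul_monomial]; simp
    · intro β _ hβ; rw [notMem_support_iff.1 hβ, map_zero]
  have h2 : (fun k => (D (l k)).coeff α) = ∑ β ∈ s, (D (monomial β 1)).coeff α • (fun k => (l k).coeff β) := by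
    ext k
    conv_lhs => rw [h1 k, map_sum]
    rw [coeff_sum, Finset.sum_apply]
    refine Finset.sum_congr rfl fun β _ => ?_
    rw [map_smul, coeff_smul]; simp [mul_comm]
  rw [h2]
  exact Submodule.sum_mem _ fun β _ => L.smul_mem _ (h β)

lemma inL_add {l l' : Fin r → MvPolynomial (Fin t) A} (h : inL L l) (h' : inL L l') : inL L (fun k => l k + l' k) := by
  intro α; exact (by ext k; simp : (fun k => coeff α (l k + l' k)) = (fun k => coeff α (l k)) + fun k => coeff α (l' k)) ▸ L.add_mem (h α) (h' α)

lemma inL_sum {ι : Type*} (s : Finset ι) {l : ι → Fin r → MvPolynomial (Fin t) A} (h : ∀ i ∈ s, inL L (l i)) :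
    inL L (fun k => ∑ i ∈ s, l i k) := by
  intro α
  have : (fun k => coeff α (∑ i ∈ s, l i k)) = ∑ i ∈ s, fun k => coeff α (l i k) := by
    ext k; simp [coeff_sum]
  rw [this]; exact Submodule.sum_mem _ fun i hi => h i hi α

lemma inL_C {v : Fin r → A} (hv : v ∈ L) (p : MvPolynomial (Fin t) A) : inL L (fun k => p * C (v k)) := by
  intro α
  have : (fun k => coeff α (p * C (v k))) = p.coeff α • v := by
    ext k; rw [mul_comm, coeff_C_mul]; simp [mul_comm]
  rw [this]; exact L.smul_mem _ hv

/-! the presentation -/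
variable (n : Fin (r + 1) → Fin r → A) (x' : Fin (r + 1) → A)

noncomputable def zz (j : Fin (r + 1)) : MvPolynomial (Fin (r + 1)) A := X j - C (x' j)
noncomputable def nP (j : Fin (r + 1)) (k : Fin r) : MvPolynomial (Fin (r + 1)) A := C (n j k)

noncomputable def EE : MvPolynomial (Fin (r + 1)) A →ₐ[A] MvPolynomial (Fin r) A :=
  aeval fun j => linT (n j) + C (x' j)

noncomputable def ee (p : MvPolynomial (Fin (r + 1)) A) (l : Fin r → MvPolynomial (Fin (r + 1)) A) : MvPolynomial (Fin r) A :=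
  EE n x' p + ∑ k, EE n x' (l k) * X k

noncomputable def tm (x' : Fin (r + 1) → A) : MvPolynomial (Fin (r + 1)) A →ₐ[A] MvPolynomial (Fin (r + 1)) A :=
  aeval fun j => X j - C (x' j)
noncomputable def tp (x' : Fin (r + 1) → A) : MvPolynomial (Fin (r + 1)) A →ₐ[A] MvPolynomial (Fin (r + 1)) A :=
  aeval fun j => X j + C (x' j)

lemma EE_C (a : A) : EE n x' (C a) = C a := by simp [EE]
lemma EE_X (j) : EE n x' (X j) = linT (n j) + C (x' j) := by simp [EE]

lemma tm_tp (p) : tm x' (tp x' p) = p := by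
  have : (tm x').comp (tp x') = AlgHom.id A _ := by
    apply MvPolynomial.algHom_ext; intro j; simp [tm, tp]
  exact DFunLike.congr_fun this p

lemma EE_tm (p) : EE n x' (tm x' p) = evT n p := by
  have : (EE n x').comp (tm x') = evT n := by
    apply MvPolynomial.algHom_ext; intro j; simp [EE, tm, evT]
  exact DFunLike.congr_fun this p

lemma evT_tp (p) : evT n (tp x' p) = EE n x' p := by
  have : (evT n).comp (tp x') = EE n x' := by
    apply MvPolynomial.algHom_ext; intro j; simp [EE, tp, evT]
  exact DFunLike.congr_fun this p

lemma EE_zz (j) : EE n x' (zz x' j) = ∑ k, C (n j k) * X k := by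
  rw [zz, map_sub, EE_X, EE_C, add_sub_cancel_right]; rfl

lemma minors_nP (i) : minorsOf (nP n) i = C (minorsOf n i) := minors_map C n i

lemma tm_lin (u : Fin (r + 1) → A) : tm x' (linT u) = ∑ j, C (u j) * zz x' j := by
  simp [linT, tm, zz]

lemma ee_theta (v : Fin (r + 1) → MvPolynomial (Fin (r + 1)) A) :
    ee n x' (∑ j, v j * zz x' j) (fun k => - ∑ j, v j * nP n j k) = 0 := by
  unfold ee
  simp only [map_sum, map_mul, map_neg, EE_zz, nP, EE_C, neg_mul, Finset.sum_neg_distrib, Finset.sum_mul, Finset.mul_sum]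
  rw [Finset.sum_comm, add_neg_eq_zero]
  exact Finset.sum_congr rfl fun i _ => Finset.sum_congr rfl fun j _ => by ring

lemma ee_add (p p' l l') : ee n x' (p + p') (fun k => l k + l' k) = ee n x' p l + ee n x' p' l' := by
  simp only [ee, map_add, add_mul, Finset.sum_add_distrib]; ring

lemma ee_mul (q p l) : ee n x' (q * p) (fun k => q * l k) = EE n x' q * ee n x' p l := by
  simp only [ee, map_mul, mul_add, Finset.mul_sum, mul_assoc]

lemma ee_sum {ι : Type*} (s : Finset ι) (p : ι → MvPolynomial (Fin (r + 1)) A) (l : ι → Fin r → MvPolynomial (Fin (r + 1)) A) :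
    ee n x' (∑ i ∈ s, p i) (fun k => ∑ i ∈ s, l i k) = ∑ i ∈ s, ee n x' (p i) (l i) := by
  simp only [ee, map_sum, Finset.sum_mul, Finset.sum_add_distrib]
  rw [Finset.sum_comm]

lemma ccz_cc (T : Finset (Fin (r + 1))) :
    constantCoeff (ccz (nP n) (fun j => sgT A T (zz x' j))) = - ∑ i, minorsOf n i * x' i := by
  simp [ccz, minors_nP, sgT_cc, zz]

lemma ee_exact [IsDomain A] [UniqueFactorizationMonoid A]
    (hg : ∀ π : A, Prime π → ∃ i, ¬ π ∣ minorsOf n i) (hx : ∑ i, minorsOf n i * x' i ≠ 0) (p l) (h : ee n x' p l = 0) :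
    ∃ v : Fin (r + 1) → MvPolynomial (Fin (r + 1)) A, p = ∑ j, v j * zz x' j ∧ ∀ k, l k = - ∑ j, v j * nP n j k := by
  have h0 : ∃ i, minorsOf n i ≠ 0 := by
    by_contra hh; push Not at hh; exact hx (by simp [hh])
  have h0' : ∃ i, minorsOf (nP n) i ≠ 0 := by
    obtain ⟨i, hi⟩ := h0; exact ⟨i, by rw [minors_nP]; simpa using hi⟩
  have hcc : ccz (nP n) (zz x') ≠ 0 := by
    intro hh
    have := ccz_cc n x' ∅
    simp only [sgT_empty] at this
    erw [hh] at this
    exact hx (by simpa using this.symm)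
  have h1 : ∀ i, EE n x' (psi (nP n) (zz x') i p l) = 0 := by
    intro i
    have h2 : EE n x' (∑ j, tauOf (nP n) i l j * zz x' j) = C (minorsOf n i) * ∑ k, EE n x' (l k) * X k := by
      simp only [map_sum, map_mul, EE_zz, Finset.mul_sum]
      rw [Finset.sum_comm]
      refine Finset.sum_congr rfl fun k _ => ?_
      have := congrArg (EE n x') (sum_tau (nP n) i l k)
      simp only [map_sum, map_mul, minors_nP, EE_C, nP] at this
      rw [← mul_assoc, ← this, Finset.sum_mul]
      exact Finset.sum_congr rfl fun j _ => by ring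
    rw [psi, map_add, h2, map_mul, minors_nP, EE_C, ← mul_add]
    have : EE n x' p + ∑ k, EE n x' (l k) * X k = 0 := h
    rw [this, mul_zero]
  have h3 : ∀ i, ∃ v, psi (nP n) (zz x') i p l = ccz (nP n) (zz x') * v := by
    intro i
    obtain ⟨q, hq⟩ := ker_evT n hg h0 (tp x' (psi (nP n) (zz x') i p l)) (by rw [evT_tp, h1])
    refine ⟨tm x' q, ?_⟩
    have := congrArg (tm x') hq
    rw [tm_tp, map_mul, tm_lin] at this
    rw [this, ccz]; simp only [minors_nP]
  choose v hv using h3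
  refine ⟨v, mul_left_cancel₀ hcc ?_, fun k => mul_left_cancel₀ hcc ?_⟩
  · rw [← theta_psi1 _ _ h0' p l, Finset.mul_sum]
    exact Finset.sum_congr rfl fun i _ => by rw [hv]; ring
  · rw [← theta_psi2 _ (zz x') h0' p l, mul_neg, Finset.mul_sum]
    exact congrArg _ (Finset.sum_congr rfl fun i _ => by rw [hv]; ring)

end
end

section
set_option linter.all false
set_option autoImplicit false
open MvPolynomial IsLocalRing

section
variable {A : Type} [CommRing A] {r t : ℕ} {L : Submodule A (Fin r → A)}
variable (n : Fin (r + 1) → Fin r → A) (x' : Fin (r + 1) → A)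

lemma dec_inL [IsDomain A] (T : Finset (Fin (r + 1))) {p : MvPolynomial (Fin (r + 1)) A}
    {l : Fin r → MvPolynomial (Fin (r + 1)) A} (hl : inL L l) (hp0 : sgT A T p = 0) (hl0 : ∀ k, sgT A T (l k) = 0) :
    ∃ (q : Fin (r + 1) → MvPolynomial (Fin (r + 1)) A) (m : Fin (r + 1) → Fin r → MvPolynomial (Fin (r + 1)) A),
      (∀ j, inL L (m j)) ∧ ee n x' p l = ∑ j ∈ T, EE n x' (X j) * ee n x' (q j) (m j) := by
  obtain ⟨D, hD⟩ := sg_dec (A := A) T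
  refine ⟨fun j => D j p, fun j k => D j (l k), fun j => inL_map hl (D j), ?_⟩
  simp only [← ee_mul]
  rw [← ee_sum]
  have h1 : p = ∑ j ∈ T, X j * D j p := by conv_lhs => rw [hD p, hp0, zero_add]
  have h2 : l = fun k => ∑ j ∈ T, X j * D j (l k) := by
    ext1 k; conv_lhs => rw [hD (l k), hl0, zero_add]
  rw [← h1, ← h2]

lemma step_X [IsDomain A] [UniqueFactorizationMonoid A]
    (hg : ∀ π : A, Prime π → ∃ i, ¬ π ∣ minorsOf n i) (hx : ∑ i, minorsOf n i * x' i ≠ 0) (hn : ∀ j, n j ∈ L)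
    (T : Finset (Fin (r + 1))) (i : Fin (r + 1)) (hi : i ∉ T)
    (p : MvPolynomial (Fin (r + 1)) A) (l : Fin r → MvPolynomial (Fin (r + 1)) A) (hl : inL L l)
    (q : Fin (r + 1) → MvPolynomial (Fin (r + 1)) A) (m : Fin (r + 1) → Fin r → MvPolynomial (Fin (r + 1)) A)
    (h : EE n x' (X i) * ee n x' p l = ∑ j ∈ T, EE n x' (X j) * ee n x' (q j) (m j)) :
    ∃ (q : Fin (r + 1) → MvPolynomial (Fin (r + 1)) A) (m : Fin (r + 1) → Fin r → MvPolynomial (Fin (r + 1)) A),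
      (∀ j, inL L (m j)) ∧ ee n x' p l = ∑ j ∈ T, EE n x' (X j) * ee n x' (q j) (m j) := by
  have hz : ee n x' (X i * p + (-1) * ∑ j ∈ T, X j * q j) (fun k => X i * l k + (-1) * ∑ j ∈ T, X j * m j k) = 0 := by
    rw [ee_add, ee_mul, ee_mul n x' (-1), ee_sum]
    simp only [ee_mul]
    rw [h, map_neg, map_one]; ring
  obtain ⟨v, hv1, hv2⟩ := ee_exact n x' hg hx _ _ hz
  have hsum0 : ∀ f : Fin (r + 1) → MvPolynomial (Fin (r + 1)) A, ∑ j ∈ T, sgT A (insert i T) (X j) * f j = 0 := fun f =>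
    Finset.sum_eq_zero fun j hj => by rw [sgT_X, if_pos (Finset.mem_insert_of_mem hj), zero_mul]
  have hsum0' : ∀ f : Fin (r + 1) → MvPolynomial (Fin (r + 1)) A, ∑ j ∈ T, sgT A T (X j) * f j = 0 := fun f =>
    Finset.sum_eq_zero fun j hj => by rw [sgT_X, if_pos hj, zero_mul]
  have hXi : sgT A (insert i T) (X i) = 0 := by rw [sgT_X, if_pos (Finset.mem_insert_self _ _)]
  have hXi' : sgT A T (X i) = X i := by rw [sgT_X, if_neg hi]
  have s1 : ∑ j, sgT A (insert i T) (v j) * sgT A (insert i T) (zz x' j) = 0 := by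
    have := congrArg (sgT A (insert i T)) hv1
    simp only [map_add, map_mul, map_sum, hsum0, hXi, zero_mul, mul_zero, add_zero] at this
    exact this.symm
  have s2 : ∀ k, - ∑ j, sgT A (insert i T) (v j) * nP n j k = 0 := by
    intro k
    have := congrArg (sgT A (insert i T)) (hv2 k)
    simp only [map_add, map_mul, map_sum, map_neg, hsum0, hXi, zero_mul, mul_zero, add_zero, nP, sgT_C] at this
    exact this.symm
  have hccne : ccz (nP n) (fun j => sgT A (insert i T) (zz x' j)) ≠ 0 := by
    intro hh
    have := ccz_cc n x' (insert i T)
    rw [hh] at this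
    exact hx (by simpa using this.symm)
  have s3 : ∀ s, sgT A (insert i T) (v s) = 0 := by
    intro s
    have := psi_theta (nP n) (fun j => sgT A (insert i T) (zz x' j)) s (fun s => sgT A (insert i T) (v s))
    rw [s1, funext s2] at this
    have h0 : psi (nP n) (fun j => sgT A (insert i T) (zz x' j)) s 0 (fun k => 0) = 0 := by
      have : tauOf (nP n) s (fun k => 0) = 0 := map_zero (tauOf (nP n) s)
      simp [psi, this]
    rw [h0] at this
    exact (mul_eq_zero.1 this.symm).resolve_left hccne
  obtain ⟨D, hD⟩ := sg_dec (A := A) (insert i T)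
  have hv : ∀ s, v s = X i * D i (v s) + ∑ j ∈ T, X j * D j (v s) := by
    intro s
    conv_lhs => rw [hD (v s), s3, zero_add, Finset.sum_insert hi]
  set u := fun s => D i (v s) with hu
  have hv' : ∀ s, sgT A T (v s) = X i * sgT A T (u s) := by
    intro s
    rw [hv s, map_add, map_mul, map_sum, hXi']
    simp only [map_mul, hsum0', add_zero, hu]
  have hee : ee n x' p l = ee n x' (p + (-1) * ∑ j, u j * zz x' j) (fun k => l k + (-1) * (- ∑ j, u j * nP n j k)) := by
    rw [ee_add, ee_mul, ee_theta, mul_zero, add_zero]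
  rw [hee]
  have hXi0 : (X i : MvPolynomial (Fin (r+1)) A) ≠ 0 := X_ne_zero i
  refine dec_inL n x' T (inL_add hl ?_) ?_ ?_
  · have : (fun k => -1 * (- ∑ j, u j * nP n j k)) = fun k => ∑ j, u j * nP n j k := by ext1 k; ring
    rw [this]
    exact inL_sum _ fun j _ => inL_C (hn j) (u j)
  · apply mul_left_cancel₀ hXi0
    have := congrArg (sgT A T) hv1
    simp only [map_add, map_mul, map_sum, hsum0', hXi', mul_zero, add_zero, hv', mul_assoc, ← Finset.mul_sum] at this
    simp only [map_add, map_mul, map_sum, map_neg, map_one, mul_add, this]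
    ring
  · intro k
    apply mul_left_cancel₀ hXi0
    have := congrArg (sgT A T) (hv2 k)
    simp only [map_add, map_mul, map_sum, map_neg, hsum0', hXi', mul_zero, add_zero, hv', mul_assoc, ← Finset.mul_sum] at this
    simp only [map_add, map_mul, map_sum, map_neg, map_one, mul_add, this]
    ring

lemma step_w [IsDomain A] [UniqueFactorizationMonoid A]
    (hg : ∀ π : A, Prime π → ∃ i, ¬ π ∣ minorsOf n i) {w : A} (hw : Prime w) (hx : ¬ w ∣ ∑ i, minorsOf n i * x' i) (hn : ∀ j, n j ∈ L)
    (p : MvPolynomial (Fin (r + 1)) A) (l : Fin r → MvPolynomial (Fin (r + 1)) A) (hl : inL L l)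
    (q : Fin (r + 1) → MvPolynomial (Fin (r + 1)) A) (m : Fin (r + 1) → Fin r → MvPolynomial (Fin (r + 1)) A)
    (h : C w * ee n x' p l = ∑ j, EE n x' (X j) * ee n x' (q j) (m j)) :
    ∃ (q : Fin (r + 1) → MvPolynomial (Fin (r + 1)) A) (m : Fin (r + 1) → Fin r → MvPolynomial (Fin (r + 1)) A),
      (∀ j, inL L (m j)) ∧ ee n x' p l = ∑ j, EE n x' (X j) * ee n x' (q j) (m j) := by
  have hz : ee n x' (C w * p + (-1) * ∑ j, X j * q j) (fun k => C w * l k + (-1) * ∑ j, X j * m j k) = 0 := by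
    rw [ee_add, ee_mul, ee_mul n x' (-1), ee_sum]
    simp only [ee_mul]
    rw [EE_C, h, map_neg, map_one]; ring
  obtain ⟨v, hv1, hv2⟩ := ee_exact n x' hg (fun h => hx (h ▸ dvd_zero _)) _ _ hz
  have t1 := congrArg (constantCoeff) hv1
  have t2 := fun k => congrArg constantCoeff (hv2 k)
  simp only [map_add, map_mul, map_sum, map_neg, map_one, constantCoeff_C, constantCoeff_X, zero_mul, Finset.sum_const_zero, mul_zero, add_zero, nP, zz, map_sub, zero_sub] at t1 t2
  have s3 : ∀ s, ∃ u, constantCoeff (v s) = w * u := by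
    intro s
    have := psi_theta n (fun j => - x' j) s (fun j => constantCoeff (v j))
    rw [← t1, ← funext t2] at this
    have h0 : psi n (fun j => - x' j) s (w * constantCoeff p) (fun k => w * constantCoeff (l k)) =
        w * psi n (fun j => - x' j) s (constantCoeff p) (fun k => constantCoeff (l k)) := by
      have : tauOf n s (fun k => w * constantCoeff (l k)) = w • tauOf n s (fun k => constantCoeff (l k)) := by
        rw [← map_smul]; rfl
      simp only [psi, this, Pi.smul_apply, smul_eq_mul, mul_add, Finset.mul_sum]
      rw [mul_left_comm]
      simp only [mul_assoc]
    rw [h0] at this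
    have hd : w ∣ ccz n (fun j => - x' j) * constantCoeff (v s) := ⟨_, this.symm⟩
    refine (hw.dvd_or_dvd hd).resolve_left fun hh => hx ?_
    have : ccz n (fun j => - x' j) = - ∑ i, minorsOf n i * x' i := by simp [ccz]
    rw [this] at hh
    exact (dvd_neg).1 hh
  choose u hu using s3
  have hee : ee n x' p l = ee n x' (p + (-1) * ∑ j, C (u j) * zz x' j) (fun k => l k + (-1) * (- ∑ j, C (u j) * nP n j k)) := by
    rw [ee_add, ee_mul, ee_theta, mul_zero, add_zero]
  rw [hee]
  refine dec_inL n x' Finset.univ (inL_add hl ?_) ?_ ?_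
  · have : (fun k => -1 * (- ∑ j, C (u j) * nP n j k)) = fun k => ∑ j, C (u j) * nP n j k := by ext1 k; ring
    rw [this]
    exact inL_sum _ fun j _ => inL_C (hn j) (C (u j))
  · rw [sgT_univ, ← C_0]
    apply congrArg C
    apply mul_left_cancel₀ hw.ne_zero
    simp only [hu, mul_assoc, ← Finset.mul_sum] at t1
    simp only [map_add, map_mul, map_sum, map_neg, map_one, constantCoeff_C, constantCoeff_X, zz, map_sub, zero_sub, mul_add, t1]
    ring
  · intro k
    rw [sgT_univ, ← C_0]
    apply congrArg C
    apply mul_left_cancel₀ hw.ne_zero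
    have t2 := t2 k
    simp only [hu, mul_assoc, ← Finset.mul_sum] at t2
    simp only [map_add, map_mul, map_sum, map_neg, map_one, constantCoeff_C, constantCoeff_X, nP, mul_add, t2]
    ring
end
end

section
set_option linter.all false
set_option autoImplicit false
open MvPolynomial IsLocalRing

section
variable {A : Type} [CommRing A] {r : ℕ} {M : Submodule A (Fin r → A)}

lemma mem_intCl {g : MvPolynomial (Fin r) A} : g ∈ intClAlg A r M ↔ IsIntegral (reesAlg A r M) g := Iff.rfl

lemma rees_le_intCl : reesAlg A r M ≤ intClAlg A r M := fun x hx =>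
  mem_intCl.2 (isIntegral_algebraMap (R := reesAlg A r M) (x := ⟨x, hx⟩))

/-- vectors integral over M -/
noncomputable def Lb (A : Type) [CommRing A] (r : ℕ) (M : Submodule A (Fin r → A)) : Submodule A (Fin r → A) :=
  (Subalgebra.toSubmodule (intClAlg A r M)).comap (emb A r)

lemma mem_Lb {v : Fin r → A} : v ∈ Lb A r M ↔ IsIntegral (reesAlg A r M) (linT v) := by
  rw [← emb_eq_linT]; rfl

lemma EE_mem (n : Fin (r + 1) → Fin r → A) (hn : ∀ j, n j ∈ M) (x' : Fin (r + 1) → A) (p) : EE n x' p ∈ reesAlg A r M := by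
  have : (EE n x').range ≤ reesAlg A r M := by
    rw [EE, ← Algebra.adjoin_range_eq_range_aeval, Algebra.adjoin_le_iff]
    rintro _ ⟨j, rfl⟩
    exact add_mem (linT_mem_rees (hn j)) (Subalgebra.algebraMap_mem _ (x' j))
  exact this ⟨p, rfl⟩

lemma ee_mem (n : Fin (r + 1) → Fin r → A) (hn : ∀ j, n j ∈ M) (x' : Fin (r + 1) → A) (p) {l} (hl : inL (Lb A r M) l) :
    ee n x' p l ∈ intClAlg A r M := by
  classical
  refine add_mem (rees_le_intCl (EE_mem n hn x' p)) ?_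
  let s := Finset.univ.biUnion fun k => (l k).support
  have h1 : ∀ k, l k = ∑ β ∈ s, monomial β (1 : A) * C ((l k).coeff β) := by
    intro k
    conv_lhs => rw [(l k).as_sum]
    rw [Finset.sum_subset (Finset.subset_biUnion_of_mem (fun k => (l k).support) (Finset.mem_univ k))]
    · exact Finset.sum_congr rfl fun β _ => by rw [mul_comm, C_mul_monomial, mul_one]
    · intro β _ hβ; rw [notMem_support_iff.1 hβ, map_zero]
  have h2 : ∑ k, EE n x' (l k) * X k = ∑ β ∈ s, EE n x' (monomial β 1) * linT (fun k => (l k).coeff β) := by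
    calc _ = ∑ k, EE n x' (∑ β ∈ s, monomial β (1 : A) * C ((l k).coeff β)) * X k :=
          Finset.sum_congr rfl fun k _ => by rw [← h1 k]
      _ = _ := by
        simp only [map_sum, map_mul, EE_C, Finset.sum_mul, linT, Finset.mul_sum]
        rw [Finset.sum_comm]
        exact Finset.sum_congr rfl fun k _ => Finset.sum_congr rfl fun j _ => by ring
  rw [h2]
  exact sum_mem fun β _ => mul_mem (rees_le_intCl (EE_mem n hn x' _)) (mem_Lb.1 (hl β))

theorem reg_seq [IsLocalRing A] [IsNoetherianRing A] [IsDomain A] (hdim : ringKrullDim A = 2)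
    (hreg : ∃ x y : A, Ideal.span {x, y} = maximalIdeal A) (hres : Infinite (ResidueField A))
    (hM0 : M ≠ ⊥) (hs : ∃ s, ∀ a ∈ maximalIdeal A ^ s, ∀ f, a • f ∈ M) :
    ∃ y : Fin (r + 1 + 1) → reesAlg A r M, (∀ i, y i ∈ gradedMax A r M) ∧
      ∀ i, ∀ f ∈ intClAlg A r M, ∀ g : Fin (r + 1 + 1) → MvPolynomial (Fin r) A, (∀ j, g j ∈ intClAlg A r M) →
        (y i).1 * f = ∑ j ∈ Finset.Iio i, (y j).1 * g j →
        ∃ g' : Fin (r + 1 + 1) → MvPolynomial (Fin r) A, (∀ j, g' j ∈ intClAlg A r M) ∧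
          f = ∑ j ∈ Finset.Iio i, (y j).1 * g' j := by
  classical
  obtain ⟨n, hn, ⟨N, hN⟩, hcore⟩ := core_M hdim hreg hres hM0 hs
  obtain ⟨x, y, hm⟩ := hreg
  obtain ⟨-, hx, hy⟩ := reg_domain hdim hm
  have hxm : x ∈ maximalIdeal A := hm ▸ Ideal.subset_span (by simp)
  have hym : y ∈ maximalIdeal A := hm ▸ Ideal.subset_span (by simp)
  have hm' : Ideal.span {y, x} = maximalIdeal A := by rw [Set.pair_comm, hm]
  haveI : UniqueFactorizationMonoid A := rr_ufd hm hx
  have hxc : ∃ i, ¬ x ∣ minorsOf n i := by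
    by_contra hh; push Not at hh
    refine reg_pow_notMem hdim hm' N ?_
    have : Ideal.span (Set.range (minorsOf n)) ≤ Ideal.span {x} := by
      rw [Ideal.span_le]; rintro _ ⟨i, rfl⟩; exact Ideal.mem_span_singleton.2 (hh i)
    exact this (hN (Ideal.pow_mem_pow hym N))
  have hg : ∀ π : A, Prime π → ∃ i, ¬ π ∣ minorsOf n i := by
    intro π hπ
    by_contra hh; push Not at hh
    have hle : Ideal.span (Set.range (minorsOf n)) ≤ Ideal.span {π} := by
      rw [Ideal.span_le]; rintro _ ⟨i, rfl⟩; exact Ideal.mem_span_singleton.2 (hh i)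
    have h1 : π ∣ x := hπ.dvd_of_dvd_pow (Ideal.mem_span_singleton.1 (hle (hN (Ideal.pow_mem_pow hxm N))))
    obtain ⟨i, hi⟩ := hxc
    exact hi (((hπ.irreducible).dvd_symm hx.irreducible h1).trans (hh i))
  obtain ⟨i0, hi0⟩ := hxc
  let x' : Fin (r + 1) → A := fun j => if j = i0 then y else 0
  have hsum : ∑ i, minorsOf n i * x' i = minorsOf n i0 * y := by simp [x']
  have hxs : ¬ x ∣ ∑ i, minorsOf n i * x' i := by
    rw [hsum]; intro h
    rcases hx.dvd_or_dvd h with h | h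
    · exact hi0 h
    · exact reg_pow_notMem hdim hm' 1 (by rw [pow_one]; exact Ideal.mem_span_singleton.2 h)
  have hnL : ∀ j, n j ∈ Lb A r M := fun j => mem_Lb.2 (mem_intCl.1 (rees_le_intCl (linT_mem_rees (hn j))))
  have surj : ∀ f ∈ intClAlg A r M, ∃ p l, inL (Lb A r M) l ∧ f = ee n x' p l := by
    intro f hf
    obtain ⟨p, lam, hlam, rfl⟩ := hcore f (mem_intCl.1 hf)
    refine ⟨tm x' p, fun k => tm x' (lam k), inL_map (fun α => mem_Lb.2 (hlam α)) (tm x').toLinearMap, ?_⟩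
    simp only [ee, EE_tm]
  let Y : Fin (r + 1 + 1) → reesAlg A r M := Fin.snoc (α := fun _ => reesAlg A r M) (fun j : Fin (r + 1) => ⟨EE n x' (X j), EE_mem n hn x' _⟩)
    ⟨C x, Subalgebra.algebraMap_mem _ x⟩
  have Yc : ∀ j : Fin (r + 1), (Y j.castSucc).1 = EE n x' (X j) := fun j => by simp [Y]
  have Yl : (Y (Fin.last (r + 1))).1 = C x := by simp [Y]
  refine ⟨Y, fun i => ?_, fun i => ?_⟩
  · show constantCoeff (Y i).1 ∈ maximalIdeal A
    induction i using Fin.lastCases with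
    | last => rw [Yl]; simpa using hxm
    | cast j =>
      rw [Yc, EE_X]
      have : constantCoeff (linT (n j)) = 0 := by simp [linT]
      rw [map_add, this, zero_add, constantCoeff_C]
      simp only [x']; split_ifs
      · exact hym
      · exact zero_mem _
  · intro f hf g hgm h
    obtain ⟨p, l, hl, rfl⟩ := surj f hf
    choose q m hqm hgq using fun j => surj (g j) (hgm j)
    induction i using Fin.lastCases with
    | last =>
      have hI : Finset.Iio (Fin.last (r + 1)) = Finset.univ.map Fin.castSuccEmb := by
        ext j; simp only [Finset.mem_Iio, Finset.mem_map, Finset.mem_univ, true_and]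
        constructor
        · intro hj; exact ⟨j.castPred hj.ne, by simp⟩
        · rintro ⟨k, rfl⟩; exact Fin.castSucc_lt_last k
      rw [hI] at h ⊢
      simp only [Finset.sum_map, Fin.coe_castSuccEmb, Yc, Yl, hgq] at h ⊢
      obtain ⟨q', m', hm', heq⟩ := step_w n x' hg hx hxs hnL p l hl (fun j => q j.castSucc) (fun j => m j.castSucc) h
      refine ⟨Fin.snoc (α := fun _ => MvPolynomial (Fin r) A) (fun j => ee n x' (q' j) (m' j)) 0, fun j => ?_, ?_⟩
      · induction j using Fin.lastCases with
        | last => simp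
        | cast j => simpa using ee_mem n hn x' (q' j) (hm' j)
      · rw [heq]
        simp
    | cast i =>
      rw [← Fin.map_castSuccEmb_Iio] at h ⊢
      simp only [Finset.sum_map, Fin.coe_castSuccEmb, Yc, Yl, hgq] at h ⊢
      obtain ⟨q', m', hm', heq⟩ := step_X n x' hg (fun h => hxs (h ▸ dvd_zero _)) hnL (Finset.Iio i) i (by simp) p l hl (fun j => q j.castSucc) (fun j => m j.castSucc) h
      refine ⟨Fin.snoc (α := fun _ => MvPolynomial (Fin r) A) (fun j => ee n x' (q' j) (m' j)) 0, fun j => ?_, ?_⟩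
      · induction j using Fin.lastCases with
        | last => simp
        | cast j => simpa using ee_mem n hn x' (q' j) (hm' j)
      · rw [heq]
        simp
end
end

section
set_option linter.all false
set_option autoImplicit false
open IsLocalRing

section
variable {R : Type} [CommRing R] {E : Type} [AddCommGroup E] [Module R E]

/-- `x` is regular on `E/N` -/
def regM (N : Submodule R E) (x : R) : Prop := ∀ e, x • e ∈ N → e ∈ N

/-- `N + xE` -/
def addx (N : Submodule R E) (x : R) : Submodule R E := N ⊔ Ideal.span {x} • ⊤

lemma mem_addx {N : Submodule R E} {x : R} {e : E} : e ∈ addx N x ↔ ∃ n ∈ N, ∃ f, e = n + x • f := by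
  rw [addx, Submodule.mem_sup]
  constructor
  · rintro ⟨n, hn, z, hz, rfl⟩
    rw [Submodule.ideal_span_singleton_smul, Submodule.mem_smul_pointwise_iff_exists] at hz
    obtain ⟨f, -, rfl⟩ := hz
    exact ⟨n, hn, f, rfl⟩
  · rintro ⟨n, hn, f, rfl⟩
    exact ⟨n, hn, _, Submodule.smul_mem_smul (Ideal.mem_span_singleton_self x) Submodule.mem_top, rfl⟩

lemma addx_comm (N : Submodule R E) (x y : R) : addx (addx N x) y = addx (addx N y) x := by
  simp only [addx, sup_assoc]; rw [sup_comm (Ideal.span {x} • ⊤)]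

lemma le_addx (N : Submodule R E) (x : R) : N ≤ addx N x := le_sup_left
lemma smul_addx (N : Submodule R E) (x : R) (f : E) : x • f ∈ addx N x := mem_addx.2 ⟨0, zero_mem _, f, by simp⟩

def Dep [IsLocalRing R] : ℕ → Submodule R E → Prop
  | 0, _ => True
  | n + 1, N => ∃ x ∈ maximalIdeal R, regM N x ∧ Dep n (addx N x)

lemma assoc_set [IsNoetherianRing R] [Module.Finite R E] (N : Submodule R E) :
    ∃ s : Set (Ideal R), s.Finite ∧ (∀ P ∈ s, P.IsPrime ∧ ∃ e, e ∉ N ∧ ∀ a, a ∈ P ↔ a • e ∈ N) ∧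
      ∀ e, e ∉ N → ∃ P ∈ s, ∀ a, a • e ∈ N → a ∈ P := by
  refine ⟨associatedPrimes R (E ⧸ N), associatedPrimes.finite R _, ?_, ?_⟩
  · intro P hP
    rw [AssociatedPrimes.mem_iff, isAssociatedPrime_iff] at hP
    obtain ⟨hp, x, rfl⟩ := hP
    obtain ⟨e, rfl⟩ := Submodule.Quotient.mk_surjective N x
    refine ⟨hp, e, ?_, ?_⟩
    · intro h
      apply hp.ne_top
      rw [(Submodule.Quotient.mk_eq_zero N).2 h]
      simp
    · intro a
      rw [Submodule.mem_colon_singleton, ← Submodule.Quotient.mk_smul, Submodule.mem_bot, Submodule.Quotient.mk_eq_zero]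
  · intro e he
    obtain ⟨P, hP, hle⟩ := exists_le_isAssociatedPrime_of_isNoetherianRing R (Submodule.Quotient.mk e : E ⧸ N)
      (fun h => he ((Submodule.Quotient.mk_eq_zero N).1 h))
    refine ⟨P, hP, fun a ha => hle ?_⟩
    rw [Submodule.mem_colon_singleton, ← Submodule.Quotient.mk_smul, Submodule.mem_bot, Submodule.Quotient.mk_eq_zero]
    exact ha

lemma common_reg [IsLocalRing R] [IsNoetherianRing R] [Module.Finite R E] (t : Set (Submodule R E)) (ht : t.Finite)
    (h : ∀ N ∈ t, ∀ e, e ∉ N → ∃ w ∈ maximalIdeal R, w • e ∉ N) :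
    ∃ z ∈ maximalIdeal R, ∀ N ∈ t, regM N z := by
  choose s hs1 hs2 hs3 using fun N : Submodule R E => assoc_set N
  have hfin : (⋃ N ∈ t, s N).Finite := ht.biUnion fun N _ => hs1 N
  by_contra hcon
  push Not at hcon
  have := (Ideal.subset_union_prime_finite hfin (f := id) ⊥ ⊥ (I := maximalIdeal R) (fun P hP _ _ => by
    simp only [Set.mem_iUnion] at hP; obtain ⟨N, _, hP⟩ := hP; exact (hs2 N P hP).1)).1 (by
      intro z hz
      obtain ⟨N, hN, hr⟩ := hcon z hz
      unfold regM at hr; push Not at hr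
      obtain ⟨e, he, he'⟩ := hr
      obtain ⟨P, hP, hPa⟩ := hs3 N e he'
      simp only [Set.mem_iUnion]
      exact ⟨P, ⟨N, hN, hP⟩, hPa z he⟩)
  obtain ⟨P, hP, hle⟩ := this
  simp only [Set.mem_iUnion] at hP; obtain ⟨N, hN, hP⟩ := hP
  obtain ⟨_, e, he, hea⟩ := hs2 N P hP
  obtain ⟨w, hw, hwe⟩ := h N hN e he
  exact hwe ((hea w).1 (hle hw))

lemma regM_swap {N : Submodule R E} {x z : R} (hx : regM N x) (hz : regM (addx N x) z) : regM (addx N z) x := by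
  intro e he
  obtain ⟨n, hn, f, hf⟩ := mem_addx.1 he
  have : z • f ∈ addx N x := mem_addx.2 ⟨-n, neg_mem hn, e, by rw [hf]; abel⟩
  obtain ⟨n', hn', g, rfl⟩ := mem_addx.1 (hz f this)
  have : e - z • g ∈ N := by
    apply hx
    rw [smul_sub, hf]
    have : n + z • (n' + x • g) - x • z • g = n + z • n' := by rw [smul_add, smul_comm x z g]; abel
    rw [this]; exact add_mem hn (N.smul_mem _ hn')
  exact mem_addx.2 ⟨_, this, g, by abel⟩

lemma Dep_quot [IsLocalRing R] [IsNoetherianRing R] [Module.Finite R E] (n : ℕ) : ∀ (N : Submodule R E) (y : R),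
    Dep (n + 1) N → y ∈ maximalIdeal R → regM N y → Dep n (addx N y) := by
  induction n with
  | zero => intros; trivial
  | succ n ih =>
    rintro N y ⟨x, hx, hxr, w, hw, hwr, hD⟩ hy hyr
    have hNy : ∀ e, e ∉ addx N y → ∃ w ∈ maximalIdeal R, w • e ∉ addx N y := by
      intro e he
      by_contra hcon; push Not at hcon
      obtain ⟨n1, hn1, f, hf⟩ := mem_addx.1 (hcon x hx)
      obtain ⟨n2, hn2, g, hg⟩ := mem_addx.1 (hcon w hw)
      have h1 : w • f - x • g ∈ N := by
        apply hyr
        have : y • (w • f - x • g) = x • n2 - w • n1 := by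
          have e1 : w • (x • e) = w • n1 + w • y • f := by rw [hf, smul_add]
          have e2 : x • (w • e) = x • n2 + x • y • g := by rw [hg, smul_add]
          rw [smul_comm w x e, e2] at e1
          rw [smul_sub, smul_comm y w, smul_comm y x, sub_eq_sub_iff_add_eq_add, add_comm, ← e1]
        rw [this]; exact sub_mem (N.smul_mem _ hn2) (N.smul_mem _ hn1)
      have h2 : f ∈ addx N x := hwr f (mem_addx.2 ⟨_, h1, g, by abel⟩)
      obtain ⟨n3, hn3, h, rfl⟩ := mem_addx.1 h2
      have h3 : e - y • h ∈ N := by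
        apply hxr
        have : x • (e - y • h) = n1 + y • n3 := by rw [smul_sub, hf, smul_add, smul_comm y x h]; abel
        rw [this]; exact add_mem hn1 (N.smul_mem _ hn3)
      exact he (mem_addx.2 ⟨_, h3, h, by abel⟩)
    obtain ⟨z, hz, hzr⟩ := common_reg {N, addx N x, addx N y} (by simp) (by
      intro N' hN'
      simp only [Set.mem_insert_iff, Set.mem_singleton_iff] at hN'
      rcases hN' with rfl | rfl | rfl
      · exact fun e he => ⟨x, hx, fun h => he (hxr e h)⟩
      · exact fun e he => ⟨w, hw, fun h => he (hwr e h)⟩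
      · exact hNy)
    have z1 := hzr N (by simp)
    have z2 := hzr (addx N x) (by simp)
    have z3 := hzr (addx N y) (by simp)
    have h1 : Dep n (addx (addx N x) z) := ih _ z ⟨w, hw, hwr, hD⟩ hz z2
    have h2 : Dep (n + 1) (addx N z) := ⟨x, hx, regM_swap hxr z2, by rw [addx_comm]; exact h1⟩
    have h3 := ih _ y h2 hy (regM_swap hyr z3)
    exact ⟨z, hz, z3, by rw [addx_comm]; exact h3⟩

lemma Dep_dim [IsLocalRing R] [IsNoetherianRing R] [Module.Finite R E] (n : ℕ) : ∀ (N : Submodule R E) (P : Ideal R)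
    (e : E), Dep n N → P.IsPrime → e ∉ N → (∀ a, a ∈ P ↔ a • e ∈ N) → (n : WithBot ℕ∞) ≤ ringKrullDim (R ⧸ P) := by
  induction n with
  | zero =>
    intro N P e _ hP _ _
    haveI : Nontrivial (R ⧸ P) := Ideal.Quotient.nontrivial_iff.2 hP.ne_top
    simpa using ringKrullDim_nonneg_of_nontrivial
  | succ n ih =>
    rintro N P e ⟨x, hx, hxr, hD⟩ hP he hPe
    let E' : Submodule R E := ⨅ a : P, N.comap (DistribSMul.toLinearMap R E a.1)
    have hE' : ∀ f, f ∈ E' ↔ ∀ a ∈ P, a • f ∈ N := by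
      intro f; simp [E', Submodule.mem_iInf]
    have hex : ∃ f ∈ E', f ∉ addx N x := by
      by_contra hcon; push Not at hcon
      have : E' ≤ N ⊔ maximalIdeal R • E' := by
        intro f hf
        obtain ⟨n, hn, g, rfl⟩ := mem_addx.1 (hcon f hf)
        refine Submodule.add_mem_sup hn (Submodule.smul_mem_smul hx ((hE' g).2 fun a ha => hxr _ ?_))
        have := (hE' _).1 hf a ha
        rw [smul_add, smul_comm a x] at this
        exact (N.add_mem_iff_right (N.smul_mem a hn)).1 this
      have hle := Submodule.le_of_le_smul_of_le_jacobson_bot (IsNoetherian.noetherian E')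
        (IsLocalRing.jacobson_eq_maximalIdeal _ bot_ne_top).ge this
      exact he (hle ((hE' e).2 fun a ha => (hPe a).1 ha))
    obtain ⟨f, hf, hfx⟩ := hex
    obtain ⟨s, -, hs2, hs3⟩ := assoc_set (addx N x)
    obtain ⟨Q, hQs, hQ⟩ := hs3 f hfx
    obtain ⟨hQp, e', he', hQe'⟩ := hs2 Q hQs
    have hPQ : P ≤ Q := fun a ha => hQ a (le_addx N x ((hE' f).1 hf a ha))
    have hxQ : x ∈ Q := (hQe' x).2 (smul_addx N x e')
    have hxP : x ∉ P := fun h => he (hxr e ((hPe x).1 h))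
    have h1 := ih _ Q e' hD hQp he' hQe'
    have h2 := ringKrullDim_quotient_succ_le_of_nonZeroDivisor (R := R ⧸ P) (r := Ideal.Quotient.mk P x)
      (mem_nonZeroDivisors_of_ne_zero fun h => hxP (Ideal.Quotient.eq_zero_iff_mem.1 h))
    have h3 : ringKrullDim (R ⧸ Q) ≤ ringKrullDim ((R ⧸ P) ⧸ Ideal.span {Ideal.Quotient.mk P x}) := by
      refine ringKrullDim_le_of_surjective (Ideal.Quotient.lift _ (Ideal.Quotient.factor hPQ) ?_) ?_
      · intro a ha
        obtain ⟨b, rfl⟩ := Ideal.mem_span_singleton'.1 ha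
        rw [map_mul, Ideal.Quotient.factor_mk, Ideal.Quotient.eq_zero_iff_mem.2 hxQ, mul_zero]
      · intro b
        obtain ⟨a, rfl⟩ := Ideal.Quotient.mk_surjective b
        exact ⟨Ideal.Quotient.mk _ (Ideal.Quotient.mk _ a), rfl⟩
    refine le_trans ?_ h2
    push_cast
    gcongr
    exact h1.trans h3

end
end

section
set_option linter.all false
set_option autoImplicit false
open IsLocalRing

section
variable {R : Type} [CommRing R] {E : Type} [AddCommGroup E] [Module R E]

lemma mem_span_smul_top {ι : Type} [DecidableEq ι] (y : ι → R) (s : Finset ι) (e : E) :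
    e ∈ (Ideal.span (y '' (s : Set ι)) • ⊤ : Submodule R E) ↔ ∃ g : ι → E, e = ∑ j ∈ s, y j • g j := by
  constructor
  · intro he
    induction he using Submodule.smul_induction_on' with
    | smul a ha n hn =>
      rw [Ideal.span, Submodule.mem_span_image_finset_iff_exists_fun] at ha
      obtain ⟨c, rfl⟩ := ha
      refine ⟨fun j => if h : j ∈ s then c ⟨j, h⟩ • n else 0, ?_⟩
      rw [Finset.sum_smul, ← Finset.sum_coe_sort s]
      exact Finset.sum_congr rfl fun j _ => by rw [smul_eq_mul, mul_comm, mul_smul]; simp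
    | add x hx y hy ihx ihy =>
      obtain ⟨g, rfl⟩ := ihx
      obtain ⟨h, rfl⟩ := ihy
      exact ⟨fun j => g j + h j, by simp [Finset.sum_add_distrib]⟩
  · rintro ⟨g, rfl⟩
    exact sum_mem fun j hj => Submodule.smul_mem_smul (Ideal.subset_span ⟨j, hj, rfl⟩) trivial

def NS {d : ℕ} (E : Type) [AddCommGroup E] [Module R E] (y : Fin d → R) (k : ℕ) : Submodule R E :=
  Ideal.span (y '' {j | j.val < k}) • ⊤

lemma NS_zero {d : ℕ} (y : Fin d → R) : NS E y 0 = ⊥ := by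
  simp [NS]

lemma NS_succ {d : ℕ} (y : Fin d → R) (k : Fin d) : NS E y (k.val + 1) = addx (NS E y k.val) (y k) := by
  have : {j : Fin d | j.val < k.val + 1} = insert k {j | j.val < k.val} := by
    ext j; simp only [Set.mem_setOf_eq, Set.mem_insert_iff, Fin.ext_iff]; omega
  rw [NS, this, Set.image_insert_eq, Ideal.span_insert, Submodule.sup_smul, addx, sup_comm]; rfl

lemma mem_NS {d : ℕ} (y : Fin d → R) (k : Fin d) (e : E) :
    e ∈ NS E y k.val ↔ ∃ g : Fin d → E, e = ∑ j ∈ Finset.Iio k, y j • g j := by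
  rw [← mem_span_smul_top, NS]
  have : {j : Fin d | j.val < k.val} = ((Finset.Iio k : Finset (Fin d)) : Set (Fin d)) := by
    ext j; simp
  rw [this]

lemma Dep_of_seq [IsLocalRing R] {d : ℕ} (y : Fin d → R) (hy : ∀ i, y i ∈ maximalIdeal R)
    (h : ∀ i : Fin d, regM (NS E y i.val) (y i)) : Dep d (⊥ : Submodule R E) := by
  have : ∀ n k, n + k = d → Dep n (NS E y k) := by
    intro n
    induction n with
    | zero => intros; trivial
    | succ n ih =>
      intro k hk
      let i : Fin d := ⟨k, by omega⟩
      refine ⟨y i, hy i, h i, ?_⟩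
      have := ih (k + 1) (by omega)
      rw [← NS_succ y i]; exact this
  rw [← NS_zero y]; exact this d 0 rfl

lemma Dep_mono [IsLocalRing R] (n m : ℕ) (N : Submodule R E) (h : n ≤ m) (hD : Dep m N) : Dep n N := by
  induction n generalizing m N with
  | zero => trivial
  | succ n ih =>
    obtain ⟨m, rfl⟩ : ∃ m', m = m' + 1 := ⟨m - 1, by omega⟩
    obtain ⟨x, hx, hr, hD⟩ := hD
    exact ⟨x, hx, hr, ih m _ (by omega) hD⟩

lemma dim_quot_lt [IsLocalRing R] [IsNoetherianRing R] {d : ℕ} (x : Fin d → R) (hx : ∀ i, x i ∈ maximalIdeal R)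
    (hrad : maximalIdeal R ≤ (Ideal.span (Set.range x)).radical) (k : Fin d) (P : Ideal R) [P.IsPrime]
    (hP : ∀ j ≤ k, x j ∈ P) : ringKrullDim (R ⧸ P) ≤ ((d - (k.val + 1) : ℕ) : WithBot ℕ∞) := by
  classical
  haveI : Nontrivial (R ⧸ P) := Ideal.Quotient.nontrivial_iff.2 (Ideal.IsPrime.ne_top ‹_›)
  haveI : IsLocalRing (R ⧸ P) := IsLocalRing.of_surjective' (Ideal.Quotient.mk P) Ideal.Quotient.mk_surjective
  let s : Finset (R ⧸ P) := (Finset.Ioi k).image fun j => Ideal.Quotient.mk P (x j)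
  have hc : s.card ≤ d - (k.val + 1) := by
    refine Finset.card_image_le.trans ?_
    simp; omega
  have hmk : ∀ a ∈ maximalIdeal R, Ideal.Quotient.mk P a ∈ maximalIdeal (R ⧸ P) := by
    intro a ha
    rw [mem_maximalIdeal, mem_nonunits_iff]
    intro hu
    obtain ⟨b, hb⟩ := hu.exists_right_inv
    obtain ⟨b, rfl⟩ := Ideal.Quotient.mk_surjective b
    rw [← map_mul, ← map_one (Ideal.Quotient.mk P), Ideal.Quotient.mk_eq_mk_iff_sub_mem] at hb
    have h2 := IsLocalRing.le_maximalIdeal (Ideal.IsPrime.ne_top ‹P.IsPrime›) hb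
    apply (maximalIdeal.isMaximal R).ne_top
    rw [Ideal.eq_top_iff_one]
    have := sub_mem (Ideal.mul_mem_right b _ ha) h2
    simpa using this
  have hmin : maximalIdeal (R ⧸ P) ∈ (Ideal.span (s : Set (R ⧸ P))).minimalPrimes := by
    refine ⟨⟨inferInstance, ?_⟩, ?_⟩
    · rw [Ideal.span_le]
      intro z hz
      simp only [s, Finset.coe_image, Set.mem_image] at hz
      obtain ⟨j, -, rfl⟩ := hz
      exact hmk _ (hx j)
    · rintro Q ⟨hQ, hle⟩ -
      intro z hz
      obtain ⟨a, rfl⟩ := Ideal.Quotient.mk_surjective z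
      have ha : a ∈ maximalIdeal R := by
        by_contra hu
        rw [mem_maximalIdeal, mem_nonunits_iff, not_not] at hu
        exact hz (hu.map _)
      obtain ⟨n, hn⟩ := hrad ha
      have h1 : Ideal.span (Set.range x) ≤ Q.comap (Ideal.Quotient.mk P) := by
        rw [Ideal.span_le]
        rintro _ ⟨j, rfl⟩
        by_cases hj : j ≤ k
        · show Ideal.Quotient.mk P (x j) ∈ Q
          rw [Ideal.Quotient.eq_zero_iff_mem.2 (hP j hj)]; exact zero_mem _
        · exact hle (Ideal.subset_span (by
            simp only [s, Finset.coe_image]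
            exact ⟨j, by simpa using hj, rfl⟩))
      have := h1 hn
      rw [Ideal.mem_comap, map_pow] at this
      exact hQ.mem_of_pow_mem _ this
  have := Ideal.height_le_card_of_mem_minimalPrimes_span_finset hmin
  rw [← IsLocalRing.maximalIdeal_height_eq_ringKrullDim]
  refine le_trans (WithBot.coe_le_coe.2 this) ?_
  exact WithBot.coe_le_coe.2 (Nat.cast_le.2 hc)

theorem sop_regular [IsLocalRing R] [IsNoetherianRing R] [Module.Finite R E] {d : ℕ} (hD : Dep d (⊥ : Submodule R E))
    (x : Fin d → R) (hx : ∀ i, x i ∈ maximalIdeal R) (hrad : maximalIdeal R ≤ (Ideal.span (Set.range x)).radical)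
    (i : Fin d) : regM (NS E x i.val) (x i) := by
  have key : ∀ k : Fin d, Dep (d - k.val) (NS E x k.val) → regM (NS E x k.val) (x k) := by
    intro k hk e he
    by_contra hcon
    obtain ⟨s, -, hs2, hs3⟩ := assoc_set (NS E x k.val)
    obtain ⟨P, hPs, hP⟩ := hs3 e hcon
    obtain ⟨hPp, e', he', hPe'⟩ := hs2 P hPs
    have h1 := Dep_dim _ _ P e' hk hPp he' hPe'
    have h2 := dim_quot_lt x hx hrad k P (fun j hj => by
      rcases hj.lt_or_eq with hj | rfl
      · exact (hPe' _).2 (Submodule.smul_mem_smul (Ideal.subset_span ⟨j, hj, rfl⟩) trivial)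
      · exact hP _ he)
    have h3 := h1.trans h2
    have h4 : d - k.val ≤ d - (k.val + 1) := by exact_mod_cast h3
    omega
  have hDk : ∀ k, k ≤ d → Dep (d - k) (NS E x k) := by
    intro k
    induction k with
    | zero => intro _; rw [NS_zero]; exact hD
    | succ k ih =>
      intro hk
      let i : Fin d := ⟨k, by omega⟩
      have h1 := ih (by omega)
      have h2 := key i h1
      rw [NS_succ x i]
      refine Dep_quot _ _ _ ?_ (hx i) h2
      have : d - (k + 1) + 1 = d - k := by omega
      rw [this]; exact h1
  exact key i (hDk i.val i.2.le)

/-- Localizing a regular sequence. -/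
theorem Dep_localized {R : Type} [CommRing R] (Q : Ideal R) [Q.IsPrime] (T : Type) [AddCommGroup T] [Module R T]
    {n : ℕ} (y : Fin n → R) (hy : ∀ i, y i ∈ Q)
    (h : ∀ i, ∀ (f : T) (g : Fin n → T), y i • f = ∑ j ∈ Finset.Iio i, y j • g j → ∃ g' : Fin n → T, f = ∑ j ∈ Finset.Iio i, y j • g' j) :
    Dep n (⊥ : Submodule (Localization.AtPrime Q) (LocalizedModule Q.primeCompl T)) := by
  classical
  let φ := LocalizedModule.mkLinearMap Q.primeCompl T
  refine Dep_of_seq (fun i => algebraMap R (Localization.AtPrime Q) (y i)) (fun i => ?_) (fun i e he => ?_)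
  · exact (IsLocalization.AtPrime.to_map_mem_maximal_iff (Localization.AtPrime Q) Q (y i)).2 (hy i)
  · rw [mem_NS] at he ⊢
    obtain ⟨g, hg⟩ := he
    simp only [algebraMap_smul] at hg ⊢
    obtain ⟨⟨f, s⟩, hf⟩ := IsLocalizedModule.surj Q.primeCompl φ e
    choose hs hhs using fun j => IsLocalizedModule.surj Q.primeCompl φ (g j)
    let S : Q.primeCompl := ∏ j, (hs j).2
    have hS : ∀ j, ∃ t : T, S.1 • g j = φ t := by
      intro j
      have : S = (∏ i ∈ Finset.univ.erase j, (hs i).2) * (hs j).2 := by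
        rw [mul_comm]; exact (Finset.mul_prod_erase _ _ (Finset.mem_univ j)).symm
      refine ⟨(∏ i ∈ Finset.univ.erase j, (hs i).2).1 • (hs j).1, ?_⟩
      rw [this, Submonoid.coe_mul, mul_smul, map_smul, ← hhs j]; rfl
    choose t ht using hS
    have e1 : φ (y i • S.1 • f) = φ (∑ j ∈ Finset.Iio i, y j • s.1 • t j) := by
      simp only [map_sum, map_smul, ← ht]
      have : φ f = s.1 • e := hf.symm
      rw [this, smul_comm S.1, smul_comm (y i), smul_comm (y i) S.1, hg, Finset.smul_sum, Finset.smul_sum]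
      refine Finset.sum_congr rfl fun j _ => ?_
      rw [smul_comm (S.1) (y j), smul_comm s.1 (y j)]
    obtain ⟨c, hc⟩ := IsLocalizedModule.exists_of_eq (S := Q.primeCompl) e1
    have e2 : y i • (c.1 • S.1 • f) = ∑ j ∈ Finset.Iio i, y j • (c.1 • s.1 • t j) := by
      rw [smul_comm (y i) c.1]
      refine hc.trans ?_
      rw [Submonoid.smul_def, Finset.smul_sum]
      exact Finset.sum_congr rfl fun j _ => smul_comm _ _ _
    obtain ⟨g', hg'⟩ := h i _ _ e2
    let u : Q.primeCompl := c * S * s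
    have hu : φ (c.1 • S.1 • f) = u.1 • e := by
      have : φ f = s.1 • e := hf.symm
      rw [map_smul, map_smul, this]; simp [u, mul_smul]
    refine ⟨fun j => IsLocalization.mk' (Localization.AtPrime Q) 1 u • φ (g' j), ?_⟩
    have : e = IsLocalization.mk' (Localization.AtPrime Q) 1 u • (u.1 • e) := by
      rw [← algebraMap_smul (Localization.AtPrime Q) u.1 e, ← mul_smul, IsLocalization.mk'_spec, map_one, one_smul]
    rw [this, ← hu, hg', map_sum, Finset.smul_sum]
    refine Finset.sum_congr rfl fun j _ => ?_
    rw [map_smul, smul_comm]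
end
end

section
set_option linter.all false
set_option autoImplicit false
open IsLocalRing

section
theorem buchs_of_ext {R : Type} [CommRing R] [IsNoetherianRing R] (Q : Ideal R) [Q.IsPrime] (T : Type) [AddCommGroup T] [Module R T]
    [Module.Finite R T] (one : T) (hinj : ∀ a : R, a • one = 0 → a = 0)
    (hQ : ∀ a ∈ Q, ∀ t : T, ∃ b : R, a • t = b • one)
    {n : ℕ} (y : Fin n → R) (hy : ∀ i, y i ∈ Q)
    (h : ∀ i, ∀ (f : T) (g : Fin n → T), y i • f = ∑ j ∈ Finset.Iio i, y j • g j → ∃ g' : Fin n → T, f = ∑ j ∈ Finset.Iio i, y j • g' j)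
    (hd : ringKrullDim (Localization.AtPrime Q) ≤ n) : IsBuchsbaumLocalRing (Localization.AtPrime Q) := by
  classical
  intro d hdd x hx hrad i
  let φ := LocalizedModule.mkLinearMap Q.primeCompl T
  let O := Localization.AtPrime Q
  haveI : IsNoetherianRing (Localization.AtPrime Q) := IsLocalization.isNoetherianRing Q.primeCompl _ inferInstance
  haveI : Module.Finite (Localization.AtPrime Q) (LocalizedModule Q.primeCompl T) :=
    Module.Finite.of_isLocalizedModule Q.primeCompl φ
  have hdn : d ≤ n := by
    rw [hdd] at hd; exact_mod_cast hd
  have hD := Dep_mono d n _ hdn (Dep_localized Q T y hy h)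
  have hreg := sop_regular hD x hx hrad i
  have inj : ∀ a : Localization.AtPrime Q, a • φ one = 0 → a = 0 := by
    intro a ha
    obtain ⟨p, s, rfl⟩ := IsLocalization.exists_mk'_eq Q.primeCompl a
    have h1 : φ (p • one) = φ 0 := by
      rw [map_zero, map_smul]
      have := congrArg (fun z => s.1 • z) ha
      simp only [smul_zero] at this
      rw [← algebraMap_smul (Localization.AtPrime Q) s.1, ← mul_smul, mul_comm, IsLocalization.mk'_spec, algebraMap_smul] at this
      exact this
    obtain ⟨c, hc⟩ := IsLocalizedModule.exists_of_eq (S := Q.primeCompl) h1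
    rw [smul_zero, Submonoid.smul_def, ← mul_smul] at hc
    have := hinj _ hc
    rw [IsLocalization.mk'_eq_zero_iff]
    exact ⟨c, this⟩
  have hmax : ∀ w ∈ maximalIdeal (Localization.AtPrime Q), ∀ e : LocalizedModule Q.primeCompl T, ∃ b : Localization.AtPrime Q, w • e = b • φ one := by
    intro w hw e
    obtain ⟨p, s, rfl⟩ := IsLocalization.exists_mk'_eq Q.primeCompl w
    have hp : p ∈ Q := (IsLocalization.AtPrime.mk'_mem_maximal_iff (Localization.AtPrime Q) Q p s).1 hw
    obtain ⟨⟨t, u⟩, ht⟩ := IsLocalizedModule.surj Q.primeCompl φ e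
    obtain ⟨b, hb⟩ := hQ p hp t
    refine ⟨IsLocalization.mk' _ b (s * u), ?_⟩
    have e1 : e = IsLocalization.mk' (Localization.AtPrime Q) 1 u • φ t := by
      have : φ t = u.1 • e := ht.symm
      rw [this, ← algebraMap_smul (Localization.AtPrime Q) u.1 e, ← mul_smul, IsLocalization.mk'_spec, map_one, one_smul]
    have e2 : ∀ z : R, (IsLocalization.mk' (Localization.AtPrime Q) z (s * u)) = IsLocalization.mk' (Localization.AtPrime Q) 1 (s * u) * algebraMap R _ z := by
      intro z; rw [mul_comm (IsLocalization.mk' _ _ _), IsLocalization.mul_mk'_eq_mk'_of_mul, mul_one]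
    rw [e1, ← mul_smul, ← IsLocalization.mk'_mul, mul_one, e2 p, e2 b, mul_smul, mul_smul, algebraMap_smul, algebraMap_smul, ← φ.map_smul p t, ← φ.map_smul b one, hb]
  have hset : x '' {j | j < i} = x '' ((Finset.Iio i : Finset (Fin d)) : Set (Fin d)) := by
    congr 1; ext j; simp
  intro a ha
  rw [Submodule.mem_colon] at ha ⊢
  have h1 := ha (x i) (Ideal.mem_span_singleton_self _)
  rw [hset, Ideal.span, Submodule.mem_span_image_finset_iff_exists_fun] at h1
  obtain ⟨c, hc⟩ := h1
  have h2 : x i • (a • φ one) ∈ NS (LocalizedModule Q.primeCompl T) x i.val := by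
    rw [mem_NS]
    refine ⟨fun j => if hj : j ∈ Finset.Iio i then c ⟨j, hj⟩ • φ one else 0, ?_⟩
    rw [← mul_smul, mul_comm, ← smul_eq_mul, ← hc, ← Finset.sum_coe_sort (Finset.Iio i), Finset.sum_smul]
    refine Finset.sum_congr rfl fun j _ => ?_
    rw [smul_eq_mul, mul_comm, mul_smul]; simp only [dif_pos j.2]
  have h3 := hreg _ h2
  rw [mem_NS] at h3
  obtain ⟨g, hg⟩ := h3
  intro w hw
  choose b hb using fun j => hmax w hw (g j)
  have h4 : a • w = ∑ j ∈ Finset.Iio i, x j * b j := by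
    rw [← sub_eq_zero]
    apply inj
    rw [sub_smul, smul_eq_mul, mul_comm a w, mul_smul, hg, Finset.smul_sum, Finset.sum_smul, sub_eq_zero]
    refine Finset.sum_congr rfl fun j _ => ?_
    rw [smul_comm, hb, mul_smul]
  rw [h4]
  exact sum_mem fun j hj => Ideal.mul_mem_right _ _ (Ideal.subset_span ⟨j, by simpa using hj, rfl⟩)
end
end

section
set_option linter.all false
set_option autoImplicit false
open MvPolynomial IsLocalRing

section
lemma loc_normal_iff {R S : Type} [CommRing R] [CommRing S] [IsDomain R] [IsDomain S] [Algebra R S]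
    (hinj : Function.Injective (algebraMap R S)) (hfrac : ∀ s : S, ∃ a : R, a ≠ 0 ∧ ∃ b : R, algebraMap R S a * s = algebraMap R S b)
    [IsIntegrallyClosed S] (P : Ideal R) [P.IsPrime] :
    IsIntegrallyClosed (Localization.AtPrime P) ↔
      ∀ t : S, IsIntegral R t → ∃ s : R, s ∉ P ∧ ∃ b : R, algebraMap R S s * t = algebraMap R S b := by
  let K := FractionRing S
  have hSK : Function.Injective (algebraMap S K) := IsFractionRing.injective S K
  have hRK : Function.Injective (algebraMap R K) := by
    rw [IsScalarTower.algebraMap_eq R S K]; exact hSK.comp hinj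
  haveI hfr : IsFractionRing R K := by
    refine ⟨?_, ?_, ?_⟩
    · rintro ⟨y, hy⟩
      have : y ≠ 0 := nonZeroDivisors.ne_zero hy
      exact ((map_ne_zero_iff _ hRK).2 this).isUnit
    · intro z
      obtain ⟨p, q, hq, rfl⟩ := IsFractionRing.div_surjective (A := S) z
      have hq0 : q ≠ 0 := nonZeroDivisors.ne_zero hq
      obtain ⟨a, ha, b, hb⟩ := hfrac p
      obtain ⟨c, hc, d, hd⟩ := hfrac q
      have hd0 : d ≠ 0 := by
        rintro rfl
        rw [map_zero] at hd
        rcases mul_eq_zero.1 hd with h | h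
        · exact hc ((map_eq_zero_iff _ hinj).1 h)
        · exact hq0 h
      refine ⟨(b * c, ⟨a * d, mem_nonZeroDivisors_of_ne_zero (mul_ne_zero ha hd0)⟩), ?_⟩
      have h1 : algebraMap S K q ≠ 0 := (map_ne_zero_iff _ hSK).2 hq0
      simp only [map_mul]
      simp only [IsScalarTower.algebraMap_apply R S K, ← hb, ← hd, map_mul]
      rw [div_mul_eq_mul_div, div_eq_iff h1]; ring
    · intro x y h
      exact ⟨1, by rw [hRK h]⟩
  have hu : ∀ y : P.primeCompl, IsUnit (algebraMap R K y) := by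
    intro y
    refine ((map_ne_zero_iff _ hRK).2 ?_).isUnit
    rintro h; exact y.2 (h ▸ zero_mem _)
  letI : Algebra (Localization.AtPrime P) K := (IsLocalization.lift (S := Localization.AtPrime P) hu).toAlgebra
  haveI : IsScalarTower R (Localization.AtPrime P) K := IsScalarTower.of_algebraMap_eq fun x => by
    rw [RingHom.algebraMap_toAlgebra, IsLocalization.lift_eq]
  haveI : IsFractionRing (Localization.AtPrime P) K :=
    IsFractionRing.isFractionRing_of_isDomain_of_isLocalization P.primeCompl _ K
  rw [isIntegrallyClosed_iff K]
  constructor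
  · intro h t ht
    have h1 : IsIntegral (Localization.AtPrime P) (algebraMap S K t) := by
      have : IsIntegral R (algebraMap S K t) := ht.algebraMap
      exact this.tower_top
    obtain ⟨y, hy⟩ := h h1
    obtain ⟨b, s, rfl⟩ := IsLocalization.exists_mk'_eq P.primeCompl y
    refine ⟨s.1, s.2, b, hSK ?_⟩
    rw [map_mul, ← hy, ← IsScalarTower.algebraMap_apply, ← IsScalarTower.algebraMap_apply,
      IsScalarTower.algebraMap_apply R (Localization.AtPrime P) K s.1, ← map_mul, mul_comm, IsLocalization.mk'_spec,
      ← IsScalarTower.algebraMap_apply]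
  · intro h z hz
    obtain ⟨m, hm⟩ := IsIntegral.exists_multiple_integral_of_isLocalization P.primeCompl z hz
    have h1 : IsIntegral S (m • z) := hm.tower_top
    obtain ⟨t, ht⟩ := IsIntegrallyClosed.isIntegral_iff.1 h1
    have h2 : IsIntegral R t := by
      rw [← isIntegral_algebraMap_iff hSK, ht]; exact hm
    obtain ⟨s, hs, b, hb⟩ := h t h2
    let sm : P.primeCompl := ⟨s, hs⟩ * m
    refine ⟨IsLocalization.mk' _ b sm, ?_⟩
    have h3 : algebraMap R K sm.1 ≠ 0 := (hu sm).ne_zero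
    apply mul_left_cancel₀ h3
    rw [IsScalarTower.algebraMap_apply R (Localization.AtPrime P) K sm.1, ← map_mul, mul_comm, IsLocalization.mk'_spec,
      ← IsScalarTower.algebraMap_apply, ← IsScalarTower.algebraMap_apply]
    have : algebraMap R K sm.1 * z = algebraMap R K s * (m • z) := by
      rw [Submonoid.smul_def, Algebra.smul_def]; simp [sm, mul_assoc]
    rw [this, ← ht, IsScalarTower.algebraMap_apply R S K b, ← hb, map_mul, ← IsScalarTower.algebraMap_apply]
end

section
variable {A : Type} [CommRing A] {r : ℕ} {M : Submodule A (Fin r → A)}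

lemma mem_bar1 {x : MvPolynomial (Fin r) A} : x ∈ barPow A r M 1 ↔ x.IsHomogeneous 1 ∧ x ∈ intClAlg A r M := by
  rw [barPow, Submodule.mem_inf, freeSub_pow_eq, mem_homogeneousSubmodule]; rfl

lemma sub1_le_bar : sub1 A r M ≤ barPow A r M 1 := by
  intro x hx
  have hx1 : x ∈ sub1 A r M ^ 1 := by rwa [pow_one]
  exact mem_bar1.2 ⟨pow_hom hx1, rees_le_intCl (pow_le_rees 1 hx1)⟩

lemma three_pow (h3 : sub1 A r M * barPow A r M 1 = sub1 A r M ^ 2) (n : ℕ) :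
    sub1 A r M ^ (n + 1) * barPow A r M 1 = sub1 A r M ^ (n + 2) := by
  rw [pow_succ, mul_assoc, h3, ← pow_add]

theorem rb_decomp [IsLocalRing A] [IsNoetherianRing A] [IsDomain A] (hdim : ringKrullDim A = 2)
    (hreg : ∃ x y : A, Ideal.span {x, y} = maximalIdeal A) (hres : Infinite (ResidueField A))
    (hM0 : M ≠ ⊥) (hs : ∃ s, ∀ a ∈ maximalIdeal A ^ s, ∀ f, a • f ∈ M)
    (h3 : sub1 A r M * barPow A r M 1 = sub1 A r M ^ 2) (g : MvPolynomial (Fin r) A) (hg : g ∈ intClAlg A r M) :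
    ∃ q ∈ reesAlg A r M, ∃ l ∈ barPow A r M 1, g = q + l := by
  classical
  obtain ⟨n, hn, -, hcore⟩ := core_M hdim hreg hres hM0 hs
  obtain ⟨p, lam, hlam, rfl⟩ := hcore g (mem_intCl.1 hg)
  let s := Finset.univ.biUnion fun k => (lam k).support
  have h1 : ∀ k, lam k = ∑ β ∈ s, monomial β (1 : A) * C ((lam k).coeff β) := by
    intro k
    conv_lhs => rw [(lam k).as_sum]
    rw [Finset.sum_subset (Finset.subset_biUnion_of_mem (fun k => (lam k).support) (Finset.mem_univ k))]
    · exact Finset.sum_congr rfl fun β _ => by rw [mul_comm, C_mul_monomial, mul_one]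
    · intro β _ hβ; rw [notMem_support_iff.1 hβ, map_zero]
  have hC : ∀ a : A, evT n (C a) = C a := fun a => by simp [evT]
  have h2 : ∑ k, evT n (lam k) * X k = ∑ β ∈ s, evT n (monomial β 1) * linT (fun k => (lam k).coeff β) := by
    calc _ = ∑ k, evT n (∑ β ∈ s, monomial β (1 : A) * C ((lam k).coeff β)) * X k :=
          Finset.sum_congr rfl fun k _ => by rw [← h1 k]
      _ = _ := by
        simp only [map_sum, map_mul, hC, Finset.sum_mul, linT, Finset.mul_sum]
        rw [Finset.sum_comm]
        exact Finset.sum_congr rfl fun k _ => Finset.sum_congr rfl fun j _ => by ring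
  let D : Submodule A (MvPolynomial (Fin r) A) := Subalgebra.toSubmodule (reesAlg A r M) ⊔ barPow A r M 1
  have hmem : evT n p + ∑ k, evT n (lam k) * X k ∈ D := by
    rw [h2]
    refine add_mem (Submodule.mem_sup_left (evT_range_le n hn ⟨p, rfl⟩)) (sum_mem fun β _ => ?_)
    have hl : linT (fun k => (lam k).coeff β) ∈ barPow A r M 1 := mem_bar1.2 ⟨linT_hom _, mem_intCl.2 (hlam β)⟩
    by_cases hβ : β = 0
    · subst hβ
      refine Submodule.mem_sup_right ?_
      have : evT n (monomial 0 (1 : A)) = 1 := by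
        rw [← C_apply, hC, C_1]
      rw [this, one_mul]; exact hl
    · refine Submodule.mem_sup_left ?_
      obtain ⟨j, hj⟩ := Finsupp.ne_iff.1 hβ
      have : monomial β (1 : A) = monomial (β - Finsupp.single j 1) 1 * X j := by
        rw [X, monomial_mul, mul_one, tsub_add_cancel_of_le]
        rw [Finsupp.single_le_iff]
        exact Nat.one_le_iff_ne_zero.2 hj
      rw [this, map_mul, evT_X, mul_assoc]
      refine (reesAlg A r M).mul_mem (evT_range_le n hn ⟨_, rfl⟩) (pow_le_rees 2 ?_)
      rw [← h3]
      exact Submodule.mul_mem_mul (linT_mem_sub1 (hn j)) hl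
  obtain ⟨q, hq, l, hl, e⟩ := Submodule.mem_sup.1 hmem
  exact ⟨q, hq, l, hl, e.symm⟩

lemma bar_hom_eq {n : ℕ} (hn : 2 ≤ n) {x q l : MvPolynomial (Fin r) A} (hx : x.IsHomogeneous n) (hq : q ∈ reesAlg A r M)
    (hl : l.IsHomogeneous 1) (e : x = q + l) : x ∈ sub1 A r M ^ n := by
  have h1 := congrArg (homogeneousComponent n) e
  rw [map_add, homogeneousComponent_of_mem hx, if_pos rfl, homogeneousComponent_of_mem hl, if_neg (by omega), add_zero] at h1
  rw [h1]; exact hc_mem hq n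

lemma gmax_mul_rees [IsLocalRing A] (h3a : (maximalIdeal A) • (barPow A r M 1) ≤ sub1 A r M)
    (h3 : sub1 A r M * barPow A r M 1 = sub1 A r M ^ 2) (a : reesAlg A r M) (ha : a ∈ gradedMax A r M)
    {l : MvPolynomial (Fin r) A} (hl : l ∈ barPow A r M 1) : a.1 * l ∈ reesAlg A r M := by
  rw [← sum_homogeneousComponent a.1, Finset.sum_mul]
  refine sum_mem fun i _ => ?_
  have h1 := hc_mem a.2 i
  cases i with
  | zero =>
    rw [homogeneousComponent_zero, C_mul']
    have h2 : coeff 0 a.1 • l ∈ sub1 A r M := h3a (Submodule.smul_mem_smul ha hl)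
    exact pow_le_rees 1 (by rwa [pow_one])
  | succ i =>
    refine pow_le_rees (i + 2) ?_
    rw [← three_pow h3]
    exact Submodule.mul_mem_mul h1 hl

lemma rr_le_bar [IsNoetherianRing A] [IsDomain A] (hM0 : M ≠ ⊥) :
    ratliffRush A r (freeSub A r) (sub1 A r M) ≤ barPow A r M 1 := by
  refine iSup_le fun ℓ x hx => ?_
  obtain ⟨hx1, hx2⟩ := hx
  refine mem_bar1.2 ⟨?_, mem_intCl.2 (int_of_stable (reesAlg A r M) (sub1 A r M ^ (ℓ + 1)) ((sub1_fg M).pow _) (pow_ne_bot hM0 _) x ?_)⟩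
  · rw [SetLike.mem_coe, freeSub_eq] at hx1; exact hx1
  · intro e he
    have h1 : x * e ∈ sub1 A r M ^ (ℓ + 2) := (Submodule.mem_div_iff_forall_mul_mem.1 hx2) e he
    rw [pow_succ'] at h1
    refine Submodule.mul_induction_on h1 (fun m hm n hn => ?_) (fun a b ha hb => add_mem ha hb)
    have hm' : m ∈ reesAlg A r M := pow_le_rees 1 (by rwa [pow_one])
    exact Submodule.smul_mem _ (⟨m, hm'⟩ : reesAlg A r M) (Submodule.subset_span hn)

lemma three_rr [IsNoetherianRing A] [IsDomain A] (hM0 : M ≠ ⊥) (h3 : sub1 A r M * barPow A r M 1 = sub1 A r M ^ 2) :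
    ratliffRush A r (freeSub A r) (sub1 A r M) = barPow A r M 1 := by
  refine le_antisymm (rr_le_bar hM0) fun x hx => ?_
  refine Submodule.mem_iSup_of_mem 0 ⟨?_, ?_⟩
  · rw [SetLike.mem_coe, freeSub_eq]; exact (mem_bar1.1 hx).1
  · rw [SetLike.mem_coe, Submodule.mem_div_iff_forall_mul_mem]
    intro y hy
    rw [← three_pow h3, mul_comm x y]
    exact Submodule.mul_mem_mul hy hx

end
end

section
set_option linter.all false
set_option autoImplicit false
open MvPolynomial IsLocalRing

section
variable {A : Type} [CommRing A] {r : ℕ} {M : Submodule A (Fin r → A)}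

lemma exists_a [IsLocalRing A] [IsDomain A] (hdim : ringKrullDim A = 2) (hs : ∃ s, ∀ a ∈ maximalIdeal A ^ s, ∀ f, a • f ∈ M) :
    ∃ a : A, a ∈ maximalIdeal A ∧ a ≠ 0 ∧ ∀ f, a • f ∈ M := by
  obtain ⟨s, hs⟩ := hs
  have hm : maximalIdeal A ≠ ⊥ := by
    intro h
    have := IsLocalRing.isField_iff_maximalIdeal_eq.2 h
    rw [ringKrullDim_eq_zero_of_isField this] at hdim
    exact absurd hdim (by norm_num)
  obtain ⟨x, hx, hx0⟩ := Submodule.exists_mem_ne_zero_of_ne_bot hm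
  refine ⟨x ^ (s + 1), Ideal.pow_mem_of_mem _ hx _ (by omega), pow_ne_zero _ hx0, hs _ ?_⟩
  exact Ideal.pow_le_pow_right (by omega) (Ideal.pow_mem_pow hx (s + 1))

lemma a_pow_mul {a : A} (ha : ∀ f, a • f ∈ M) (x : MvPolynomial (Fin r) A) : ∃ k, C (a ^ k) * x ∈ reesAlg A r M := by
  have hX : ∀ i, C a * X i ∈ reesAlg A r M := by
    intro i
    have := linT_mem_rees (ha (Pi.single i 1))
    rwa [linT_smul, show linT (Pi.single i (1 : A)) = X i from ?_] at this
    simp [linT, Pi.single_apply]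
  have hC : ∀ b, C b ∈ reesAlg A r M := fun b => Subalgebra.algebraMap_mem _ b
  induction x using MvPolynomial.induction_on with
  | C b => exact ⟨0, by simpa using hC b⟩
  | add p q hp hq =>
    obtain ⟨k, hk⟩ := hp
    obtain ⟨j, hj⟩ := hq
    refine ⟨j + k, ?_⟩
    have : C (a ^ (j + k)) * (p + q) = C (a ^ j) * (C (a ^ k) * p) + C (a ^ k) * (C (a ^ j) * q) := by
      rw [pow_add, C_mul]; ring
    rw [this]
    exact add_mem (mul_mem (hC _) hk) (mul_mem (hC _) hj)
  | mul_X p i hp =>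
    obtain ⟨k, hk⟩ := hp
    refine ⟨k + 1, ?_⟩
    have : C (a ^ (k + 1)) * (p * X i) = (C (a ^ k) * p) * (C a * X i) := by
      rw [pow_succ, C_mul]; ring
    rw [this]; exact mul_mem hk (hX i)

lemma rees_frac [IsLocalRing A] [IsDomain A] (hdim : ringKrullDim A = 2) (hs : ∃ s, ∀ a ∈ maximalIdeal A ^ s, ∀ f, a • f ∈ M)
    (s : MvPolynomial (Fin r) A) : ∃ a : reesAlg A r M, a ≠ 0 ∧ ∃ b : reesAlg A r M,
      algebraMap (reesAlg A r M) (MvPolynomial (Fin r) A) a * s = algebraMap (reesAlg A r M) (MvPolynomial (Fin r) A) b := by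
  obtain ⟨a, -, ha0, ha⟩ := exists_a hdim hs
  obtain ⟨k, hk⟩ := a_pow_mul ha s
  refine ⟨⟨C (a ^ k), Subalgebra.algebraMap_mem _ _⟩, ?_, ⟨_, hk⟩, rfl⟩
  intro h
  have := congrArg Subtype.val h
  simp only [ZeroMemClass.coe_zero] at this
  rw [C_eq_zero] at this
  exact pow_ne_zero k ha0 this

lemma S_normal [IsLocalRing A] [IsNoetherianRing A] [IsDomain A] (hdim : ringKrullDim A = 2)
    (hreg : ∃ x y : A, Ideal.span {x, y} = maximalIdeal A) : IsIntegrallyClosed (MvPolynomial (Fin r) A) := by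
  obtain ⟨x, y, hm⟩ := hreg
  obtain ⟨-, hx, hy⟩ := reg_domain hdim hm
  haveI : UniqueFactorizationMonoid A := rr_ufd hm hx
  infer_instance

lemma rees_normal_iff [IsLocalRing A] [IsNoetherianRing A] [IsDomain A] (hdim : ringKrullDim A = 2)
    (hreg : ∃ x y : A, Ideal.span {x, y} = maximalIdeal A) (hs : ∃ s, ∀ a ∈ maximalIdeal A ^ s, ∀ f, a • f ∈ M)
    (P : Ideal (reesAlg A r M)) [P.IsPrime] :
    IsIntegrallyClosed (Localization.AtPrime P) ↔
      ∀ t ∈ intClAlg A r M, ∃ s : reesAlg A r M, s ∉ P ∧ s.1 * t ∈ reesAlg A r M := by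
  haveI := S_normal (r := r) hdim hreg
  rw [loc_normal_iff (S := MvPolynomial (Fin r) A) Subtype.val_injective (rees_frac hdim hs) P]
  constructor
  · intro h t ht
    obtain ⟨s, hs, b, hb⟩ := h t (mem_intCl.1 ht)
    exact ⟨s, hs, by change s.1 * t = b.1 at hb; rw [hb]; exact b.2⟩
  · intro h t ht
    obtain ⟨s, hs, hb⟩ := h t (mem_intCl.2 ht)
    exact ⟨s, hs, ⟨_, hb⟩, rfl⟩

lemma gmax_mul_int [IsLocalRing A] [IsNoetherianRing A] [IsDomain A] (hdim : ringKrullDim A = 2)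
    (hreg : ∃ x y : A, Ideal.span {x, y} = maximalIdeal A) (hres : Infinite (ResidueField A))
    (hM0 : M ≠ ⊥) (hs : ∃ s, ∀ a ∈ maximalIdeal A ^ s, ∀ f, a • f ∈ M)
    (h3a : (maximalIdeal A) • (barPow A r M 1) ≤ sub1 A r M)
    (h3 : sub1 A r M * barPow A r M 1 = sub1 A r M ^ 2) (a : reesAlg A r M) (ha : a ∈ gradedMax A r M)
    {g : MvPolynomial (Fin r) A} (hg : g ∈ intClAlg A r M) : a.1 * g ∈ reesAlg A r M := by
  obtain ⟨q, hq, l, hl, rfl⟩ := rb_decomp hdim hreg hres hM0 hs h3 g hg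
  rw [mul_add]
  exact add_mem (mul_mem a.2 hq) (gmax_mul_rees h3a h3 a ha hl)

theorem three_normal [IsLocalRing A] [IsNoetherianRing A] [IsDomain A] (hdim : ringKrullDim A = 2)
    (hreg : ∃ x y : A, Ideal.span {x, y} = maximalIdeal A) (hres : Infinite (ResidueField A))
    (hM0 : M ≠ ⊥) (hs : ∃ s, ∀ a ∈ maximalIdeal A ^ s, ∀ f, a • f ∈ M)
    (h3a : (maximalIdeal A) • (barPow A r M 1) ≤ sub1 A r M)
    (h3 : sub1 A r M * barPow A r M 1 = sub1 A r M ^ 2)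
    (P : Ideal (reesAlg A r M)) [P.IsPrime] (hP : ¬ (posPart A r (reesAlg A r M) ≤ P)) :
    IsIntegrallyClosed (Localization.AtPrime P) := by
  rw [rees_normal_iff hdim hreg hs]
  intro t ht
  obtain ⟨s, hs1, hs2⟩ := SetLike.not_le_iff_exists.1 hP
  refine ⟨s, hs2, gmax_mul_int hdim hreg hres hM0 hs h3a h3 s ?_ ht⟩
  show constantCoeff s.1 ∈ maximalIdeal A
  have : constantCoeff s.1 = 0 := hs1
  rw [this]; exact zero_mem _

theorem gradedMax_prime [IsLocalRing A] : (gradedMax A r M).IsPrime := Ideal.comap_isPrime _ _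

lemma loc_dim_le [IsLocalRing A] [IsNoetherianRing A] [IsDomain A] (hdim : ringKrullDim A = 2)
    (hs : ∃ s, ∀ a ∈ maximalIdeal A ^ s, ∀ f, a • f ∈ M) :
    ringKrullDim (Localization.AtPrime (gradedMax A r M)) ≤ ((r + 1 + 1 : ℕ) : WithBot ℕ∞) := by
  obtain ⟨a, -, ha0, ha⟩ := exists_a hdim hs
  rw [IsLocalization.AtPrime.ringKrullDim_eq_height (gradedMax A r M) (Localization.AtPrime (gradedMax A r M))]
  exact (Ideal.height_le_ringKrullDim_of_isPrime).trans (rees_dim_le hdim ha0 ha)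

theorem three_buchs [IsLocalRing A] [IsNoetherianRing A] [IsDomain A] (hdim : ringKrullDim A = 2)
    (hreg : ∃ x y : A, Ideal.span {x, y} = maximalIdeal A) (hres : Infinite (ResidueField A))
    (hM0 : M ≠ ⊥) (hs : ∃ s, ∀ a ∈ maximalIdeal A ^ s, ∀ f, a • f ∈ M)
    (h3a : (maximalIdeal A) • (barPow A r M 1) ≤ sub1 A r M)
    (h3 : sub1 A r M * barPow A r M 1 = sub1 A r M ^ 2) :
    IsBuchsbaumLocalRing (Localization.AtPrime (gradedMax A r M)) := by
  obtain ⟨y, hy, hyr⟩ := reg_seq hdim hreg hres hM0 hs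
  let T := integralClosure (reesAlg A r M) (MvPolynomial (Fin r) A)
  have hT : ∀ t : T, t.1 ∈ intClAlg A r M := fun t => t.2
  have hmul := fun (a : reesAlg A r M) ha (t : T) => gmax_mul_int hdim hreg hres hM0 hs h3a h3 a ha (hT t)
  obtain ⟨a, ham, ha0, -⟩ := exists_a hdim hs
  let a' : reesAlg A r M := ⟨C a, Subalgebra.algebraMap_mem _ _⟩
  have ha' : a' ∈ gradedMax A r M := by show constantCoeff (C a) ∈ maximalIdeal A; simpa using ham
  have ha'0 : (C a : MvPolynomial (Fin r) A) ≠ 0 := by rwa [Ne, C_eq_zero]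
  haveI : Module.Finite (reesAlg A r M) T := by
    let f : T →ₗ[reesAlg A r M] reesAlg A r M :=
      { toFun := fun t => ⟨a'.1 * t.1, hmul a' ha' t⟩
        map_add' := fun s t => Subtype.ext (mul_add _ _ _)
        map_smul' := fun c t => Subtype.ext (by
          show a'.1 * (c.1 * t.1) = c.1 * (a'.1 * t.1)
          ring) }
    refine Module.Finite.of_injective f fun s t h => Subtype.ext ?_
    have := congrArg Subtype.val h
    exact mul_left_cancel₀ ha'0 this
  refine buchs_of_ext (gradedMax A r M) T 1 ?_ ?_ y hy ?_ (loc_dim_le hdim hs)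
  · intro c hc
    have := congrArg Subtype.val hc
    apply Subtype.ext
    simpa [Subalgebra.smul_def] using this
  · intro c hc t
    refine ⟨⟨c.1 * t.1, hmul c hc t⟩, Subtype.ext ?_⟩
    show c.1 * t.1 = (c.1 * t.1) * 1
    rw [mul_one]
  · intro i f g hfg
    have h1 := congrArg Subtype.val hfg
    have h2 : (y i).1 * f.1 = ∑ j ∈ Finset.Iio i, (y j).1 * (g j).1 := by
      refine h1.trans ?_
      rw [AddSubmonoidClass.coe_finset_sum]; rfl
    obtain ⟨g', hg', e⟩ := hyr i f.1 (hT f) (fun j => (g j).1) (fun j => hT (g j)) h2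
    refine ⟨fun j => ⟨g' j, hg' j⟩, Subtype.ext ?_⟩
    rw [e, AddSubmonoidClass.coe_finset_sum]; rfl

theorem three_bar [IsLocalRing A] [IsNoetherianRing A] [IsDomain A] (hdim : ringKrullDim A = 2)
    (hreg : ∃ x y : A, Ideal.span {x, y} = maximalIdeal A) (hres : Infinite (ResidueField A))
    (hM0 : M ≠ ⊥) (hs : ∃ s, ∀ a ∈ maximalIdeal A ^ s, ∀ f, a • f ∈ M)
    (h3 : sub1 A r M * barPow A r M 1 = sub1 A r M ^ 2) (n : ℕ) (hn : 2 ≤ n) : barPow A r M n = sub1 A r M ^ n := by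
  apply le_antisymm
  · rintro x ⟨hx1, hx2⟩
    rw [SetLike.mem_coe, freeSub_pow_eq] at hx1
    obtain ⟨q, hq, l, hl, e⟩ := rb_decomp hdim hreg hres hM0 hs h3 x hx2
    exact bar_hom_eq hn hx1 hq (mem_bar1.1 hl).1 e
  · intro x hx
    refine ⟨?_, rees_le_intCl (pow_le_rees n hx)⟩
    rw [SetLike.mem_coe, freeSub_pow_eq]; exact pow_hom hx
end
end

section
set_option linter.all false
set_option autoImplicit false
open MvPolynomial IsLocalRing

section
lemma exists_sop (O : Type) [CommRing O] [IsLocalRing O] [IsNoetherianRing O] (d : ℕ) (hd : ringKrullDim O = d) (N : ℕ) (hN : 0 < N) :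
    ∃ x : Fin d → O, (∀ i, x i ∈ maximalIdeal O ^ N) ∧ maximalIdeal O ≤ (Ideal.span (Set.range x)).radical := by
  obtain ⟨s, hs, hc⟩ := Ideal.exists_finset_card_eq_height_of_isNoetherianRing (maximalIdeal O)
  have hcd : s.card = d := by
    have h1 := IsLocalRing.maximalIdeal_height_eq_ringKrullDim (R := O)
    rw [← hc, hd] at h1
    exact_mod_cast h1
  let e : Fin d ≃ s := (finCongr hcd.symm).trans s.equivFin.symm
  have hsm : ∀ z ∈ s, z ∈ maximalIdeal O := fun z hz => hs.1.2 (Ideal.subset_span hz)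
  refine ⟨fun i => (e i).1 ^ N, fun i => Ideal.pow_mem_pow (hsm _ (e i).2) N, ?_⟩
  rw [Ideal.radical_eq_sInf]
  refine le_sInf ?_
  rintro Q ⟨hQ, hQp⟩
  have : Ideal.span (s : Set O) ≤ Q := by
    rw [Ideal.span_le]
    intro z hz
    have h1 : (e (e.symm ⟨z, hz⟩)).1 ^ N ∈ Q := hQ (Ideal.subset_span ⟨_, rfl⟩)
    rw [e.apply_symm_apply] at h1
    exact hQp.mem_of_pow_mem _ h1
  exact hs.2 ⟨hQp, this⟩ (IsLocalRing.le_maximalIdeal hQp.ne_top)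

lemma buchs_kill (O : Type) [CommRing O] [IsDomain O] [IsLocalRing O] [IsNoetherianRing O] (d : ℕ) (hd : ringKrullDim O = d) (hd2 : 2 ≤ d)
    (hB : IsBuchsbaumLocalRing O) (p q : O) (hq : q ≠ 0) (N : ℕ) (h : ∀ c ∈ maximalIdeal O ^ N, q ∣ c * p) (c : O) (hcm : c ∈ maximalIdeal O) :
    q ∣ c * p := by
  obtain ⟨x, hx, hrad⟩ := exists_sop O d hd (N + 1) (by omega)
  have hxm : ∀ i, x i ∈ maximalIdeal O := fun i => Ideal.pow_le_self (by omega) (hx i)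
  have hxN : ∀ i, x i ∈ maximalIdeal O ^ N := fun i => Ideal.pow_le_pow_right (by omega) (hx i)
  have hBx := hB d hd x hxm hrad
  let i0 : Fin d := ⟨0, by omega⟩
  let i1 : Fin d := ⟨1, by omega⟩
  have e0 : {j : Fin d | j < i0} = ∅ := by
    ext j; simp only [Set.mem_setOf_eq, Set.mem_empty_iff_false, iff_false, Fin.lt_def, i0]; omega
  have e1 : {j : Fin d | j < i1} = {i0} := by
    ext j; simp only [Set.mem_setOf_eq, Set.mem_singleton_iff, Fin.lt_def, i0, i1, Fin.ext_iff]; omega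
  by_cases hc0 : c = 0
  · subst hc0; simp
  have hx0 : x i0 ≠ 0 := by
    intro h0
    have h1 := hBx i0
    rw [e0, h0] at h1
    have h2 : (1 : O) ∈ (Ideal.span (x '' ∅)).colon (Ideal.span {(0 : O)}) := by
      rw [Submodule.mem_colon]
      intro z hz
      simp at hz; simp [hz]
    have h3 := (Submodule.mem_colon.1 (h1 h2)) c hcm
    simp at h3
    exact hc0 h3
  obtain ⟨u, hu⟩ := h _ (hxN i0)
  obtain ⟨v, hv⟩ := h _ (hxN i1)
  have huv : x i1 * u = x i0 * v := by
    apply mul_left_cancel₀ hq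
    linear_combination x i0 * hv - x i1 * hu
  have h1 := hBx i1
  rw [e1, Set.image_singleton] at h1
  have h2 : u ∈ (Ideal.span {x i0}).colon (Ideal.span {x i1}) := by
    rw [Submodule.mem_colon]
    intro z hz
    obtain ⟨w, rfl⟩ := Ideal.mem_span_singleton'.1 hz
    rw [smul_eq_mul, Ideal.mem_span_singleton]
    exact ⟨w * v, by linear_combination w * huv⟩
  have h3 := (Submodule.mem_colon.1 (h1 h2)) c hcm
  rw [smul_eq_mul, Ideal.mem_span_singleton] at h3
  obtain ⟨e, he⟩ := h3
  refine ⟨e, ?_⟩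
  apply mul_left_cancel₀ hx0
  linear_combination c * hu + q * he
end

section
variable {A : Type} [CommRing A] {r : ℕ} {M : Submodule A (Fin r → A)}

/-- the conductor `(R : b)` -/
def condR (M : Submodule A (Fin r → A)) (b : MvPolynomial (Fin r) A) : Ideal (reesAlg A r M) where
  carrier := {c | c.1 * b ∈ reesAlg A r M}
  add_mem' := fun {x y} hx hy => by
    show (x.1 + y.1) * b ∈ reesAlg A r M
    rw [add_mul]; exact add_mem hx hy
  zero_mem' := by show (0 : MvPolynomial (Fin r) A) * b ∈ reesAlg A r M; rw [zero_mul]; exact zero_mem _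
  smul_mem' := fun c x hx => by
    show (c.1 * x.1) * b ∈ reesAlg A r M
    rw [mul_assoc]; exact mul_mem c.2 hx

lemma mem_condR {b : MvPolynomial (Fin r) A} {c : reesAlg A r M} : c ∈ condR M b ↔ c.1 * b ∈ reesAlg A r M := Iff.rfl

lemma loc_dim_eq [IsLocalRing A] [IsNoetherianRing A] [IsDomain A] (hdim : ringKrullDim A = 2)
    (hM0 : M ≠ ⊥) (hs : ∃ s, ∀ a ∈ maximalIdeal A ^ s, ∀ f, a • f ∈ M) :
    ∃ d : ℕ, 2 ≤ d ∧ ringKrullDim (Localization.AtPrime (gradedMax A r M)) = d := by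
  have h1 := loc_dim_le (r := r) (M := M) hdim hs
  rw [IsLocalization.AtPrime.ringKrullDim_eq_height (gradedMax A r M) (Localization.AtPrime (gradedMax A r M))] at h1 ⊢
  haveI hpp : (posPart A r (reesAlg A r M)).IsPrime := RingHom.ker_isPrime _
  have l1 : (⊥ : Ideal (reesAlg A r M)) < posPart A r (reesAlg A r M) := by
    rw [bot_lt_iff_ne_bot]
    intro h
    obtain ⟨e, he, he0⟩ := pow_ne_bot (r := r) hM0 1
    have : (⟨e, pow_le_rees 1 he⟩ : reesAlg A r M) ∈ posPart A r (reesAlg A r M) := by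
      show constantCoeff e = 0
      exact (pow_hom he).coeff_eq_zero (by simp)
    rw [h, Ideal.mem_bot] at this
    exact he0 (congrArg Subtype.val this)
  obtain ⟨a, ham, ha0, -⟩ := exists_a hdim hs
  have l2 : posPart A r (reesAlg A r M) < gradedMax A r M := by
    refine lt_of_le_of_ne (fun x hx => ?_) fun h => ?_
    · have : constantCoeff x.1 = 0 := hx
      show constantCoeff x.1 ∈ maximalIdeal A
      rw [this]; exact zero_mem _
    · have : (⟨C a, Subalgebra.algebraMap_mem _ a⟩ : reesAlg A r M) ∈ gradedMax A r M := by
        show constantCoeff (C a) ∈ maximalIdeal A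
        simpa using ham
      rw [← h] at this
      have h2 : constantCoeff (C a : MvPolynomial (Fin r) A) = 0 := this
      exact ha0 (by simpa using h2)
  have k1 := Ideal.height_add_one_le_of_lt_of_isPrime l1
  have k2 := Ideal.height_add_one_le_of_lt_of_isPrime l2
  have k3 : (2 : ℕ∞) ≤ (gradedMax A r M).height := by
    calc (2 : ℕ∞) = 0 + 1 + 1 := by norm_num
      _ ≤ (⊥ : Ideal (reesAlg A r M)).height + 1 + 1 := by gcongr; exact bot_le
      _ ≤ _ := (add_le_add_left k1 1).trans k2
  have h1' : (gradedMax A r M).height ≤ ((r + 1 + 1 : ℕ) : ℕ∞) := WithBot.coe_le_coe.1 h1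
  lift (gradedMax A r M).height to ℕ using (fun h => by rw [h] at h1'; simp at h1') with d hd
  exact ⟨d, by exact_mod_cast k3, rfl⟩

theorem buchs_three [IsLocalRing A] [IsNoetherianRing A] [IsDomain A] (hdim : ringKrullDim A = 2)
    (hM0 : M ≠ ⊥) (hs : ∃ s, ∀ a ∈ maximalIdeal A ^ s, ∀ f, a • f ∈ M)
    (hB : IsBuchsbaumLocalRing (Localization.AtPrime (gradedMax A r M)))
    (hrad : ∀ b ∈ barPow A r M 1, gradedMax A r M ≤ (condR M b).radical) :
    (maximalIdeal A) • (barPow A r M 1) ≤ sub1 A r M ∧ sub1 A r M * barPow A r M 1 = (sub1 A r M) ^ 2 := by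
  obtain ⟨d, hd2, hd⟩ := loc_dim_eq hdim hM0 hs
  haveI : IsNoetherianRing (Localization.AtPrime (gradedMax A r M)) := IsLocalization.isNoetherianRing (gradedMax A r M).primeCompl _ inferInstance
  haveI : IsDomain (Localization.AtPrime (gradedMax A r M)) := IsLocalization.isDomain_localization (Ideal.primeCompl_le_nonZeroDivisors _)
  have hRinj : Function.Injective (algebraMap (reesAlg A r M) (Localization.AtPrime (gradedMax A r M))) :=
    IsLocalization.injective (Localization.AtPrime (gradedMax A r M)) (Ideal.primeCompl_le_nonZeroDivisors (gradedMax A r M))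
  have key : ∀ b ∈ barPow A r M 1, ∀ c : reesAlg A r M, c ∈ gradedMax A r M → ∃ s : reesAlg A r M, s ∉ gradedMax A r M ∧
      s.1 * (c.1 * b) ∈ reesAlg A r M := by
    intro b hb c hc
    obtain ⟨N, hN⟩ := Ideal.exists_pow_le_of_le_radical_of_fg (hrad b hb) (IsNoetherian.noetherian _)
    obtain ⟨q, hq, p, hp⟩ := rees_frac hdim hs b
    change q.1 * b = p.1 at hp
    have h1 := buchs_kill _ d hd hd2 hB (algebraMap _ _ p) (algebraMap _ _ q) ((map_ne_zero_iff _ hRinj).2 hq) N (by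
      intro z hz
      rw [← Localization.AtPrime.map_eq_maximalIdeal, ← Ideal.map_pow, IsLocalization.mem_map_algebraMap_iff (gradedMax A r M).primeCompl] at hz
      obtain ⟨⟨c0, s⟩, hz⟩ := hz
      have hc0 := hN c0.2
      rw [mem_condR] at hc0
      have hu : IsUnit (algebraMap (reesAlg A r M) (Localization.AtPrime (gradedMax A r M)) s.1) := IsLocalization.map_units _ s
      rw [← hu.dvd_mul_left]
      refine ⟨algebraMap _ _ (⟨_, hc0⟩ : reesAlg A r M), ?_⟩
      rw [← mul_assoc, mul_comm _ z, hz, ← map_mul, ← map_mul]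
      refine congrArg _ (Subtype.ext ?_)
      show c0.1.1 * p.1 = q.1 * (c0.1.1 * b)
      rw [← hp]; ring) (algebraMap _ _ c) ((IsLocalization.AtPrime.to_map_mem_maximal_iff _ (gradedMax A r M) c).2 hc)
    obtain ⟨e, he⟩ := h1
    obtain ⟨e, s, rfl⟩ := IsLocalization.exists_mk'_eq (gradedMax A r M).primeCompl e
    refine ⟨s.1, s.2, ?_⟩
    have h2 : s.1 * (c * p) = q * e := by
      apply hRinj
      rw [map_mul, map_mul _ c p, he, map_mul, ← IsLocalization.mk'_spec (Localization.AtPrime (gradedMax A r M)) e s]; ring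
    have h3 : s.1.1 * (c.1 * b) = e.1 := by
      have hq' : q.1 ≠ 0 := fun h => hq (Subtype.ext h)
      apply mul_left_cancel₀ hq'
      have := congrArg Subtype.val h2
      change s.1.1 * (c.1 * p.1) = q.1 * e.1 at this
      rw [← this, ← hp]; ring
    rw [h3]; exact e.2
  have key2 : ∀ n, ∀ y : MvPolynomial (Fin r) A, y.IsHomogeneous n → ∀ s : reesAlg A r M, s ∉ gradedMax A r M → s.1 * y ∈ reesAlg A r M →
      y ∈ sub1 A r M ^ n := by
    intro n y hy s hs hsy
    have h1 := hc_mem hsy (0 + n)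
    rw [hc_mul_hom hy, homogeneousComponent_zero, zero_add, C_mul'] at h1
    have hu : IsUnit (coeff 0 s.1) := by
      by_contra hh
      exact hs hh
    exact ((sub1 A r M ^ n).smul_mem_iff_of_isUnit hu).1 h1
  refine ⟨?_, le_antisymm ?_ ?_⟩
  · rw [Submodule.smul_le]
    intro c hc b hb
    obtain ⟨s, hs1, hs2⟩ := key b hb ⟨C c, Subalgebra.algebraMap_mem _ c⟩ (by
      show constantCoeff (C c) ∈ maximalIdeal A
      simpa using hc)
    have h1 := key2 1 _ (by
      show (C c * b).IsHomogeneous 1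
      rw [C_mul']; exact (homogeneousSubmodule (Fin r) A 1).smul_mem c (mem_bar1.1 hb).1) s hs1 hs2
    rwa [pow_one, C_mul'] at h1
  · rw [Submodule.mul_le]
    intro c hc b hb
    have hc' : c ∈ sub1 A r M ^ 1 := by rwa [pow_one]
    have hch := pow_hom hc'
    obtain ⟨s, hs1, hs2⟩ := key b hb ⟨c, pow_le_rees 1 hc'⟩ (by
      show constantCoeff c ∈ maximalIdeal A
      have : constantCoeff c = 0 := hch.coeff_eq_zero (by simp)
      rw [this]; exact zero_mem _)
    exact key2 2 _ (hch.mul (mem_bar1.1 hb).1) s hs1 hs2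
  · rw [pow_two]; exact mul_le_mul' le_rfl sub1_le_bar

lemma rad_of_hom [IsLocalRing A] (hs : ∃ s, ∀ a ∈ maximalIdeal A ^ s, ∀ f, a • f ∈ M) {b : MvPolynomial (Fin r) A} (hb : b.IsHomogeneous 1)
    (h : ∀ n, ∀ y : reesAlg A r M, y.1 ∈ sub1 A r M ^ (n + 1) → y ∈ (condR M b).radical) : gradedMax A r M ≤ (condR M b).radical := by
  intro c hc
  have hsum : c = ∑ i ∈ Finset.range (c.1.totalDegree + 1), (⟨homogeneousComponent i c.1, hc_rees c.2 i⟩ : reesAlg A r M) := by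
    apply Subtype.ext
    rw [AddSubmonoidClass.coe_finset_sum]
    exact (sum_homogeneousComponent c.1).symm
  rw [hsum]
  refine sum_mem fun i _ => ?_
  cases i with
  | succ i => exact h i _ (hc_mem c.2 (i + 1))
  | zero =>
    obtain ⟨s, hs⟩ := hs
    refine ⟨s, ?_⟩
    rw [mem_condR]
    show (homogeneousComponent 0 c.1) ^ s * b ∈ _
    rw [homogeneousComponent_zero, ← C_pow, C_mul']
    have hbf : b ∈ freeSub A r := by rw [freeSub_eq]; exact hb
    obtain ⟨v, -, rfl⟩ := hbf
    rw [← map_smul]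
    have : emb A r (coeff 0 c.1 ^ s • v) ∈ sub1 A r M := ⟨_, hs _ (Ideal.pow_mem_pow (show constantCoeff c.1 ∈ maximalIdeal A from hc) s) v, rfl⟩
    exact pow_le_rees 1 (by rwa [pow_one])

theorem one_three [IsLocalRing A] [IsNoetherianRing A] [IsDomain A] (hdim : ringKrullDim A = 2)
    (hM0 : M ≠ ⊥) (hs : ∃ s, ∀ a ∈ maximalIdeal A ^ s, ∀ f, a • f ∈ M)
    (hB : IsBuchsbaumLocalRing (Localization.AtPrime (gradedMax A r M)))
    (hr : ratliffRush A r (freeSub A r) (sub1 A r M) = barPow A r M 1) :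
    (maximalIdeal A) • (barPow A r M 1) ≤ sub1 A r M ∧ sub1 A r M * barPow A r M 1 = (sub1 A r M) ^ 2 := by
  refine buchs_three hdim hM0 hs hB ?_
  intro b hb
  rw [← hr] at hb
  refine Submodule.iSup_induction _ (motive := fun b => gradedMax A r M ≤ (condR M b).radical) hb ?_ ?_ ?_
  · rintro ℓ b ⟨hb1, hb2⟩
    rw [SetLike.mem_coe, freeSub_eq] at hb1
    rw [SetLike.mem_coe, Submodule.mem_div_iff_forall_mul_mem] at hb2
    refine rad_of_hom hs hb1 fun n y hy => ⟨ℓ + 1, ?_⟩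
    rw [mem_condR]
    have h1 : y.1 ^ (ℓ + 1) ∈ sub1 A r M ^ (ℓ + 1) * sub1 A r M ^ (n * (ℓ + 1)) := by
      rw [← pow_add, show ℓ + 1 + n * (ℓ + 1) = (n + 1) * (ℓ + 1) by ring, pow_mul]
      exact Submodule.pow_mem_pow _ hy _
    show y.1 ^ (ℓ + 1) * b ∈ reesAlg A r M
    refine Submodule.mul_induction_on (C := fun z => z * b ∈ reesAlg A r M) h1 (fun u hu v hv => ?_) (fun u v hu hv => ?_)
    · rw [show u * v * b = (b * u) * v by ring]
      exact mul_mem (pow_le_rees _ (hb2 u hu)) (pow_le_rees _ hv)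
    · rw [add_mul]; exact add_mem hu hv
  · have : condR M (0 : MvPolynomial (Fin r) A) = ⊤ := by
      rw [Ideal.eq_top_iff_one, mem_condR, mul_zero]; exact zero_mem _
    rw [this, Ideal.radical_top]; exact le_top
  · intro x y hx hy
    refine le_trans (le_inf hx hy) ?_
    rw [← Ideal.radical_inf]
    refine Ideal.radical_mono ?_
    rintro c ⟨h1, h2⟩
    rw [mem_condR, mul_add]; exact add_mem h1 h2

theorem two_three [IsLocalRing A] [IsNoetherianRing A] [IsDomain A] (hdim : ringKrullDim A = 2)
    (hreg : ∃ x y : A, Ideal.span {x, y} = maximalIdeal A)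
    (hM0 : M ≠ ⊥) (hs : ∃ s, ∀ a ∈ maximalIdeal A ^ s, ∀ f, a • f ∈ M)
    (hB : IsBuchsbaumLocalRing (Localization.AtPrime (gradedMax A r M)))
    (hn : ∀ (P : Ideal ↥(reesAlg A r M)) [P.IsPrime],
          IsGradedIdeal A r (reesAlg A r M) P → ¬ (posPart A r (reesAlg A r M) ≤ P) →
          IsIntegrallyClosed (Localization.AtPrime P)) :
    (maximalIdeal A) • (barPow A r M 1) ≤ sub1 A r M ∧ sub1 A r M * barPow A r M 1 = (sub1 A r M) ^ 2 := by
  refine buchs_three hdim hM0 hs hB ?_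
  intro b hb
  obtain ⟨hb1, hb2⟩ := mem_bar1.1 hb
  refine rad_of_hom hs hb1 fun n y hy => ?_
  rw [Ideal.radical_eq_sInf]
  refine Submodule.mem_sInf.2 ?_
  rintro Q ⟨hQ, hQp⟩
  by_contra hyQ
  have h1 := hn (hCore Q) (hCore_graded Q) (fun hle => hyQ (hCore_le Q (hle (by
    show constantCoeff y.1 = 0
    exact (pow_hom hy).coeff_eq_zero (by simp)))))
  rw [rees_normal_iff hdim hreg hs] at h1
  obtain ⟨s, hsQ, hsb⟩ := h1 b hb2
  apply hsQ
  rw [mem_hCore]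
  intro k
  apply hQ
  rw [mem_condR]
  show homogeneousComponent k s.1 * b ∈ reesAlg A r M
  rw [← hc_mul_hom hb1]
  exact hc_rees hsb _
end
end

section
set_option linter.all false
set_option autoImplicit false
section
open CategoryTheory
variable {R : Type} [CommRing R]

/-- The map induced on Hom complexes. -/
noncomputable def linYMap {K L : ChainComplex (ModuleCat.{0} R) ℕ} (φ : K ⟶ L) (Y : ModuleCat.{0} R) :
    L.linearYonedaObj R Y ⟶ K.linearYonedaObj R Y :=
  (HomologicalComplex.unopFunctor _ _).map
    ((((linearYoneda R (ModuleCat.{0} R)).obj Y).rightOp.mapHomologicalComplex _).map φ).op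

lemma abs_nat {C : Type*} [Category C] {E' E HoP HoQ HP HQ : C} (a : E' ⟶ E) (p : E ⟶ HoP) (q : E' ⟶ HoQ) (m : HoQ ⟶ HoP)
    (h1 : a ≫ p = q ≫ m) (sP : HP ≅ HoP) (sQ : HQ ≅ HoQ) (hm : HQ ⟶ HP) (h2 : sQ.hom ≫ m = hm ≫ sP.hom) :
    a ≫ p ≫ sP.inv = (q ≫ sQ.inv) ≫ hm := by
  rw [← Category.assoc, h1, Category.assoc, Category.assoc]
  congr 1
  rw [Iso.comp_inv_eq, Category.assoc, Iso.eq_inv_comp, h2]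

lemma extF_nat {X X' : ModuleCat.{0} R} (f : X ⟶ X') (P : ProjectiveResolution X) (Q : ProjectiveResolution X')
    (φ : P.complex ⟶ Q.complex) (comm : φ.f 0 ≫ Q.π.f 0 = P.π.f 0 ≫ f) (Y : ModuleCat.{0} R) (n : ℕ) :
    ((Ext R (ModuleCat.{0} R) n).map f.op).app Y ≫ (P.isoExt n Y).hom =
      (Q.isoExt n Y).hom ≫ HomologicalComplex.homologyMap (linYMap φ Y) n := by
  have h1 := ProjectiveResolution.isoLeftDerivedObj_inv_naturality f P Q φ comm
    ((linearYoneda R (ModuleCat.{0} R)).obj Y).rightOp n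
  have h2 := HomologicalComplex.homologyOp_hom_naturality (linYMap φ Y) n
  have h1' := congrArg Quiver.Hom.unop h1
  have h2' := congrArg Quiver.Hom.unop h2
  have e1 : (P.isoExt n Y).hom = (P.isoLeftDerivedObj ((linearYoneda R (ModuleCat.{0} R)).obj Y).rightOp n).inv.unop ≫ ((P.complex.linearYonedaObj R Y).homologyOp n).inv.unop := rfl
  have e2 : (Q.isoExt n Y).hom = (Q.isoLeftDerivedObj ((linearYoneda R (ModuleCat.{0} R)).obj Y).rightOp n).inv.unop ≫ ((Q.complex.linearYonedaObj R Y).homologyOp n).inv.unop := rfl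
  rw [e1, e2]
  exact abs_nat _ _ _ _ h1' ((P.complex.linearYonedaObj R Y).homologyOp n).unop
    ((Q.complex.linearYonedaObj R Y).homologyOp n).unop _ h2'
end
end

section
set_option linter.all false
set_option autoImplicit false
section
open CategoryTheory
variable {R : Type} [CommRing R]

/-- class of a cocycle in degree one -/
noncomputable def clsH (K : CochainComplex (ModuleCat.{0} R) ℕ) :
    ModuleCat.of R (LinearMap.ker (K.d 1 2).hom) ⟶ K.homology 1 :=
  K.liftCycles (ModuleCat.ofHom (LinearMap.ker (K.d 1 2).hom).subtype) 2 (by simp)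
    (by ext x; exact x.2) ≫ K.homologyπ 1

lemma clsH_surj (K : CochainComplex (ModuleCat.{0} R) ℕ) : Function.Surjective (clsH K) := by
  intro y
  obtain ⟨z, rfl⟩ := (ModuleCat.epi_iff_surjective (K.homologyπ 1)).1 inferInstance y
  have h0 : (K.d 1 2) (K.iCycles 1 z) = 0 := by
    have := K.iCycles_d 1 2
    have := congrArg (fun f => f.hom z) this
    exact this
  refine ⟨⟨K.iCycles 1 z, h0⟩, ?_⟩
  unfold clsH
  rw [ModuleCat.comp_apply]
  congr 1
  apply (ModuleCat.mono_iff_injective (K.iCycles 1)).1 inferInstance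
  rw [← ModuleCat.comp_apply, HomologicalComplex.liftCycles_i]
  rfl

lemma clsH_zero (K : CochainComplex (ModuleCat.{0} R) ℕ) (c : LinearMap.ker (K.d 1 2).hom) :
    clsH K c = 0 ↔ ∃ g : K.X 0, K.d 0 1 g = c.1 := by
  have hex : (ShortComplex.mk (K.toCycles 0 1) (K.homologyπ 1) (by simp)).Exact :=
    ShortComplex.exact_of_g_is_cokernel _ (K.homologyIsCokernel 0 1 (by simp))
  rw [ShortComplex.moduleCat_exact_iff] at hex
  have hi : K.iCycles 1 ((K.liftCycles (ModuleCat.ofHom (LinearMap.ker (K.d 1 2).hom).subtype) 2 (by simp)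
    (by ext x; exact x.2)) c) = c.1 := by
    rw [← ModuleCat.comp_apply, HomologicalComplex.liftCycles_i]
    rfl
  unfold clsH
  rw [ModuleCat.comp_apply]
  constructor
  · intro h
    obtain ⟨g, hg⟩ := hex _ h
    refine ⟨g, ?_⟩
    rw [← hi, ← hg]
    change _ = (K.iCycles 1) ((K.toCycles 0 1) g)
    rw [← ModuleCat.comp_apply, HomologicalComplex.toCycles_i]
  · rintro ⟨g, hg⟩
    have : (K.liftCycles (ModuleCat.ofHom (LinearMap.ker (K.d 1 2).hom).subtype) 2 (by simp)
      (by ext x; exact x.2)) c = K.toCycles 0 1 g := by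
      apply (ModuleCat.mono_iff_injective (K.iCycles 1)).1 inferInstance
      rw [hi, ← ModuleCat.comp_apply, HomologicalComplex.toCycles_i, hg]
    rw [this, ← ModuleCat.comp_apply, HomologicalComplex.toCycles_comp_homologyπ]
    rfl

lemma clsH_i (K : CochainComplex (ModuleCat.{0} R) ℕ) (c : LinearMap.ker (K.d 1 2).hom) :
    K.iCycles 1 ((K.liftCycles (ModuleCat.ofHom (LinearMap.ker (K.d 1 2).hom).subtype) 2 (by simp)
    (by ext x; exact x.2)) c) = c.1 := by
  rw [← ModuleCat.comp_apply, HomologicalComplex.liftCycles_i]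
  rfl

lemma clsH_nat {K L : CochainComplex (ModuleCat.{0} R) ℕ} (φ : K ⟶ L) (c : LinearMap.ker (K.d 1 2).hom)
    (c' : LinearMap.ker (L.d 1 2).hom) (h : φ.f 1 c.1 = c'.1) :
    HomologicalComplex.homologyMap φ 1 (clsH K c) = clsH L c' := by
  unfold clsH
  rw [ModuleCat.comp_apply, ← ModuleCat.comp_apply, HomologicalComplex.homologyπ_naturality, ModuleCat.comp_apply,
    ModuleCat.comp_apply]
  congr 1
  apply (ModuleCat.mono_iff_injective (L.iCycles 1)).1 inferInstance
  rw [← ModuleCat.comp_apply, HomologicalComplex.cyclesMap_i, ModuleCat.comp_apply]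
  exact ((congrArg (φ.f 1) (clsH_i K c)).trans h).trans (clsH_i L c').symm
end

section
variable {R : Type} [CommRing R] {J : Ideal R} {P0 P1 P2 : Type} [AddCommGroup P0] [Module R P0]
  [AddCommGroup P1] [Module R P1] [AddCommGroup P2] [Module R P2]

lemma th_ker (π : P0 →ₗ[R] R ⧸ J) (hπ : Function.Surjective π) (d : P1 →ₗ[R] P0) (hd : ∀ x, π x = 0 → ∃ p, d p = x)
    (h : P0 →ₗ[R] R) (hh : ∀ x, Ideal.Quotient.mk J (h x) = π x) (k : P1 →ₗ[R] J) (hk : ∀ p, (k p : R) = h (d p))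
    (ψ : J →ₗ[R] R) : (∃ g : P0 →ₗ[R] R, g ∘ₗ d = ψ ∘ₗ k) ↔ ∃ r : R, ∀ j : J, ψ j = j.1 * r := by
  constructor
  · rintro ⟨g, hg⟩
    obtain ⟨e, he⟩ := hπ 1
    have hu : 1 - h e ∈ J := by
      rw [← Ideal.Quotient.eq_zero_iff_mem, map_sub, hh, he, map_one, sub_self]
    refine ⟨g e + ψ ⟨1 - h e, hu⟩, fun j => ?_⟩
    obtain ⟨p, hp⟩ := hd (j.1 • e) (by
      rw [map_smul, he, Algebra.smul_def, mul_one]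
      exact Ideal.Quotient.eq_zero_iff_mem.2 j.2)
    have h1 := congrArg (fun f => f p) hg
    simp only [LinearMap.comp_apply] at h1
    rw [hp, map_smul, smul_eq_mul] at h1
    have h2 : j = k p + j.1 • (⟨1 - h e, hu⟩ : J) := by
      apply Subtype.ext
      rw [Submodule.coe_add, hk, hp, map_smul, Submodule.coe_smul]
      simp only [smul_eq_mul]; ring
    have h3 : ψ j = ψ (k p) + j.1 * ψ ⟨1 - h e, hu⟩ := by
      conv_lhs => rw [h2]
      rw [map_add, map_smul, smul_eq_mul]
    rw [h3, ← h1]; ring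
  · rintro ⟨r, hr⟩
    refine ⟨r • h, ?_⟩
    ext p
    simp only [LinearMap.comp_apply, LinearMap.smul_apply, smul_eq_mul, hr, hk]
    ring

lemma th_surj (π : P0 →ₗ[R] R ⧸ J) (hπ : Function.Surjective π) (d : P1 →ₗ[R] P0) (hd : ∀ x, π x = 0 → ∃ p, d p = x)
    (hd0 : ∀ p, π (d p) = 0)
    (h : P0 →ₗ[R] R) (hh : ∀ x, Ideal.Quotient.mk J (h x) = π x) (k : P1 →ₗ[R] J) (hk : ∀ p, (k p : R) = h (d p))
    (c : P1 →ₗ[R] R) (hc : ∀ p, d p = 0 → c p = 0) : ∃ ψ : J →ₗ[R] R, ∃ g : P0 →ₗ[R] R, c = ψ ∘ₗ k + g ∘ₗ d := by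
  obtain ⟨e, he⟩ := hπ 1
  -- the induced map on the kernel
  have hf : ∃ cb : LinearMap.ker π →ₗ[R] R, ∀ p, cb ⟨d p, hd0 p⟩ = c p := by
    have hinv : ∀ b : LinearMap.ker π, ∃ p, d p = b.1 := fun b => hd b.1 b.2
    choose s hs using hinv
    have hs' : ∀ b p, d p = b.1 → c (s b) = c p := fun b p hp => by
      rw [← sub_eq_zero, ← map_sub]
      exact hc _ (by rw [map_sub, hs, hp, sub_self])
    refine ⟨{ toFun := fun b => c (s b), map_add' := fun x y => ?_, map_smul' := fun a x => ?_ }, fun p => ?_⟩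
    · rw [hs' (x + y) (s x + s y) (by rw [map_add, hs, hs]; rfl), map_add]
    · rw [hs' (a • x) (a • s x) (by rw [map_smul, hs]; rfl), map_smul]; rfl
    · exact hs' _ p rfl
  obtain ⟨cb, hcb⟩ := hf
  have hJ : ∀ j : J, j.1 • e ∈ LinearMap.ker π := fun j => by
    rw [LinearMap.mem_ker, map_smul, he, Algebra.smul_def, mul_one]
    exact Ideal.Quotient.eq_zero_iff_mem.2 j.2
  have hS : ∀ x : P0, x - h x • e ∈ LinearMap.ker π := fun x => by
    rw [LinearMap.mem_ker, map_sub, map_smul, he, Algebra.smul_def, mul_one, sub_eq_zero]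
    exact (hh x).symm
  refine ⟨cb ∘ₗ LinearMap.codRestrict _ ((LinearMap.toSpanSingleton R P0 e) ∘ₗ J.subtype) hJ,
    cb ∘ₗ LinearMap.codRestrict _ (LinearMap.id - (LinearMap.toSpanSingleton R P0 e) ∘ₗ h) hS, ?_⟩
  ext p
  simp only [LinearMap.comp_apply, LinearMap.add_apply]
  rw [← map_add, ← hcb]
  congr 1
  apply Subtype.ext
  change d p = (k p : R) • e + (d p - h (d p) • e)
  rw [hk, add_sub_cancel]
end
end

section
set_option linter.all false
set_option autoImplicit false
section
open CategoryTheory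
variable {R : Type} [CommRing R]

/-- a projective resolution of `R/J` -/
noncomputable abbrev resJ (J : Ideal R) : ProjectiveResolution (ModuleCat.of R (R ⧸ J)) := projectiveResolution _

noncomputable abbrev resPi (J : Ideal R) : (resJ J).complex.X 0 →ₗ[R] R ⧸ J := ((resJ J).π.f 0).hom

lemma resPi_surj (J : Ideal R) : Function.Surjective (resPi J) :=
  (ModuleCat.epi_iff_surjective ((resJ J).π.f 0)).1 inferInstance

noncomputable abbrev resD (J : Ideal R) : (resJ J).complex.X 1 →ₗ[R] (resJ J).complex.X 0 := ((resJ J).complex.d 1 0).hom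
noncomputable abbrev resD2 (J : Ideal R) : (resJ J).complex.X 2 →ₗ[R] (resJ J).complex.X 1 := ((resJ J).complex.d 2 1).hom

lemma resD_ex (J : Ideal R) (x : (resJ J).complex.X 0) (hx : resPi J x = 0) : ∃ p, resD J p = x := by
  have := (resJ J).exact₀
  rw [ShortComplex.moduleCat_exact_iff] at this
  exact this x hx

lemma resD_pi (J : Ideal R) (p : (resJ J).complex.X 1) : resPi J (resD J p) = 0 := by
  have := (resJ J).complex_d_comp_π_f_zero
  exact congrArg (fun f => f.hom p) this

lemma resD2_ex (J : Ideal R) (x : (resJ J).complex.X 1) (hx : resD J x = 0) : ∃ p, resD2 J p = x := by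
  have := (resJ J).exact_succ 0
  rw [ShortComplex.moduleCat_exact_iff] at this
  exact this x hx

lemma resD2_D (J : Ideal R) (p : (resJ J).complex.X 2) : resD J (resD2 J p) = 0 := by
  have := (resJ J).complex.d_comp_d 2 1 0
  exact congrArg (fun f => f.hom p) this

lemma resH_ex (J : Ideal R) : ∃ h : (resJ J).complex.X 0 →ₗ[R] R, ∀ x, Ideal.Quotient.mk J (h x) = resPi J x := by
  haveI : Epi (ModuleCat.ofHom (Submodule.mkQ J)) := (ModuleCat.epi_iff_surjective _).2 (Submodule.mkQ_surjective J)
  let q : (resJ J).complex.X 0 ⟶ ModuleCat.of R (R ⧸ J) := ModuleCat.ofHom (resPi J)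
  refine ⟨(Projective.factorThru q (ModuleCat.ofHom (Submodule.mkQ J))).hom, fun x => ?_⟩
  have := Projective.factorThru_comp q (ModuleCat.ofHom (Submodule.mkQ J))
  exact congrArg (fun f => f.hom x) this

noncomputable def resH (J : Ideal R) : (resJ J).complex.X 0 →ₗ[R] R := (resH_ex J).choose
lemma resH_spec (J : Ideal R) (x) : Ideal.Quotient.mk J (resH J x) = resPi J x := (resH_ex J).choose_spec x

noncomputable def resK (J : Ideal R) : (resJ J).complex.X 1 →ₗ[R] J :=
  LinearMap.codRestrict J (resH J ∘ₗ resD J) (fun p => by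
    rw [← Ideal.Quotient.eq_zero_iff_mem]
    exact (resH_spec J _).trans (resD_pi J p))
lemma resK_spec (J : Ideal R) (p) : (resK J p : R) = resH J (resD J p) := rfl

noncomputable abbrev homJ (J : Ideal R) : CochainComplex (ModuleCat.{0} R) ℕ :=
  (resJ J).complex.linearYonedaObj R (ModuleCat.of R R)

noncomputable def cocJ (J : Ideal R) : (J →ₗ[R] R) →ₗ[R] LinearMap.ker ((homJ J).d 1 2).hom where
  toFun ψ := ⟨ModuleCat.ofHom (ψ ∘ₗ resK J), by
    change (resJ J).complex.d 2 1 ≫ ModuleCat.ofHom (ψ ∘ₗ resK J) = 0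
    ext p
    change ψ (resK J (resD2 J p)) = 0
    have : resK J (resD2 J p) = 0 := by
      apply Subtype.ext
      rw [resK_spec, resD2_D, map_zero]; rfl
    rw [this, map_zero]⟩
  map_add' _ _ := rfl
  map_smul' _ _ := rfl

noncomputable abbrev ext1 (J : Ideal R) : ModuleCat.{0} R :=
  ((Ext R (ModuleCat.{0} R) 1).obj (Opposite.op (ModuleCat.of R (R ⧸ J)))).obj (ModuleCat.of R R)

noncomputable def thetaJ (J : Ideal R) : (J →ₗ[R] R) →ₗ[R] ext1 J :=
  ((resJ J).isoExt 1 (ModuleCat.of R R)).inv.hom ∘ₗ (clsH (homJ J)).hom ∘ₗ cocJ J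

lemma isoinj {X Y : ModuleCat.{0} R} (e : X ≅ Y) : Function.Injective e.inv.hom :=
  (ModuleCat.mono_iff_injective e.inv).1 inferInstance

lemma isosurj {X Y : ModuleCat.{0} R} (e : X ≅ Y) : Function.Surjective e.inv.hom :=
  (ModuleCat.epi_iff_surjective e.inv).1 inferInstance

lemma thetaJ_zero (J : Ideal R) (ψ : J →ₗ[R] R) : thetaJ J ψ = 0 ↔ ∃ r : R, ∀ j : J, ψ j = j.1 * r := by
  rw [← th_ker (resPi J) (resPi_surj J) (resD J) (resD_ex J) (resH J) (resH_spec J) (resK J) (resK_spec J)]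
  change ((resJ J).isoExt 1 (ModuleCat.of R R)).inv.hom (clsH (homJ J) (cocJ J ψ)) = 0 ↔ _
  rw [map_eq_zero_iff _ (isoinj _), clsH_zero]
  constructor
  · rintro ⟨g, hg⟩
    exact ⟨ModuleCat.Hom.hom g, congrArg ModuleCat.Hom.hom hg⟩
  · rintro ⟨g, hg⟩
    exact ⟨ModuleCat.ofHom g, congrArg ModuleCat.ofHom hg⟩

lemma thetaJ_surj (J : Ideal R) : Function.Surjective (thetaJ J) := by
  intro y
  obtain ⟨y, rfl⟩ := isosurj ((resJ J).isoExt 1 (ModuleCat.of R R)) y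
  obtain ⟨c, rfl⟩ := clsH_surj (homJ J) y
  have hc : ∀ p, resD J p = 0 → (ModuleCat.Hom.hom (A := (resJ J).complex.X 1) (B := ModuleCat.of R R) c.1) p = 0 := by
    intro p hp
    obtain ⟨q, rfl⟩ := resD2_ex J p hp
    have h := c.2
    rw [LinearMap.mem_ker] at h
    exact congrArg (fun f => ModuleCat.Hom.hom (A := (resJ J).complex.X 2) (B := ModuleCat.of R R) f q) h
  obtain ⟨ψ, g, hg⟩ := th_surj (resPi J) (resPi_surj J) (resD J) (resD_ex J) (resD_pi J) (resH J) (resH_spec J) (resK J) (resK_spec J) _ hc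
  refine ⟨ψ, ?_⟩
  change ((resJ J).isoExt 1 (ModuleCat.of R R)).inv.hom (clsH (homJ J) (cocJ J ψ)) = _
  congr 1
  rw [← sub_eq_zero, ← map_sub, clsH_zero]
  refine ⟨ModuleCat.ofHom (-g), ?_⟩
  apply ModuleCat.hom_ext (M := (resJ J).complex.X 1) (N := ModuleCat.of R R)
  change (-g) ∘ₗ resD J = (ψ ∘ₗ resK J) - (ModuleCat.Hom.hom (A := (resJ J).complex.X 1) (B := ModuleCat.of R R) c.1)
  rw [hg]
  ext p
  simp

lemma thetaJ_nat {J' J : Ideal R} (hle : J' ≤ J) (f : ModuleCat.of R (R ⧸ J') ⟶ ModuleCat.of R (R ⧸ J))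
    (hf : ∀ x : R, f.hom (Ideal.Quotient.mk J' x) = Ideal.Quotient.mk J x) (ψ : J →ₗ[R] R) :
    ((Ext R (ModuleCat.{0} R) 1).map f.op).app (ModuleCat.of R R) (thetaJ J ψ) =
      thetaJ J' (ψ ∘ₗ Submodule.inclusion hle) := by
  let φ := ProjectiveResolution.lift f (resJ J') (resJ J)
  have comm : φ.f 0 ≫ (resJ J).π.f 0 = (resJ J').π.f 0 ≫ f := ProjectiveResolution.lift_commutes_zero f (resJ J') (resJ J)
  have h1 := extF_nat f (resJ J') (resJ J) φ comm (ModuleCat.of R R) 1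
  apply (ModuleCat.mono_iff_injective ((resJ J').isoExt 1 (ModuleCat.of R R)).hom).1 inferInstance
  have h2 := congrArg (fun g => g.hom (thetaJ J ψ)) h1
  refine Eq.trans h2 ?_
  have h3 : ((resJ J).isoExt 1 (ModuleCat.of R R)).hom (thetaJ J ψ) = clsH (homJ J) (cocJ J ψ) := by
    change ((resJ J).isoExt 1 (ModuleCat.of R R)).hom (((resJ J).isoExt 1 (ModuleCat.of R R)).inv _) = _
    rw [← ModuleCat.comp_apply, Iso.inv_hom_id]; rfl
  have h3' : ((resJ J').isoExt 1 (ModuleCat.of R R)).hom (thetaJ J' (ψ ∘ₗ Submodule.inclusion hle)) = clsH (homJ J') (cocJ J' (ψ ∘ₗ Submodule.inclusion hle)) := by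
    change ((resJ J').isoExt 1 (ModuleCat.of R R)).hom (((resJ J').isoExt 1 (ModuleCat.of R R)).inv _) = _
    rw [← ModuleCat.comp_apply, Iso.inv_hom_id]; rfl
  rw [h3']
  change HomologicalComplex.homologyMap (linYMap φ (ModuleCat.of R R)) 1 (((resJ J).isoExt 1 (ModuleCat.of R R)).hom (thetaJ J ψ)) = _
  rw [h3]
  have hφ : ∀ p, resD J ((φ.f 1).hom p) = (φ.f 0).hom (resD J' p) := fun p => by
    have := φ.comm 1 0
    exact congrArg (fun f => f.hom p) this
  have hmem : ∀ x, (resH J ((φ.f 0).hom x) - resH J' x) ∈ J := fun x => by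
    rw [← Ideal.Quotient.eq_zero_iff_mem, map_sub, sub_eq_zero]
    have e1 : resPi J ((φ.f 0).hom x) = f.hom (resPi J' x) := congrArg (fun f => f.hom x) comm
    rw [resH_spec, e1, ← resH_spec, hf]
  let g : (resJ J').complex.X 0 →ₗ[R] R := ψ ∘ₗ LinearMap.codRestrict J (resH J ∘ₗ (φ.f 0).hom - resH J') hmem
  have hcoc : (ψ ∘ₗ resK J) ∘ₗ (φ.f 1).hom = (ψ ∘ₗ Submodule.inclusion hle) ∘ₗ resK J' + g ∘ₗ resD J' := by
    ext p
    change ψ _ = ψ _ + ψ _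
    rw [← map_add]
    congr 1
    apply Subtype.ext
    change resH J (resD J ((φ.f 1).hom p)) = resH J' (resD J' p) + (resH J ((φ.f 0).hom (resD J' p)) - resH J' (resD J' p))
    rw [hφ]; ring
  have hker : (linYMap φ (ModuleCat.of R R)).f 1 (cocJ J ψ).1 ∈ LinearMap.ker ((homJ J').d 1 2).hom := by
    rw [LinearMap.mem_ker]
    have := (linYMap φ (ModuleCat.of R R)).comm 1 2
    have h4 := congrArg (fun f => f.hom (cocJ J ψ).1) this
    refine (h4).trans ?_
    have h5 := (cocJ J ψ).2
    rw [LinearMap.mem_ker] at h5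
    change ((linYMap φ (ModuleCat.of R R)).f 2).hom (((homJ J).d 1 2).hom _) = 0
    rw [h5, map_zero]
  rw [clsH_nat (linYMap φ (ModuleCat.of R R)) (cocJ J ψ) ⟨_, hker⟩ rfl, ← sub_eq_zero, ← map_sub, clsH_zero]
  refine ⟨ModuleCat.ofHom g, ?_⟩
  apply ModuleCat.hom_ext (M := (resJ J').complex.X 1) (N := ModuleCat.of R R)
  change g ∘ₗ resD J' = ((ψ ∘ₗ resK J) ∘ₗ (φ.f 1).hom) - ((ψ ∘ₗ Submodule.inclusion hle) ∘ₗ resK J')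
  rw [hcoc, add_sub_cancel_left]
end
end

section
set_option linter.all false
set_option autoImplicit false
section
open CategoryTheory CategoryTheory.Limits
variable {R : Type} [CommRing R]

lemma lc_iso (I : Ideal R) (hiso : ∀ n, 1 ≤ n → ∀ f : ModuleCat.of R (R ⧸ I ^ n) ⟶ ModuleCat.of R (R ⧸ I ^ 1),
      (∀ x : R, f.hom (Ideal.Quotient.mk (I ^ n) x) = Ideal.Quotient.mk (I ^ 1) x) →
      Function.Bijective (((Ext R (ModuleCat.{0} R) 1).map f.op).app (ModuleCat.of R R))) :
    Nonempty ((localCohomology I 1).obj (ModuleCat.of R R) ≅ ext1 (I ^ 1)) := by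
  let D : ℕᵒᵖᵒᵖ ⥤ ModuleCat.{0} R := localCohomology.diagram (localCohomology.idealPowersDiagram I) 1 ⋙
    (evaluation (ModuleCat.{0} R) (ModuleCat.{0} R)).obj (ModuleCat.of R R)
  have hD : D.IsEventuallyConstantFrom (Opposite.op (Opposite.op 1)) := by
    intro j g
    have hle : 1 ≤ j.unop.unop := leOfHom g.unop.unop
    have := hiso j.unop.unop hle ((localCohomology.ringModIdeals (localCohomology.idealPowersDiagram I)).map g.unop)
      (fun x => rfl)
    exact (ConcreteCategory.isIso_iff_bijective (D.map g)).2 this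
  have e1 : (localCohomology I 1).obj (ModuleCat.of R R) ≅ colimit D :=
    colimitObjIsoColimitCompEvaluation (localCohomology.diagram (localCohomology.idealPowersDiagram I) 1) (ModuleCat.of R R)
  exact ⟨e1 ≪≫ (colimit.isColimit D).coconePointUniqueUpToIso hD.isColimitCocone⟩

/-- if every `R`-linear map `I ^ n → R` is multiplication by an element of a fixed extension, the
transition maps of the Ext system are bijective -/
lemma lc_iso' (I : Ideal R) {S : Type} [CommRing S] [IsDomain S] (ι : R →+* S) (hι : Function.Injective ι)
    (T : Set S) (hT : ∀ n, 1 ≤ n → ∀ ψ : (I ^ n : Ideal R) →ₗ[R] R, ∃ g ∈ T, ∀ j, ι (ψ j) = ι j.1 * g)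
    (hT2 : ∀ g ∈ T, ∀ j ∈ I, ∃ x : R, ι x = ι j * g) (hI : I ≠ ⊥) [IsDomain R] :
    Nonempty ((localCohomology I 1).obj (ModuleCat.of R R) ≅ ext1 (I ^ 1)) := by
  refine lc_iso I fun n hn f hf => ?_
  have hle : I ^ n ≤ I ^ 1 := Ideal.pow_le_pow_right hn
  constructor
  · refine (injective_iff_map_eq_zero (((Ext R (ModuleCat.{0} R) 1).map f.op).app (ModuleCat.of R R)).hom).2 ?_
    intro y hy
    obtain ⟨ψ, rfl⟩ := thetaJ_surj (I ^ 1) y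
    have h1 : thetaJ (I ^ n) (ψ ∘ₗ Submodule.inclusion hle) = 0 := (thetaJ_nat hle f hf ψ).symm.trans hy
    rw [thetaJ_zero] at h1 ⊢
    obtain ⟨x, hx⟩ := h1
    obtain ⟨g, hg, hψ⟩ := hT 1 le_rfl ψ
    obtain ⟨c, hc, hc0⟩ := Submodule.exists_mem_ne_zero_of_ne_bot (pow_ne_zero n hI)
    have h2 := hx ⟨c, hc⟩
    have h3 : ι c * g = ι c * ι x := by
      rw [← map_mul, ← h2]
      exact (hψ (Submodule.inclusion hle ⟨c, hc⟩)).symm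
    have h4 : g = ι x := mul_left_cancel₀ (fun h => hc0 (hι (by rw [h, map_zero]))) h3
    refine ⟨x, fun j => hι ?_⟩
    rw [hψ, h4, map_mul]
  · intro y
    obtain ⟨ψ, rfl⟩ := thetaJ_surj (I ^ n) y
    obtain ⟨g, hg, hψ⟩ := hT n hn ψ
    have hx : ∀ j : (I ^ 1 : Ideal R), ∃ x : R, ι x = ι j.1 * g := fun j => hT2 g hg j.1 ((le_of_eq (pow_one I)) j.2)
    choose F hF using hx
    let ψ' : (I ^ 1 : Ideal R) →ₗ[R] R :=
      { toFun := F
        map_add' := fun a b => hι (by rw [map_add, hF, hF, hF, Submodule.coe_add, map_add]; ring)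
        map_smul' := fun a b => hι (by
          rw [hF, RingHom.id_apply, smul_eq_mul, map_mul, hF, Submodule.coe_smul, smul_eq_mul, map_mul]; ring) }
    refine ⟨thetaJ (I ^ 1) ψ', (thetaJ_nat hle f hf ψ').trans ?_⟩
    congr 1
    ext j
    apply hι
    exact (hF _).trans (hψ j).symm
end
end

section
set_option linter.all false
set_option autoImplicit false
open MvPolynomial IsLocalRing
section
variable {A : Type} [CommRing A] {r : ℕ} {M : Submodule A (Fin r → A)}

lemma reg_two [IsLocalRing A] [IsNoetherianRing A] [IsDomain A] (hdim : ringKrullDim A = 2)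
    (hreg : ∃ x y : A, Ideal.span {x, y} = maximalIdeal A) [Infinite (ResidueField A)]
    (hM0 : M ≠ ⊥) (hs : ∃ s, ∀ a ∈ maximalIdeal A ^ s, ∀ f, a • f ∈ M) :
    ∃ u v : reesAlg A r M, u ∈ gradedMax A r M ∧ v ∈ gradedMax A r M ∧ u.1 ≠ 0 ∧
      ∀ f ∈ intClAlg A r M, ∀ g ∈ intClAlg A r M, v.1 * f = u.1 * g → ∃ h ∈ intClAlg A r M, f = u.1 * h := by
  obtain ⟨y, hy, hreg'⟩ := reg_seq hdim hreg inferInstance hM0 hs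
  have hI1 : (Finset.Iio (1 : Fin (r + 1 + 1))) = {0} := by
    ext j
    simp only [Finset.mem_Iio, Finset.mem_singleton, Fin.lt_def, Fin.ext_iff]
    simp
  have hI0 : (Finset.Iio (0 : Fin (r + 1 + 1))) = ∅ := by
    ext j; simp
  refine ⟨y 0, y 1, hy 0, hy 1, fun h => ?_, fun f hf g hg hfg => ?_⟩
  · obtain ⟨g', -, h1⟩ := hreg' 0 1 (one_mem _) (fun _ => 0) (fun _ => zero_mem _) (by rw [h, hI0]; simp)
    rw [hI0] at h1
    simp at h1
  · obtain ⟨g', hg', h1⟩ := hreg' 1 f hf (fun _ => g) (fun _ => hg) (by rw [hI1]; simpa using hfg)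
    rw [hI1] at h1
    exact ⟨g' 0, hg' 0, by simpa using h1⟩

lemma reg_pow [IsDomain A] {T : Subalgebra A (MvPolynomial (Fin r) A)} {u v : MvPolynomial (Fin r) A} (hu : u ∈ T) (hv : v ∈ T) (hu0 : u ≠ 0)
    (h : ∀ f ∈ T, ∀ g ∈ T, v * f = u * g → ∃ h ∈ T, f = u * h) (m n : ℕ) :
    ∀ f ∈ T, ∀ g ∈ T, v ^ m * f = u ^ n * g → ∃ h ∈ T, f = u ^ n * h := by
  have h1 : ∀ n, ∀ f ∈ T, ∀ g ∈ T, v * f = u ^ n * g → ∃ h ∈ T, f = u ^ n * h := by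
    intro n
    induction n with
    | zero => intro f hf g hg _; exact ⟨f, hf, by simp⟩
    | succ n ih =>
      intro f hf g hg hfg
      obtain ⟨f', hf', rfl⟩ := h f hf (u ^ n * g) (mul_mem (pow_mem hu n) hg) (by rw [hfg]; ring)
      obtain ⟨f'', hf'', rfl⟩ := ih f' hf' g hg (mul_left_cancel₀ hu0 (by
        calc u * (v * f') = v * (u * f') := by ring
          _ = _ := by rw [hfg]; ring))
      exact ⟨f'', hf'', by ring⟩
  induction m with
  | zero => intro f hf g hg hfg; exact ⟨g, hg, by simpa using hfg⟩
  | succ m ih =>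
    intro f hf g hg hfg
    obtain ⟨k, hk, hk2⟩ := ih (v * f) (mul_mem hv hf) g hg (by rw [← hfg]; ring)
    exact h1 n f hf k hk hk2

theorem three_lc [IsLocalRing A] [IsNoetherianRing A] [IsDomain A] (hdim : ringKrullDim A = 2)
    (hreg : ∃ x y : A, Ideal.span {x, y} = maximalIdeal A) [Infinite (ResidueField A)]
    (hM0 : M ≠ ⊥) (hs : ∃ s, ∀ a ∈ maximalIdeal A ^ s, ∀ f, a • f ∈ M)
    (h3a : (maximalIdeal A) • (barPow A r M 1) ≤ sub1 A r M) (h3 : sub1 A r M * barPow A r M 1 = (sub1 A r M) ^ 2) :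
    Nonempty (lcModA1 A r M ≃ₗ[A] quotNP A r (sub1 A r M) (barPow A r M 1)) := by
  obtain ⟨u, v, hu, hv, hu0, huv⟩ := reg_two hdim hreg hM0 hs
  have hI : gradedMax A r M ≠ ⊥ := fun h => by
    rw [h] at hu
    exact hu0 (congrArg Subtype.val ((Submodule.mem_bot _).1 hu))
  have hT : ∀ n, 1 ≤ n → ∀ ψ : (gradedMax A r M ^ n : Ideal (reesAlg A r M)) →ₗ[reesAlg A r M] reesAlg A r M,
      ∃ g ∈ (intClAlg A r M : Set (MvPolynomial (Fin r) A)), ∀ j, (ψ j).1 = j.1.1 * g := by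
    intro n hn ψ
    have hc : ∀ a b : (gradedMax A r M ^ n : Ideal (reesAlg A r M)), a.1.1 * (ψ b).1 = b.1.1 * (ψ a).1 := by
      intro a b
      have : a.1 • ψ b = b.1 • ψ a := by
        rw [← map_smul, ← map_smul]
        congr 1
        apply Subtype.ext
        simp only [Submodule.coe_smul, smul_eq_mul]
        ring
      exact congrArg Subtype.val this
    let a : (gradedMax A r M ^ n : Ideal (reesAlg A r M)) := ⟨u ^ n, Ideal.pow_mem_pow hu n⟩
    let b : (gradedMax A r M ^ n : Ideal (reesAlg A r M)) := ⟨v ^ n, Ideal.pow_mem_pow hv n⟩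
    obtain ⟨g, hg, hψ⟩ := reg_pow (rees_le_intCl u.2) (rees_le_intCl v.2) hu0 huv n n (ψ a).1 (rees_le_intCl (ψ a).2) (ψ b).1
      (rees_le_intCl (ψ b).2) (hc b a)
    refine ⟨g, hg, fun j => ?_⟩
    apply mul_left_cancel₀ (pow_ne_zero n hu0)
    have := hc a j
    rw [hψ] at this
    refine Eq.trans this ?_
    ring
  have hT2 : ∀ g ∈ (intClAlg A r M : Set (MvPolynomial (Fin r) A)), ∀ j ∈ gradedMax A r M, ∃ x : reesAlg A r M, x.1 = j.1 * g :=
    fun g hg j hj => ⟨⟨_, gmax_mul_int hdim hreg inferInstance hM0 hs h3a h3 j hj hg⟩, rfl⟩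
  obtain ⟨e⟩ := lc_iso' (gradedMax A r M) (reesAlg A r M).val.toRingHom Subtype.val_injective
    (intClAlg A r M : Set (MvPolynomial (Fin r) A)) hT hT2 hI
  have hmul : ∀ l : barPow A r M 1, ∀ j : (gradedMax A r M ^ 1 : Ideal (reesAlg A r M)), j.1.1 * l.1 ∈ reesAlg A r M :=
    fun l j => gmax_mul_int hdim hreg inferInstance hM0 hs h3a h3 j.1 ((le_of_eq (pow_one (gradedMax A r M))) j.2) (mem_bar1.1 l.2).2
  let μ : barPow A r M 1 → ((gradedMax A r M ^ 1 : Ideal (reesAlg A r M)) →ₗ[reesAlg A r M] reesAlg A r M) := fun l =>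
    { toFun := fun j => ⟨j.1.1 * l.1, hmul l j⟩
      map_add' := fun a b => Subtype.ext (add_mul a.1.1 b.1.1 l.1)
      map_smul' := fun a b => Subtype.ext (mul_assoc a.1 b.1.1 l.1) }
  have μadd : ∀ a b, μ (a + b) = μ a + μ b := fun a b => LinearMap.ext fun j => Subtype.ext (mul_add j.1.1 a.1 b.1)
  have μsmul : ∀ (a : A) b, μ (a • b) = (algebraMap A (reesAlg A r M) a) • μ b := fun a b => LinearMap.ext fun j => Subtype.ext (by
    show j.1.1 * (a • b.1) = C a * (j.1.1 * b.1)
    rw [← C_mul']; ring)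
  let Φ0 : ((gradedMax A r M ^ 1 : Ideal (reesAlg A r M)) →ₗ[reesAlg A r M] reesAlg A r M) →ₗ[reesAlg A r M]
      ((localCohomology (gradedMax A r M) 1).obj (ModuleCat.of ↥(reesAlg A r M) ↥(reesAlg A r M))) :=
    e.inv.hom ∘ₗ thetaJ (gradedMax A r M ^ 1)
  have hΦ0 : ∀ ψ, Φ0 ψ = 0 ↔ ∃ x : reesAlg A r M, ∀ j, ψ j = j.1 * x := fun ψ => by
    rw [← thetaJ_zero]
    exact map_eq_zero_iff _ (isoinj e)
  let Φ : barPow A r M 1 →ₗ[A] lcModA1 A r M :=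
    { toFun := fun l => Φ0 (μ l)
      map_add' := fun a b => by rw [μadd, map_add]; rfl
      map_smul' := fun a b => by rw [μsmul, map_smul]; rfl }
  have hsurj : Function.Surjective Φ := by
    intro y
    obtain ⟨y', rfl⟩ := isosurj e y
    obtain ⟨ψ, rfl⟩ := thetaJ_surj _ y'
    obtain ⟨g, hg, hψ⟩ := hT 1 le_rfl ψ
    obtain ⟨q, hq, l, hl, rfl⟩ := rb_decomp hdim hreg inferInstance hM0 hs h3 g hg
    refine ⟨⟨l, hl⟩, ?_⟩
    change Φ0 (μ ⟨l, hl⟩) = Φ0 ψ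
    rw [eq_comm, ← sub_eq_zero, ← map_sub, hΦ0]
    refine ⟨⟨q, hq⟩, fun j => Subtype.ext ?_⟩
    change (ψ j).1 - j.1.1 * l = j.1.1 * q
    rw [hψ]; ring
  have hker : LinearMap.ker Φ = (sub1 A r M).comap (barPow A r M 1).subtype := by
    ext l
    rw [LinearMap.mem_ker, Submodule.mem_comap]
    change Φ0 (μ l) = 0 ↔ l.1 ∈ sub1 A r M
    rw [hΦ0]
    constructor
    · rintro ⟨x, hx⟩
      have h1 := congrArg Subtype.val (hx ⟨u, by rw [pow_one]; exact hu⟩)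
      change u.1 * l.1 = u.1 * x.1 at h1
      have h2 := mul_left_cancel₀ hu0 h1
      have := rees_hom_mem (h2 ▸ x.2) (mem_bar1.1 l.2).1
      rwa [pow_one] at this
    · intro hl
      exact ⟨⟨l.1, pow_le_rees 1 (by rwa [pow_one])⟩, fun j => rfl⟩
  let Ψ : quotNP A r (sub1 A r M) (barPow A r M 1) →+ lcModA1 A r M :=
    QuotientAddGroup.lift _ Φ.toAddMonoidHom (fun l hl => by
      have : l ∈ LinearMap.ker Φ := by rw [hker]; exact hl
      exact this)
  have hΨ : ∀ l, Ψ (Submodule.Quotient.mk l) = Φ l := fun l => rfl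
  let Ψ' : quotNP A r (sub1 A r M) (barPow A r M 1) →ₗ[A] lcModA1 A r M :=
    { toFun := Ψ
      map_add' := fun a b => map_add Ψ a b
      map_smul' := fun a b => by
        obtain ⟨l, rfl⟩ := Submodule.Quotient.mk_surjective _ b
        rw [← Submodule.Quotient.mk_smul, hΨ, hΨ, map_smul]; rfl }
  refine ⟨(LinearEquiv.ofBijective Ψ' ⟨?_, ?_⟩).symm⟩
  · have h0 : Function.Injective Ψ := by
      rw [injective_iff_map_eq_zero]
      intro b hb
      obtain ⟨l, rfl⟩ := Submodule.Quotient.mk_surjective _ b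
      rw [Submodule.Quotient.mk_eq_zero, ← hker]
      exact hb
    exact h0
  · intro y
    obtain ⟨l, rfl⟩ := hsurj y
    exact ⟨Submodule.Quotient.mk l, rfl⟩
end
end

/-- Theorem 5.1. Let `(A, 𝔪)` be a two-dimensional regular local ring
with infinite residue field, `M ≠ (0)` a finitely generated torsion-free `A`-module with
`F = M** = A^r` (`r > 0`). Then the following are equivalent:
(1) `R(M)` is a Buchsbaum ring and `widetilde{M} = overline{M}`;
(2) `R(M)` is a Buchsbaum ring and `Proj R(M)` is normal;
(3) `𝔪·overline{M} ⊆ M` and `M·overline{M} = M²` (products computed in `S = Sym_A(F)`).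
When these hold, `H^1_𝔐(R(M))` is concentrated in degree one with
`[H^1_𝔐(R(M))]_1 ≅ overline{M}/M`, and `overline{M^n} = M^n` for every `n ≥ 2`. -/
theorem ratliffRush_statement_18 (A : Type) [CommRing A] [IsLocalRing A]
    [IsNoetherianRing A]
    (hdim : ringKrullDim A = 2)
    (hreg : ∃ x y : A, Ideal.span {x, y} = maximalIdeal A)
    (hres : Infinite (ResidueField A))
    (r : ℕ) (hr : 0 < r) (M : Submodule A (Fin r → A)) (hM0 : M ≠ ⊥)
    (hlen : ∃ n : ℕ, modLength A ((Fin r → A) ⧸ M) = (n : WithBot ℕ∞)) :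
    List.TFAE [
      IsBuchsbaumLocalRing (Localization.AtPrime (gradedMax A r M)) ∧
        ratliffRush A r (freeSub A r) (sub1 A r M) = barPow A r M 1,
      IsBuchsbaumLocalRing (Localization.AtPrime (gradedMax A r M)) ∧
        ∀ (P : Ideal ↥(reesAlg A r M)) [P.IsPrime],
          IsGradedIdeal A r (reesAlg A r M) P → ¬ (posPart A r (reesAlg A r M) ≤ P) →
          IsIntegrallyClosed (Localization.AtPrime P),
      (maximalIdeal A) • (barPow A r M 1) ≤ sub1 A r M ∧
        sub1 A r M * barPow A r M 1 = (sub1 A r M) ^ 2] ∧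
    ((IsBuchsbaumLocalRing (Localization.AtPrime (gradedMax A r M)) ∧
        ratliffRush A r (freeSub A r) (sub1 A r M) = barPow A r M 1) →
      Nonempty (lcModA1 A r M ≃ₗ[A] quotNP A r (sub1 A r M) (barPow A r M 1)) ∧
      ∀ n : ℕ, 2 ≤ n → barPow A r M n = (sub1 A r M) ^ n) := by
  haveI : IsDomain A := by
    obtain ⟨x, y, hm⟩ := hreg
    exact (reg_domain hdim hm).1
  have hs := hfin_of_len hlen
  haveI := hres
  have h13 : (IsBuchsbaumLocalRing (Localization.AtPrime (gradedMax A r M)) ∧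
        ratliffRush A r (freeSub A r) (sub1 A r M) = barPow A r M 1) →
      ((maximalIdeal A) • (barPow A r M 1) ≤ sub1 A r M ∧
        sub1 A r M * barPow A r M 1 = (sub1 A r M) ^ 2) :=
    fun h => one_three hdim hM0 hs h.1 h.2
  refine ⟨?_, fun h => ?_⟩
  · tfae_have 1 → 3 := h13
    tfae_have 2 → 3 := fun h => two_three hdim hreg hM0 hs h.1 h.2
    tfae_have 3 → 1 := fun h3 =>
      ⟨three_buchs hdim hreg hres hM0 hs h3.1 h3.2, three_rr hM0 h3.2⟩
    tfae_have 3 → 2 := fun h3 =>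
      ⟨three_buchs hdim hreg hres hM0 hs h3.1 h3.2,
        fun P _ _ hP => three_normal hdim hreg hres hM0 hs h3.1 h3.2 P hP⟩
    tfae_finish
  · have h3 := h13 h
    exact ⟨three_lc hdim hreg hM0 hs h3.1 h3.2,
      fun n hn => three_bar hdim hreg hres hM0 hs h3.2 n hn⟩
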